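/- Let Φ = D_n, let I, J ⊆ Δ with ^IW^J ≠ ∅, and let λ̄ be a dominant integral weight with Φ_{λ̄} = Φ_J. Then: (1) if (Φ, Φ_I, Φ_J) is not separable, it has exactly one block; (2) if (Φ, Φ_I, Φ_J) is weakly separable, it has exactly two blocks when (n_m, n̄_{m̄}) = (m̄, m), and exactly one block otherwise; (3) if (Φ, Φ_I, Φ_J) is weakly separable and has two blocks, then λ, μ ∈ ^IW^Jλ̄ belong to the same block if and only if P(λ) = P(μ). -/

import Mathlib

namespace JantzenBlocks

open scoped Classical

/-- The three classical types `B`, `C`, `D`. -/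
inductive CType : Type
  | B | C | D
deriving DecidableEq

/-- The weight space `ℝ^n`. -/
abbrev V (n : ℕ) := Fin n → ℝ

noncomputable section

/-- The standard inner product on `ℝ^n`. -/
def inn {n : ℕ} (x y : V n) : ℝ := ∑ i, x i * y i

/-- The standard basis vector `e i`. -/
def ee {n : ℕ} (i : Fin n) : V n := Pi.single i 1

/-- The reflection `s_v` in the vector `v`. -/
def sRefl {n : ℕ} (v x : V n) : V n := x - (2 * inn x v / inn v v) • v

/-- The roots `±e_i ± e_j` (`i ≠ j`), i.e. the root system of type `D_n`. -/
def DRoots (n : ℕ) : Set (V n) :=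
  {v | ∃ i j : Fin n, i ≠ j ∧ (v = ee i + ee j ∨ v = ee i - ee j ∨ v = -ee i - ee j)}

/-- The ambient root system `Φ` of type `B_n`, `C_n` or `D_n`. -/
def Phi (n : ℕ) : CType → Set (V n)
  | CType.B => DRoots n ∪ {v | ∃ i : Fin n, v = ee i ∨ v = -ee i}
  | CType.C => DRoots n ∪ {v | ∃ i : Fin n, v = (2:ℝ) • ee i ∨ v = -((2:ℝ) • ee i)}
  | CType.D => DRoots n

/-- The standard positive system `Φ⁺`: roots whose first nonzero coordinate is positive. -/
def PhiPos (n : ℕ) (ct : CType) : Set (V n) :=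
  {v | v ∈ Phi n ct ∧ ∃ i : Fin n, 0 < v i ∧ ∀ j : Fin n, j < i → v j = 0}

/-- The simple root `α_{i+1}` (`0`-based index `i`). -/
def alphaR (n : ℕ) (ct : CType) (i : Fin n) : V n :=
  if h : i.1 + 1 < n then ee i - ee ⟨i.1 + 1, h⟩
  else
    match ct with
    | CType.B => ee i
    | CType.C => (2:ℝ) • ee i
    | CType.D => ee ⟨n - 2, Nat.sub_lt i.pos (by norm_num)⟩ + ee i

/-- The subsystem `Φ_I` generated by the simple roots indexed by `I`. -/
def PhiI (n : ℕ) (ct : CType) (I : Finset (Fin n)) : Set (V n) :=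
  Phi n ct ∩ (Submodule.span ℝ (alphaR n ct '' (I : Set (Fin n))) : Set (V n))

/-- `λ` is `Φ_I`-regular. -/
def RegI (n : ℕ) (ct : CType) (I : Finset (Fin n)) (lam : V n) : Prop :=
  ∀ β ∈ PhiI n ct I, inn lam β ≠ 0

/-- `λ` is integral. -/
def IntegralW (n : ℕ) (ct : CType) (lam : V n) : Prop :=
  ∀ β ∈ Phi n ct, ∃ k : ℤ, 2 * inn lam β / inn β β = (k : ℝ)

/-- `λ` is dominant. -/
def DominantW (n : ℕ) (ct : CType) (lam : V n) : Prop :=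
  ∀ i : Fin n, 0 ≤ inn lam (alphaR n ct i)

/-- `μ` lies in the `W_I`-orbit of `λ` (`W_I` generated by the reflections `s_α`, `α ∈ I`). -/
def WIOrb (n : ℕ) (ct : CType) (I : Finset (Fin n)) : V n → V n → Prop :=
  Relation.ReflTransGen (fun x y => ∃ i ∈ I, y = sRefl (alphaR n ct i) x)

/-- `μ` lies in the `W`-orbit of `λ`. -/
def WOrb (n : ℕ) (ct : CType) : V n → V n → Prop := WIOrb n ct Finset.univ

/-- `λ ∈ Λ_I⁺`. -/
def LamIPlus (n : ℕ) (ct : CType) (I : Finset (Fin n)) (lam : V n) : Prop :=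
  IntegralW n ct lam ∧ ∀ i ∈ I, 0 < inn lam (alphaR n ct i)

/-- The sorted list `q_1 < q_2 < … < q_{m-1}` (`1`-based values) of indices of `Δ∖I`. -/
def Qlist (n : ℕ) (I : Finset (Fin n)) : List ℕ :=
  ((Finset.univ \ I).sort (· ≤ ·)).map (fun j => j.1 + 1)

/-- The number `m` of segments determined by `I`. -/
def mval (n : ℕ) (I : Finset (Fin n)) : ℕ := (Qlist n I).length + 1

/-- `q_s`, with the conventions `q_0 = 0` and `q_m = n`. -/
def qval (n : ℕ) (I : Finset (Fin n)) (s : ℕ) : ℕ :=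
  if s = 0 then 0 else if s < mval n I then (Qlist n I).getD (s - 1) 0 else n

/-- `I` is standard (automatic in types `B`, `C`). -/
def StandardI (n : ℕ) (ct : CType) (I : Finset (Fin n)) : Prop :=
  ct = CType.D → ∀ h : 2 ≤ n,
    ((⟨n - 2, by omega⟩ : Fin n) ∈ I ∨ (⟨n - 1, by omega⟩ : Fin n) ∉ I)

/-- `q_s`, corrected for nonstandard `I` (where `q_{m-1}` is replaced by `n`,
so that the `(m-1)`-st segment is `(q_{m-2}, n]` and the `m`-th segment is empty). -/
def qv (n : ℕ) (ct : CType) (I : Finset (Fin n)) (s : ℕ) : ℕ :=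
  if ¬ StandardI n ct I ∧ s = mval n I - 1 then n else qval n I s

/-- The segment length `n_s`. -/
def nsval (n : ℕ) (ct : CType) (I : Finset (Fin n)) (s : ℕ) : ℕ :=
  qv n ct I s - qv n ct I (s - 1)

/-- The (`0`-based) index `i` lies in the `s`-th segment, i.e. `q_{s-1} < i+1 ≤ q_s`. -/
def InSeg (n : ℕ) (ct : CType) (I : Finset (Fin n)) (s : ℕ) (i : Fin n) : Prop :=
  qv n ct I (s - 1) < i.1 + 1 ∧ i.1 + 1 ≤ qv n ct I s

/-- `n_s^λ(a)`: the number of entries of the `s`-th segment of `λ` with absolute value `a`. -/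
def nsl (n : ℕ) (ct : CType) (I : Finset (Fin n)) (lam : V n) (s : ℕ) (a : ℝ) : ℕ :=
  (Finset.univ.filter (fun i : Fin n => InSeg n ct I s i ∧ |lam i| = a)).card

/-- `a_t = λ̄_{q̄_t}` for `1 ≤ t < m̄`, and `a_{m̄} = 0`. -/
def aval (n : ℕ) (ct : CType) (J : Finset (Fin n)) (lbar : V n) (t : ℕ) : ℝ :=
  if t < mval n J then
    (if h : qv n ct J t - 1 < n then lbar ⟨qv n ct J t - 1, h⟩ else 0)
  else 0

/-- `n_s^λ(a)` is maximal among all `Φ_I`-regular weights in the orbit of `λ`. -/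
def IsMaxN (n : ℕ) (ct : CType) (I : Finset (Fin n)) (lam : V n) (s : ℕ) (a : ℝ) : Prop :=
  ∀ mu : V n, WOrb n ct lam mu → RegI n ct I mu →
    nsl n ct I mu s a ≤ nsl n ct I lam s a

/-- The exceptional configurations of Proposition 4.7 (types `B` and `C`, with
`shortR i` the short/long root `e_i` resp. `2e_i`). -/
def ExcBC (n : ℕ) (ct : CType) (I : Finset (Fin n)) (shortR : Fin n → V n)
    (lam β : V n) : Prop :=
  ∃ s : ℕ, 1 ≤ s ∧ s < mval n I ∧ ∃ a : ℝ, 0 < a ∧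
    nsl n ct I lam s a = 1 ∧
    nsl n ct I lam s 0 + nsl n ct I lam (mval n I) a = 1 ∧
    ((∃ i j : Fin n, InSeg n ct I s i ∧ InSeg n ct I s j ∧
        |lam i| = a ∧ lam j = 0 ∧ (β = shortR i ∨ β = ee i + ee j)) ∨
     (∃ i j : Fin n, InSeg n ct I s i ∧ InSeg n ct I (mval n I) j ∧
        ((lam i = a ∧ lam j = a) ∨ (lam i = -a ∧ lam j = -a)) ∧
        (β = shortR i ∨ β = ee i + ee j)) ∨
     (∃ i j : Fin n, InSeg n ct I s i ∧ InSeg n ct I (mval n I) j ∧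
        ((lam i = a ∧ lam j = -a) ∨ (lam i = -a ∧ lam j = a)) ∧
        (β = shortR i ∨ β = ee i - ee j)))

/-- The exceptional configurations of Proposition 4.7 (type `D`). -/
def ExcD (n : ℕ) (I : Finset (Fin n)) (lam β : V n) : Prop :=
  ∃ s : ℕ, 1 ≤ s ∧ s < mval n I ∧ ∃ a : ℝ, 0 < a ∧
    nsl n CType.D I lam s a = 1 ∧ nsl n CType.D I lam (mval n I) a = 1 ∧
    nsl n CType.D I lam s 0 = 1 ∧ nsl n CType.D I lam (mval n I) 0 = 1 ∧
    ∃ i j k l : Fin n, InSeg n CType.D I s i ∧ InSeg n CType.D I s j ∧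
      InSeg n CType.D I (mval n I) k ∧ InSeg n CType.D I (mval n I) l ∧
      lam j = 0 ∧ lam l = 0 ∧
      ((((lam i = a ∧ lam k = a) ∨ (lam i = -a ∧ lam k = -a)) ∧
          (β = ee i + ee j ∨ β = ee i + ee k)) ∨
       (((lam i = a ∧ lam k = -a) ∨ (lam i = -a ∧ lam k = a)) ∧
          (β = ee i + ee j ∨ β = ee i - ee k)))

/-- The exceptional configurations in which `β` fails to be a linked root. -/
def Exc (n : ℕ) (ct : CType) (I : Finset (Fin n)) (lam β : V n) : Prop :=
  match ct with
  | CType.B => ExcBC n CType.B I (fun i => ee i) lam β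
  | CType.C => ExcBC n CType.C I (fun i => (2:ℝ) • ee i) lam β
  | CType.D => ExcD n I lam β

/-- `β` is a linked root of the `Φ_I`-regular weight `λ` (for standard `I`). -/
def PlainLinked (n : ℕ) (ct : CType) (I : Finset (Fin n)) (lam β : V n) : Prop :=
  RegI n ct I lam ∧ β ∈ PhiPos n ct ∧ β ∉ PhiI n ct I ∧
  RegI n ct I (sRefl β lam) ∧ sRefl β lam ≠ lam ∧ ¬ Exc n ct I lam β

/-- The transposition of the last two indices. -/
def swapLast (n : ℕ) (j : Fin n) : Fin n :=
  if j.1 = n - 1 then ⟨n - 2, Nat.sub_lt j.pos (by norm_num)⟩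
  else if j.1 = n - 2 then ⟨n - 1, Nat.sub_lt j.pos (by norm_num)⟩
  else j

/-- The isomorphism `φ = s_{e_n}` (negating the last coordinate). -/
def phiW {n : ℕ} (x : V n) : V n := fun j => if j.1 = n - 1 then -x j else x j

/-- The image `φ(I)` of an index set under `φ` (interchanging `α_{n-1}` and `α_n`). -/
def phiIdx (n : ℕ) (I : Finset (Fin n)) : Finset (Fin n) := I.image (swapLast n)

/-- `β` is a linked root of `λ`; for nonstandard `I` the notion is transported along `φ`. -/
def LinkedRoot (n : ℕ) (ct : CType) (I : Finset (Fin n)) (lam β : V n) : Prop :=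
  if StandardI n ct I then PlainLinked n ct I lam β
  else PlainLinked n ct (phiIdx n I) (phiW lam) (phiW β)

/-- One step in a connecting chain: `y ∈ W_I x`, or `y = w s_β x` for a linked root `β` of `x`. -/
def ConnStep (n : ℕ) (ct : CType) (I : Finset (Fin n)) (x y : V n) : Prop :=
  RegI n ct I x ∧ RegI n ct I y ∧
  (WIOrb n ct I x y ∨ ∃ β : V n, LinkedRoot n ct I x β ∧ WIOrb n ct I (sRefl β x) y)

/-- `λ ⟷ μ`: `λ` and `μ` are connected by a chain of linked roots. -/
def Conn (n : ℕ) (ct : CType) (I : Finset (Fin n)) (lam mu : V n) : Prop :=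
  RegI n ct I lam ∧ RegI n ct I mu ∧
  Relation.ReflTransGen (ConnStep n ct I) lam mu

/-- The set `^IW^Jλ̄ = Wλ̄ ∩ Λ_I⁺` of weights parametrizing the simple modules. -/
def IWJset (n : ℕ) (ct : CType) (I : Finset (Fin n)) (lbar : V n) : Set (V n) :=
  {mu | WOrb n ct lbar mu ∧ LamIPlus n ct I mu}

/-- `(S, S̄)` is a separable pair for the weight `λ`. -/
def IsSepPair (n : ℕ) (ct : CType) (I J : Finset (Fin n)) (lbar lam : V n)
    (S Sb : Finset ℕ) : Prop :=
  S.Nonempty ∧ Sb.Nonempty ∧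
  S ⊆ Finset.Icc 1 (mval n I) ∧ Sb ⊆ Finset.Icc 1 (mval n J) ∧
  1 < mval n I ∧ 1 < mval n J ∧
  (∀ s ∈ S, ∀ t ∈ Sb, IsMaxN n ct I lam s (aval n ct J lbar t)) ∧
  (∀ s ∈ Finset.Icc 1 (mval n I), s ∉ S →
     ∀ t ∈ Finset.Icc 1 (mval n J), t ∉ Sb →
       nsl n ct I lam s (aval n ct J lbar t) = 0) ∧
  (match ct with
   | CType.B => (mval n I ∈ S ↔ mval n J ∉ Sb)
   | CType.C => (mval n I ∈ S ↔ mval n J ∉ Sb)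
   | CType.D => (mval n I ∈ S ↔ mval n J ∈ Sb))

/-- `𝒟`: the set of separable pairs of the system `(Φ, Φ_I, Φ_J)`. -/
def DSet (n : ℕ) (ct : CType) (I J : Finset (Fin n)) (lbar : V n) :
    Set (Finset ℕ × Finset ℕ) :=
  {p | ∀ lam ∈ IWJset n ct I lbar, IsSepPair n ct I J lbar lam p.1 p.2}

/-- The four weakly separable pairs. -/
def IsWeakPair (n : ℕ) (I J : Finset (Fin n)) (p : Finset ℕ × Finset ℕ) : Prop :=
  p = (Finset.Icc 1 (mval n I - 1), {mval n J}) ∨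
  p = (Finset.Icc 1 (mval n I), {mval n J}) ∨
  p = ({mval n I}, Finset.Icc 1 (mval n J - 1)) ∨
  p = ({mval n I}, Finset.Icc 1 (mval n J))

/-- The system `(Φ, Φ_I, Φ_J)` is separable. -/
def SepSys (n : ℕ) (ct : CType) (I J : Finset (Fin n)) (lbar : V n) : Prop :=
  (DSet n ct I J lbar).Nonempty

/-- The system `(Φ, Φ_I, Φ_J)` is strongly separable. -/
def StronglySepSys (n : ℕ) (ct : CType) (I J : Finset (Fin n)) (lbar : V n) : Prop :=
  ∃ p ∈ DSet n ct I J lbar, ¬ IsWeakPair n I J p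

/-- The system `(Φ, Φ_I, Φ_J)` is weakly separable. -/
def WeaklySepSys (n : ℕ) (ct : CType) (I J : Finset (Fin n)) (lbar : V n) : Prop :=
  SepSys n ct I J lbar ∧ ∀ p ∈ DSet n ct I J lbar, IsWeakPair n I J p

/-- The partial ordering on separable pairs: `(S₁,S̄₁) ≤ (S₂,S̄₂)` iff `S₁ ⊆ S₂`, `S̄₁ ⊇ S̄₂`. -/
def pairLE (p q : Finset ℕ × Finset ℕ) : Prop := p.1 ⊆ q.1 ∧ q.2 ⊆ p.2

/-- Strict version of `pairLE`. -/
def pairLT (p q : Finset ℕ × Finset ℕ) : Prop := pairLE p q ∧ p ≠ q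

/-- The generating relations of the equivalence `∼` on `𝒟`. -/
def PairRel (D : Set (Finset ℕ × Finset ℕ)) (p q : Finset ℕ × Finset ℕ) : Prop :=
  p ∈ D ∧ q ∈ D ∧ ((p.2 = q.2 ∧ p.1 ⊆ q.1) ∨ (p.1 = q.1 ∧ p.2 ⊆ q.2))

/-- The equivalence relation `∼` on separable pairs. -/
def PairEquiv (D : Set (Finset ℕ × Finset ℕ)) :
    Finset ℕ × Finset ℕ → Finset ℕ × Finset ℕ → Prop :=
  Relation.EqvGen (PairRel D)

/-- A trivial separable pair. -/
def TrivialPair (n : ℕ) (ct : CType) (I J : Finset (Fin n)) (lbar : V n)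
    (p : Finset ℕ × Finset ℕ) : Prop :=
  match ct with
  | CType.B | CType.C =>
    (∃ s0 : ℕ, 1 ≤ s0 ∧ s0 < mval n I ∧
       PairEquiv (DSet n ct I J lbar) p ({s0}, Finset.Icc 1 (mval n J))) ∨
    (∃ t0 : ℕ, 1 ≤ t0 ∧ t0 < mval n J ∧
       PairEquiv (DSet n ct I J lbar) p (Finset.Icc 1 (mval n I), {t0}))
  | CType.D =>
    (∃ s0 : ℕ, 1 ≤ s0 ∧ s0 < mval n I ∧
       PairEquiv (DSet n ct I J lbar) p ({s0}, Finset.Icc 1 (mval n J - 1))) ∨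
    (∃ t0 : ℕ, 1 ≤ t0 ∧ t0 < mval n J ∧
       PairEquiv (DSet n ct I J lbar) p (Finset.Icc 1 (mval n I - 1), {t0}))

/-- The set of blocks: equivalence classes of `^IW^Jλ̄` under `⟷`. -/
def BlockSet (n : ℕ) (ct : CType) (I : Finset (Fin n)) (lbar : V n) : Set (Set (V n)) :=
  {Cl | ∃ lam ∈ IWJset n ct I lbar,
     Cl = {mu | mu ∈ IWJset n ct I lbar ∧ Conn n ct I lam mu}}

/-- The parity `P(λ)` of the number of negative entries of `λ`. -/
def Pfun (n : ℕ) (lam : V n) : ℕ :=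
  (Finset.univ.filter (fun i : Fin n => lam i < 0)).card % 2

/-- A fundamental chain `c 1 ∼ c 2 ∼ … ∼ c k` in `𝒟`. -/
def IsFundChain (D : Set (Finset ℕ × Finset ℕ)) (c : ℕ → Finset ℕ × Finset ℕ)
    (k : ℕ) : Prop :=
  1 ≤ k ∧ (∀ i, 1 ≤ i → i ≤ k → c i ∈ D) ∧
  (∀ i, 1 ≤ i → i < k →
     ((c i).1 = (c (i+1)).1 ∨ (c i).2 = (c (i+1)).2) ∧
     (pairLT (c i) (c (i+1)) ∨ pairLT (c (i+1)) (c i)))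

/-- The list of parts of the partition `π_I`. -/
def piParts (n : ℕ) (ct : CType) (I : Finset (Fin n)) : List ℕ :=
  (List.range (mval n I - 1)).map (fun s => nsval n ct I (s+1)) ++
  (List.range (mval n I - 1)).map (fun s => nsval n ct I (s+1)) ++
  (match ct with
   | CType.B => [2 * nsval n ct I (mval n I) + 1]
   | CType.C => [2 * nsval n ct I (mval n I)]
   | CType.D => if nsval n ct I (mval n I) = 0 then []
                else [2 * nsval n ct I (mval n I) - 1, 1])

/-- The `i`-th part (`1`-based) of the partition with list of parts `L`. -/
def partAt (L : List ℕ) (i : ℕ) : ℕ :=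
  (L.mergeSort (fun a b => decide (b ≤ a))).getD (i - 1) 0

/-- The `i`-th part (`1`-based) of the dual partition `π^t`: the number of parts `≥ i`. -/
def dualAt (L : List ℕ) (i : ℕ) : ℕ :=
  (L.filter (fun x => decide (i ≤ x))).length

/-- `k` is compatible with the system `(Φ, Φ_I, Φ_J)`. -/
def CompatibleK (n : ℕ) (ct : CType) (I J : Finset (Fin n)) (k : ℕ) : Prop :=
  1 ≤ k ∧ k ≤ 2 * mval n I - 1 ∧
  (match ct with
   | CType.B =>
     (Odd k ∧ k ≤ partAt (piParts n CType.B J) 2 ∧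
        2 * nsval n CType.B J (mval n J) + 1 ≤ k ∧
        partAt (piParts n CType.B I) k ≤ 2 * nsval n CType.B I (mval n I) + 1) ∨
     (Even k ∧ k ≤ 2 * nsval n CType.B J (mval n J) ∧
        2 * nsval n CType.B I (mval n I) + 1 ≤ partAt (piParts n CType.B I) k)
   | CType.C =>
     (Odd k ∧ k ≤ partAt (piParts n CType.C J) 2 ∧
        2 * nsval n CType.C J (mval n J) + 1 ≤ k ∧
        partAt (piParts n CType.C I) k ≤ 2 * nsval n CType.C I (mval n I)) ∨
     (Even k ∧ k ≤ 2 * nsval n CType.C J (mval n J) ∧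
        2 * nsval n CType.C I (mval n I) + 1 ≤ partAt (piParts n CType.C I) k)
   | CType.D =>
     (Even k ∧ k ≤ partAt (piParts n CType.D J) 2 ∧
        2 * nsval n CType.D J (mval n J) ≤ k ∧
        2 * nsval n CType.D I (mval n I) ≤ partAt (piParts n CType.D I) k) ∨
     (Odd k ∧ k ≤ 2 * nsval n CType.D J (mval n J) - 1 ∧
        partAt (piParts n CType.D I) k ≤ 2 * nsval n CType.D I (mval n I) - 1))

/-- `s_{e_{k_1}}^{ε_1} ⋯ s_{e_{k_r}}^{ε_r} μ`. -/
def applyFlips (n : ℕ) (ks : ℕ → Fin n) (eps : ℕ → Bool) : ℕ → V n → V n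
  | 0, v => v
  | (r+1), v =>
      if eps (r+1) then sRefl (ee (ks (r+1))) (applyFlips n ks eps r v)
      else applyFlips n ks eps r v

end

set_option linter.all false
section Ryser
variable {R C : Type} [Fintype R] [Fintype C]

noncomputable def swt (p q : R) (a b : C) (N : R → C → ℤ) : R → C → ℤ := fun r c =>
  N r c + (if r = p then (if c = a then -1 else if c = b then 1 else 0) else
    if r = q then (if c = a then 1 else if c = b then -1 else 0) else 0)

def Om (cap : R → C → ℤ) (ρ : R → ℤ) (κ : C → ℤ) (N : R → C → ℤ) : Prop :=
  (∀ r c, 0 ≤ N r c ∧ N r c ≤ cap r c) ∧ (∀ r, ∑ c, N r c = ρ r) ∧ (∀ c, ∑ r, N r c = κ c)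

lemma swt_inv {p q : R} {a b : C} (hab : a ≠ b) (N : R → C → ℤ) :
    swt p q b a (swt p q a b N) = N := by
  funext r c; simp only [swt]; split_ifs <;> simp_all

lemma swt_Om {cap : R → C → ℤ} {ρ κ} {N : R → C → ℤ} (h : Om cap ρ κ N) {p q : R} {a b : C}
    (hpq : p ≠ q) (hab : a ≠ b) (h1 : 0 < N p a) (h2 : 0 < N q b) (h3 : N p b < cap p b)
    (h4 : N q a < cap q a) : Om cap ρ κ (swt p q a b N) := by
  obtain ⟨hc, hr, hk⟩ := h
  refine ⟨fun r c => ?_, fun r => ?_, fun c => ?_⟩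
  · have := hc r c
    simp only [swt]; split_ifs <;> subst_vars <;> first | omega | (exfalso; simp_all)
  · rw [← hr r]
    simp only [swt, Finset.sum_add_distrib, add_eq_left]
    by_cases hp : r = p
    · simp only [hp, if_true]
      have : ∀ c, (if c = a then (-1:ℤ) else if c = b then 1 else 0)
        = (if c = a then -1 else 0) + (if c = b then 1 else 0) := by
        intro c; split_ifs <;> simp_all
      simp [this, Finset.sum_add_distrib]
    · by_cases hq : r = q
      · simp only [if_neg hp, hq, if_true]
        have : ∀ c, (if q = p then (if c = a then (-1:ℤ) else if c = b then 1 else 0) else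
          if c = a then 1 else if c = b then -1 else 0)
          = (if c = a then 1 else 0) + (if c = b then -1 else 0) := by
          intro c; split_ifs <;> simp_all
        simp [this, Finset.sum_add_distrib]
      · simp [hp, hq]
  · rw [← hk c]
    simp only [swt, Finset.sum_add_distrib, add_eq_left]
    have : ∀ r, (if r = p then (if c = a then (-1:ℤ) else if c = b then 1 else 0) else
          if r = q then (if c = a then 1 else if c = b then -1 else 0) else 0)
          = (if r = p then (if c = a then (-1:ℤ) else if c = b then 1 else 0) else 0) +
           (if r = q then (if c = a then 1 else if c = b then -1 else 0) else 0) := by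
      intro r; split_ifs <;> simp_all
    simp only [this, Finset.sum_add_distrib, Finset.sum_ite_eq', Finset.mem_univ, if_true]
    split_ifs <;> simp_all

def SwR (cap : R → C → ℤ) (ρ : R → ℤ) (κ : C → ℤ) (M M' : R → C → ℤ) : Prop :=
  Om cap ρ κ M ∧ Om cap ρ κ M' ∧ ∃ p q a b, p ≠ q ∧ a ≠ b ∧ M' = swt p q a b M

lemma SwR.symm {cap : R → C → ℤ} {ρ κ} {M M' : R → C → ℤ} (h : SwR cap ρ κ M M') :
    SwR cap ρ κ M' M := by
  obtain ⟨h1, h2, p, q, a, b, hp, ha, rfl⟩ := h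
  exact ⟨h2, h1, p, q, b, a, hp, ha.symm, (swt_inv ha _).symm⟩

lemma ex_neg {T : Type} [Fintype T] (f : T → ℤ) (h : ∑ x, f x = 0) (x : T) (hx : 0 < f x) :
    ∃ y, f y < 0 := by
  by_contra hc
  push Not at hc
  have := (Finset.sum_eq_zero_iff_of_nonneg (fun i _ => hc i)).1 h x (Finset.mem_univ _)
  omega

lemma dist_lt (D D' : R → C → ℤ) (r1 r2 : R) (c1 c2 : C) (hr : r1 ≠ r2) (hc : c1 ≠ c2)
    (h : ∀ r c, |D' r c| ≤ |D r c| + (if r = r1 ∧ c = c1 then -1 else 0)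
      + (if r = r2 ∧ c = c1 then -1 else 0) + (if r = r2 ∧ c = c2 then -1 else 0)
      + (if r = r1 ∧ c = c2 then 1 else 0)) :
    ∑ e : R × C, |D' e.1 e.2| < ∑ e : R × C, |D e.1 e.2| := by
  have h0 : ∀ (x : R) (y : C) (z : ℤ), ∑ e : R × C, (if e.1 = x ∧ e.2 = y then z else 0) = z := by
    intro x y z
    rw [Finset.sum_eq_single (x, y)] <;> simp
    intro a b h1 h2 h3; exact absurd h3 (h1 h2)
  have := Finset.sum_le_sum (fun (e : R × C) (_ : e ∈ Finset.univ) => h e.1 e.2)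
  simp only [Finset.sum_add_distrib, h0] at this
  omega

theorem ryser {cap : R → C → ℤ} {ρ κ} (hcap : ∀ r c, 1 ≤ cap r c) :
    ∀ (k : ℕ) (M M' : R → C → ℤ), Om cap ρ κ M → Om cap ρ κ M' →
    ∑ e : R × C, |M' e.1 e.2 - M e.1 e.2| ≤ k → Relation.ReflTransGen (SwR cap ρ κ) M M' := by
  intro k
  induction k using Nat.strong_induction_on with
  | _ k ih =>
  intro M M' hM hM' hk
  by_cases hE : M = M'
  · rw [hE]
  have hrow : ∀ r, ∑ c, (M' r c - M r c) = 0 := fun r => by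
    rw [Finset.sum_sub_distrib, hM.2.1, hM'.2.1, sub_self]
  have hcol : ∀ c, ∑ r, (M' r c - M r c) = 0 := fun r => by
    rw [Finset.sum_sub_distrib, hM.2.2, hM'.2.2, sub_self]
  have hrow' : ∀ r, ∑ c, -(M' r c - M r c) = 0 := fun r => by
    rw [Finset.sum_neg_distrib, hrow, neg_zero]
  let Pos : R → Finset C := fun r => Finset.univ.filter (fun c => 0 < M' r c - M r c)
  have hex : ∃ r, (Pos r).Nonempty := by
    by_contra hn
    push Not at hn
    apply hE
    funext r c
    have h1 : ∀ c, M' r c - M r c ≤ 0 := by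
      intro c
      by_contra h
      have : c ∈ Pos r := by simp [Pos]; omega
      rw [hn r] at this
      simp at this
    by_contra h2
    obtain ⟨y, hy⟩ := ex_neg (fun c => -(M' r c - M r c)) (hrow' r) c (by have := h1 c; omega)
    have := h1 y
    omega
  obtain ⟨r1, hr1, hmin⟩ := Finset.exists_min_image (Finset.univ.filter (fun r => (Pos r).Nonempty))
    (fun r => (Pos r).card) (by obtain ⟨r, hr⟩ := hex; exact ⟨r, by simpa using hr⟩)
  obtain ⟨c1, hc1⟩ := (Finset.mem_filter.1 hr1).2
  have hc1' : 0 < M' r1 c1 - M r1 c1 := (Finset.mem_filter.1 hc1).2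
  obtain ⟨r2, hr2⟩ := ex_neg (fun r => M' r c1 - M r c1) (hcol c1) r1 hc1'

  have h12 : r1 ≠ r2 := by rintro rfl; omega
  have hex2 : ∃ c2, 0 < M' r2 c2 - M r2 c2 ∧ M' r1 c2 - M r1 c2 ≤ 0 := by
    by_contra hn
    push Not at hn
    obtain ⟨c2, h2⟩ := ex_neg (fun c => -(M' r2 c - M r2 c)) (hrow' r2) c1 (by omega)
    have hlt : (Pos r2).card < (Pos r1).card := by
      apply Finset.card_lt_card
      refine ⟨fun c hc => ?_, fun hh => ?_⟩
      · have h3 := (Finset.mem_filter.1 hc).2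
        exact Finset.mem_filter.2 ⟨Finset.mem_univ _, by have := hn c h3; omega⟩
      · have := (Finset.mem_filter.1 (hh hc1)).2; omega
    have := hmin r2 (Finset.mem_filter.2 ⟨Finset.mem_univ _, ⟨c2, Finset.mem_filter.2
      ⟨Finset.mem_univ _, by omega⟩⟩⟩)
    omega
  obtain ⟨c2, h2, h3⟩ := hex2
  have hcc : c1 ≠ c2 := by rintro rfl; omega
  have b11 := hM.1 r1 c1; have b12 := hM.1 r1 c2; have b21 := hM.1 r2 c1; have b22 := hM.1 r2 c2
  have b11' := hM'.1 r1 c1; have b12' := hM'.1 r1 c2; have b21' := hM'.1 r2 c1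
  have b22' := hM'.1 r2 c2
  have hc12 := hcap r1 c2
  have hpt : ∀ r c, |M' r c - swt r1 r2 c2 c1 M r c| ≤ |M' r c - M r c|
      + (if r = r1 ∧ c = c1 then -1 else 0)
      + (if r = r2 ∧ c = c1 then -1 else 0) + (if r = r2 ∧ c = c2 then -1 else 0)
      + (if r = r1 ∧ c = c2 then 1 else 0) := by
    intro r c; simp only [swt]
    rcases eq_or_ne r r1 with rfl | e1
    · rcases eq_or_ne c c1 with rfl | e2
      · simp only [h12, hcc, if_true, if_false, and_self, and_false, false_and]
        rw [abs_of_nonneg (by omega), abs_of_nonneg (by omega)]; omega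
      · rcases eq_or_ne c c2 with rfl | e3
        · simp only [h12, e2, if_true, if_false, and_self, and_false, false_and]
          have := abs_add_le (M' r c - M r c) 1
          rw [abs_one] at this
          rw [show M' r c - (M r c + -1) = M' r c - M r c + 1 by ring]; omega
        · simp [h12, e2, e3]
    · rcases eq_or_ne r r2 with rfl | e4
      · rcases eq_or_ne c c1 with rfl | e2
        · simp only [e1, hcc, if_true, if_false, and_self, and_false, false_and]
          rw [abs_of_nonpos (by omega), abs_of_nonpos (by omega)]; omega
        · rcases eq_or_ne c c2 with rfl | e3
          · simp only [e1, e2, if_true, if_false, and_self, and_false, false_and]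
            rw [abs_of_nonneg (by omega), abs_of_nonneg (by omega)]; omega
          · simp [e1, e2, e3]
      · simp [e1, e4]
  by_cases hz : 0 < M r1 c2
  · have hO := swt_Om hM h12 hcc.symm hz (by omega : 0 < M r2 c1) (by omega) (by omega)
    have hd := dist_lt (fun r c => M' r c - M r c) (fun r c => M' r c - swt r1 r2 c2 c1 M r c)
      r1 r2 c1 c2 h12 hcc hpt
    exact Relation.ReflTransGen.head ⟨hM, hO, r1, r2, c2, c1, h12, hcc.symm, rfl⟩
      (ih (k - 1) (by have := Finset.sum_nonneg (fun (e : R × C) (_ : e ∈ Finset.univ) =>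
          abs_nonneg (M' e.1 e.2 - swt r1 r2 c2 c1 M e.1 e.2)); omega) _ _ hO hM' (by
          have := Finset.sum_nonneg (fun (e : R × C) (_ : e ∈ Finset.univ) =>
          abs_nonneg (M' e.1 e.2 - swt r1 r2 c2 c1 M e.1 e.2)); omega))
  · have hO := swt_Om hM' h12 hcc (by omega : 0 < M' r1 c1) (by omega : 0 < M' r2 c2)
      (by omega) (by omega)
    have hd := dist_lt (fun r c => M' r c - M r c) (fun r c => swt r1 r2 c1 c2 M' r c - M r c)
      r1 r2 c1 c2 h12 hcc (by
        intro r c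
        have h : swt r1 r2 c1 c2 M' r c - M r c = M' r c - swt r1 r2 c2 c1 M r c := by
          simp only [swt]; split_ifs <;> simp_all <;> omega
        simp only [h]; exact hpt r c)
    refine Relation.ReflTransGen.tail (ih (k - 1) ?_ _ _ hM hO ?_)
      (SwR.symm ⟨hM', hO, r1, r2, c1, c2, h12, hcc, rfl⟩)
    all_goals
      have := Finset.sum_nonneg (fun (e : R × C) (_ : e ∈ Finset.univ) =>
          abs_nonneg (swt r1 r2 c1 c2 M' e.1 e.2 - M e.1 e.2)); omega
end Ryser

section Abs
variable {R C : Type} [Fintype R] [Fintype C]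

noncomputable def ctb (N : R → C → ℤ) (σ : R × C → ZMod 2) (e : R × C) : ZMod 2 :=
  if N e.1 e.2 = 1 then σ e else if N e.1 e.2 = 2 then 1 else 0
noncomputable def gp (N : R → C → ℤ) (σ : R × C → ZMod 2) : ZMod 2 := ∑ e, ctb N σ e
noncomputable def fl (e : R × C) : R × C → ZMod 2 := fun f => if f = e then 1 else 0
def inZ (p q : R) (a b : C) (e : R × C) : Prop := (e.1 = p ∨ e.1 = q) ∧ (e.2 = a ∨ e.2 = b)

def Stp (cap : R → C → ℤ) (ρ : R → ℤ) (κ : C → ℤ) (al : (R → C → ℤ) → R × C → R × C → Prop)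
    (S S' : (R → C → ℤ) × (R × C → ZMod 2)) : Prop :=
  Om cap ρ κ S.1 ∧ Om cap ρ κ S'.1 ∧ gp S.1 S.2 = gp S'.1 S'.2 ∧
  ((S.1 = S'.1 ∧ ∀ f : R × C, S.1 f.1 f.2 = 1 → S.2 f = S'.2 f) ∨
   (S.1 = S'.1 ∧ ∃ e e' : R × C, S.1 e.1 e.2 = 1 ∧ S.1 e'.1 e'.2 = 1 ∧ al S.1 e e' ∧
      ∀ f : R × C, S.1 f.1 f.2 = 1 → f ≠ e → f ≠ e' → S.2 f = S'.2 f) ∨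
   ∃ p q a b, p ≠ q ∧ a ≠ b ∧ S'.1 = swt p q a b S.1 ∧
      ∀ f : R × C, ¬ inZ p q a b f → S.1 f.1 f.2 = 1 → S.2 f = S'.2 f)

abbrev Cn (cap : R → C → ℤ) (ρ : R → ℤ) (κ : C → ℤ) (al : (R → C → ℤ) → R × C → R × C → Prop) :=
  Relation.ReflTransGen (Stp cap ρ κ al)

lemma swt_out {p q : R} {a b : C} {N : R → C → ℤ} {f : R × C} (h : ¬ inZ p q a b f) :
    swt p q a b N f.1 f.2 = N f.1 f.2 := by
  simp only [inZ] at h; simp only [swt]; split_ifs <;> simp_all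

lemma Stp.symm {cap : R → C → ℤ} {ρ κ al} {S S' : (R → C → ℤ) × (R × C → ZMod 2)}
    (h : Stp cap ρ κ al S S') : Stp cap ρ κ al S' S := by
  obtain ⟨h1, h2, h3, h⟩ := h
  refine ⟨h2, h1, h3.symm, ?_⟩
  rcases h with ⟨e, h⟩ | ⟨e, x, y, hx, hy, ha, h⟩ | ⟨p, q, a, b, hp, hq, e, h⟩
  · rw [← e]; exact Or.inl ⟨rfl, fun f hf => (h f hf).symm⟩
  · rw [← e]; exact Or.inr (Or.inl ⟨rfl, x, y, hx, hy, ha, fun f hf k k' => (h f hf k k').symm⟩)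
  · refine Or.inr (Or.inr ⟨p, q, b, a, hp, hq.symm, ?_, fun f hf hs => ?_⟩)
    · rw [e, swt_inv hq]
    · have hf' : ¬ inZ p q a b f := fun hh => hf ⟨hh.1, hh.2.symm⟩
      rw [e, swt_out hf'] at hs
      exact (h f hf' hs).symm

lemma Cn_symm {cap : R → C → ℤ} {ρ κ al} {S S' : (R → C → ℤ) × (R × C → ZMod 2)}
    (h : Cn cap ρ κ al S S') : Cn cap ρ κ al S' S := by
  induction h with
  | refl => exact .refl
  | tail _ h2 ih => exact .head h2.symm ih

lemma gp_fl (N : R → C → ℤ) (σ : R × C → ZMod 2) (e : R × C) (h : N e.1 e.2 = 1) (z : ZMod 2) :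
    gp N (fun f => σ f + z * fl e f) = gp N σ + z := by
  have : ∀ f, ctb N (fun f => σ f + z * fl e f) f = ctb N σ f + if f = e then z else 0 := by
    intro f; simp only [ctb, fl]; by_cases hf : f = e
    · subst hf; simp [h]
    · simp [hf]
  simp [gp, this, Finset.sum_add_distrib]

lemma gp_fl1 (N : R → C → ℤ) (σ : R × C → ZMod 2) (e : R × C) (h : N e.1 e.2 = 1) :
    gp N (σ + fl e) = gp N σ + 1 := by
  rw [← gp_fl N σ e h 1]; congr 1; funext f; simp

lemma z2 (x : ZMod 2) : x + x = 0 := CharTwo.add_self_eq_zero x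

lemma gp_fl2 (N : R → C → ℤ) (σ : R × C → ZMod 2) (e e' : R × C) (h : N e.1 e.2 = 1)
    (h' : N e'.1 e'.2 = 1) : gp N (σ + fl e + fl e') = gp N σ := by
  rw [gp_fl1 _ _ _ h', gp_fl1 _ _ _ h, add_assoc, z2, add_zero]

structure QS (cap : R → C → ℤ) (ρ : R → ℤ) (κ : C → ℤ)
    (Q : (R → C → ℤ) → R × C → R × C → Prop) : Prop where
  refl : ∀ N e, Q N e e
  symm : ∀ N e e', Q N e e' → Q N e' e
  trans : ∀ N e e' e'', Q N e e' → Q N e' e'' → Q N e e''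
  tr : ∀ N p q a b e e' f, Om cap ρ κ N → p ≠ q → a ≠ b → 0 < N p a → 0 < N q b →
    N p b < cap p b → N q a < cap q a → N e.1 e.2 = 1 → N e'.1 e'.2 = 1 → inZ p q a b f →
    swt p q a b N f.1 f.2 = 1 → Q (swt p q a b N) (if inZ p q a b e then f else e)
      (if inZ p q a b e' then f else e') → Q N e e'

def QC (cap : R → C → ℤ) (ρ : R → ℤ) (κ : C → ℤ) (al : (R → C → ℤ) → R × C → R × C → Prop)
    (N : R → C → ℤ) (e e' : R × C) : Prop := ∀ σ, Cn cap ρ κ al (N, σ) (N, σ + fl e + fl e')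

lemma QC_QS (cap : R → C → ℤ) (ρ : R → ℤ) (κ : C → ℤ)
    (al : (R → C → ℤ) → R × C → R × C → Prop) : QS cap ρ κ (QC cap ρ κ al) where
  refl N e σ := by
    rw [show σ + fl e + fl e = σ by funext f; simp [add_assoc, z2]]
  symm N e e' h σ := by
    rw [show σ + fl e' + fl e = σ + fl e + fl e' by ring]; exact h σ
  trans N e e' e'' h h' σ := by
    have := (h σ).trans (h' _)
    rwa [show σ + fl e + fl e' + fl e' + fl e'' = σ + fl e + fl e'' by
      funext f; have := z2 (fl e' f); simp only [Pi.add_apply]; linear_combination this] at this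
  tr N p q a b e e' f hO hp hab h1 h2 h3 h4 he he' hf hf1 hQ σ := by
    have hO' := swt_Om hO hp hab h1 h2 h3 h4
    set N' := swt p q a b N with hN'
    set τ : R × C → ZMod 2 := fun x => σ x + (gp N' σ + gp N σ) * fl f x with hτ
    have hg : gp N' τ = gp N σ := by
      rw [hτ, gp_fl _ _ _ hf1, ← add_assoc, z2, zero_add]
    have hse : N' (if inZ p q a b e then f else e).1 (if inZ p q a b e then f else e).2 = 1 := by
      split_ifs with h
      · exact hf1
      · rw [hN', swt_out h]; exact he
    have hse' : N' (if inZ p q a b e' then f else e').1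
        (if inZ p q a b e' then f else e').2 = 1 := by
      split_ifs with h
      · exact hf1
      · rw [hN', swt_out h]; exact he'
    have hfz : ∀ x, ¬ inZ p q a b x → x ≠ f := by rintro x hx rfl; exact hx hf
    have hflz : ∀ x y, ¬ inZ p q a b x → fl (if inZ p q a b y then f else y) x = fl y x := by
      intro x y hx; split_ifs with h
      · have : x ≠ y := by rintro rfl; exact hx h
        simp [fl, this, hfz x hx]
      · rfl
    refine .head (b := (N', τ)) ⟨hO, hO', hg.symm, Or.inr (Or.inr ⟨p, q, a, b, hp, hab, hN', ?_⟩)⟩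
      ((hQ τ).tail (Stp.symm ⟨hO, hO', ?_, Or.inr (Or.inr ⟨p, q, a, b, hp, hab, hN', ?_⟩)⟩))
    · intro x hx _; simp [hτ, fl, hfz x hx]
    · rw [gp_fl2 _ _ _ _ hse hse', gp_fl2 _ _ _ _ he he', hg]
    · intro x hx _
      simp only [Pi.add_apply, hflz x _ hx]
      simp [hτ, fl, hfz x hx]

lemma QC_al {cap : R → C → ℤ} {ρ : R → ℤ} {κ : C → ℤ}
    {al : (R → C → ℤ) → R × C → R × C → Prop} {N : R → C → ℤ} (hO : Om cap ρ κ N) {e e' : R × C}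
    (he : N e.1 e.2 = 1) (he' : N e'.1 e'.2 = 1) (h : al N e e') : QC cap ρ κ al N e e' :=
  fun σ => .single ⟨hO, hO, (gp_fl2 _ _ _ _ he he').symm, Or.inr (Or.inl ⟨rfl, e, e', he, he', h,
    fun f _ h1 h2 => by simp [fl, h1, h2]⟩)⟩

/-! paths -/

def Arc (cap N : R → C → ℤ) : R ⊕ C → R ⊕ C → Prop
  | .inl r, .inr c => N r c < cap r c
  | .inr c, .inl r => 0 < N r c
  | _, _ => False

def Pth (cap N : R → C → ℤ) (T : R ⊕ C → Prop) : ℕ → R ⊕ C → Prop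
  | 0, v => T v
  | k + 1, v => ∃ u, Arc cap N v u ∧ Pth cap N T k u

lemma Pth_keep {cap N N' : R → C → ℤ} {T bad : R ⊕ C → Prop}
    (hN : ∀ r c, N' r c ≠ N r c → bad (.inl r) ∨ bad (.inr c)) :
    ∀ k, (∀ j ≤ k, ∀ v, bad v → ¬ Pth cap N T j v) → ∀ v, Pth cap N T k v → Pth cap N' T k v := by
  intro k
  induction k with
  | zero => intro _ v h; exact h
  | succ k ih =>
    intro hb v hv
    obtain ⟨u, h1, h2⟩ := id hv
    refine ⟨u, ?_, ih (fun j hj => hb j (by omega)) u h2⟩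
    have hbv := fun h => hb (k+1) le_rfl v h hv
    have hbu := fun h => hb k (by omega) u h h2
    match v, u, h1 with
    | .inl r, .inr c, h1 =>
      have : N' r c = N r c := by by_contra h; rcases hN r c h with h | h <;> tauto
      simpa [Arc, this] using h1
    | .inr c, .inl r, h1 =>
      have : N' r c = N r c := by by_contra h; rcases hN r c h with h | h <;> tauto
      simpa [Arc, this] using h1

end Abs

section Abs2
variable {R C : Type} [Fintype R] [Fintype C]

structure CapOK (cap : R → C → ℤ) : Prop where
  b : ∀ r c, 1 ≤ cap r c ∧ cap r c ≤ 2
  m : ∀ r r' c c', cap r c' = 2 → cap r' c = 2 → cap r c = 2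

def AdjAll (cap : R → C → ℤ) (ρ : R → ℤ) (κ : C → ℤ)
    (Q : (R → C → ℤ) → R × C → R × C → Prop) : Prop :=
  ∀ N, Om cap ρ κ N → ∀ r c, N r c = 1 → (∀ c', N r c' = 1 → Q N (r, c) (r, c')) ∧
    (∀ r', N r' c = 1 → Q N (r, c) (r', c))

lemma P2 {cap : R → C → ℤ} {ρ κ Q} (hQ : QS cap ρ κ Q) (hc : CapOK cap) (hA : AdjAll cap ρ κ Q)
    {N : R → C → ℤ} (hO : Om cap ρ κ N) {r1 r2 : R} {c1 c2 : C} (h1 : N r1 c1 = 1)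
    (h2 : N r2 c2 = 1) (hn : ¬ Q N (r1, c1) (r2, c2)) :
    (N r1 c2 = 0 ∧ N r2 c1 = 2) ∨ (N r1 c2 = 2 ∧ N r2 c1 = 0) := by
  have b1 := hO.1 r1 c2; have b2 := hO.1 r2 c1
  have k1 := hc.b r1 c2; have k2 := hc.b r2 c1
  have n1 : N r1 c2 ≠ 1 := fun h => hn (hQ.trans _ _ _ _ ((hA N hO r1 c1 h1).1 c2 h)
    ((hA N hO r1 c2 h).2 r2 h2))
  have n2 : N r2 c1 ≠ 1 := fun h => hn (hQ.trans _ _ _ _ ((hA N hO r1 c1 h1).2 r2 h)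
    ((hA N hO r2 c1 h).1 c2 h2))
  have hr : r1 ≠ r2 := by rintro rfl; exact n1 h2
  have hcc : c1 ≠ c2 := by rintro rfl; exact n1 h1
  by_cases h00 : N r1 c2 = 0 ∧ N r2 c1 = 0
  · exfalso; apply hn
    apply hQ.tr N r1 r2 c1 c2 _ _ (r1, c2) hO hr hcc (by omega) (by omega) (by omega) (by omega)
      h1 h2 (by simp [inZ]) (by simp [swt, hcc.symm, h00])
    simp [inZ, hQ.refl]
  by_cases h22 : N r1 c2 = 2 ∧ N r2 c1 = 2
  · exfalso; apply hn
    have m1 := hc.m r1 r2 c1 c2 (by omega) (by omega)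
    have m2 := hc.m r2 r1 c2 c1 (by omega) (by omega)
    apply hQ.tr N r1 r2 c2 c1 _ _ (r1, c2) hO hr hcc.symm (by omega) (by omega) (by omega)
      (by omega) h1 h2 (by simp [inZ]) (by simp [swt, hcc.symm, h22])
    simp [inZ, hQ.refl]
  omega

def TT (r : R) (c : C) : R ⊕ C → Prop := fun v => v = .inl r ∨ v = .inr c

theorem PL {cap : R → C → ℤ} {ρ κ Q} (hQ : QS cap ρ κ Q) (hc : CapOK cap)
    (hA : AdjAll cap ρ κ Q) : ∀ (l : ℕ) (N : R → C → ℤ), Om cap ρ κ N → ∀ r1 c1 r2 c2,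
    N r1 c1 = 1 → N r2 c2 = 1 → N r1 c2 = 0 → ∀ v, TT r2 c2 v → Pth cap N (TT r1 c1) l v →
    Q N (r1, c1) (r2, c2) := by
  intro l
  induction l using Nat.strong_induction_on with
  | _ l ih =>
  intro N hO r1 c1 r2 c2 h1 h2 h12 v hv hp
  by_contra hn
  have h21 : N r2 c1 = 2 := by rcases P2 hQ hc hA hO h1 h2 hn with h | h <;> omega
  have hmin : ∀ l' < l, ∀ v, TT r2 c2 v → ¬ Pth cap N (TT r1 c1) l' v :=
    fun l' hl v hv hp => hn (ih l' hl N hO r1 c1 r2 c2 h1 h2 h12 v hv hp)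
  have hminR := fun l' hl => hmin l' hl (.inl r2) (Or.inl rfl)
  have hminC := fun l' hl => hmin l' hl (.inr c2) (Or.inr rfl)
  have hr12 : r1 ≠ r2 := by rintro rfl; omega
  have hc12 : c1 ≠ c2 := by rintro rfl; omega
  have hP2 : ∀ {r c r' c'}, N r c = 1 → N r' c' = 1 →
    ¬ ((N r c' = 0 ∧ N r' c = 2) ∨ (N r c' = 2 ∧ N r' c = 0)) → Q N (r, c) (r', c') :=
    fun a b h => by by_contra hh; exact h (P2 hQ hc hA hO a b hh)
  rcases hv with rfl | rfl
  · -- row start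
    rcases l with _ | l
    · simp [Pth, TT, hr12.symm] at hp
    obtain ⟨u | c, ha, hp⟩ := hp
    · exact ha.elim
    simp only [Arc] at ha
    have bb := hc.b r2 c
    have b0 := hO.1 r2 c
    have hcc2 : c ≠ c2 := by rintro rfl; exact hminC l (by omega) hp
    rcases l with _ | l
    · simp [Pth, TT] at hp; subst hp; omega
    obtain ⟨r | u, hb, hp⟩ := hp
    on_goal 2 => exact hb.elim
    simp only [Arc] at hb
    have hrr2 : r ≠ r2 := by rintro rfl; exact hminR _ (by omega) hp
    have b1 := hO.1 r c
    have bb1 := hc.b r c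
    rcases l with _ | l
    · simp [Pth, TT] at hp; subst hp
      have e2 : N r c = 2 := by
        by_contra h
        have : N r c = 1 := by omega
        exact hn (hQ.trans _ _ _ _ ((hA N hO r c1 h1).1 c this) (hP2 this h2 (by omega)))
      have e0 : N r2 c = 0 := by
        by_contra h
        have : N r2 c = 1 := by omega
        exact hn (hQ.trans _ _ _ _ (hP2 h1 this (by omega)) ((hA N hO r2 c this).1 c2 h2))
      have hcc1 : c ≠ c1 := by rintro rfl; omega
      have k1 := hO.1 r2 c1; have k2 := hc.b r2 c1
      have m := hc.m r r2 c1 c (by omega) (by omega)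
      apply hn
      refine hQ.tr N r2 r c1 c _ _ (r2, c) hO hrr2.symm hcc1.symm (by omega) (by omega) (by omega)
        (by omega) h1 h2 (by simp [inZ]) (by simp [swt, hcc1, e0]) ?_
      rw [if_pos (by simp [inZ]), if_neg (by simp [inZ, hcc2.symm, hc12.symm])]
      refine (hA _ (swt_Om hO hrr2.symm hcc1.symm (by omega) (by omega) (by omega)
        (by omega)) _ _ ?_).1 _ ?_
      · simp [swt, hcc1, e0]
      · simp [swt, hc12.symm, hcc2.symm, h2]
    obtain ⟨u | c3, hd, hp⟩ := hp
    · exact hd.elim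
    simp only [Arc] at hd
    have hrr1 : r ≠ r1 := by
      rintro rfl
      exact hminR 2 (by omega) ⟨.inr c, ha, .inl r, hb, Or.inl rfl⟩
    have hcc1 : c ≠ c1 := by
      rintro rfl
      exact hminR 1 (by omega) ⟨.inr c, ha, Or.inr rfl⟩
    have hch : N r2 c3 = cap r2 c3 := by
      by_contra h
      have := hO.1 r2 c3
      exact hminR (l + 1) (by omega) ⟨.inr c3, by simp only [Arc]; omega, hp⟩
    have hcc3 : c ≠ c3 := by rintro rfl; omega
    have bb3 := hc.b r2 c3
    by_cases hs : N r2 c3 = 1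
    · have hq := (hA N hO r2 c3 hs).1 c2 h2
      apply hn; refine hQ.trans _ _ _ _ ?_ hq
      by_contra hx
      rcases P2 hQ hc hA hO h1 hs hx with h | h
      · exact hx (ih l (by omega) N hO r1 c1 r2 c3 h1 hs h.1 _ (Or.inr rfl) hp)
      · omega
    · have hs2 : N r2 c3 = 2 := by omega
      have h32 : c3 ≠ c2 := by rintro rfl; omega
      have hO' := swt_Om hO hrr2.symm hcc3.symm (by omega) hb ha hd
      have i1 : ¬ inZ r2 r c3 c (r1, c1) := by simp [inZ, hr12, hrr1.symm]
      have i2 : ¬ inZ r2 r c3 c (r2, c2) := by simp [inZ, h32.symm, hcc2.symm]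
      have s3 : swt r2 r c3 c N r2 c3 = 1 := by simp [swt, hs2]
      have s1 : swt r2 r c3 c N r1 c1 = 1 := by rw [← h1]; exact swt_out i1
      have s2 : swt r2 r c3 c N r2 c2 = 1 := by rw [← h2]; exact swt_out i2
      apply hn
      refine hQ.tr N r2 r c3 c _ _ (r2, c3) hO hrr2.symm hcc3.symm (by omega) hb ha
        hd h1 h2 (by simp [inZ]) s3 ?_
      rw [if_neg i1, if_neg i2]
      refine hQ.trans _ _ _ _ ?_ ((hA _ hO' r2 c3 s3).1 c2 s2)
      by_contra hx
      rcases P2 hQ hc hA hO' s1 s3 hx with h | h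
      · refine hx (ih l (by omega) _ hO' r1 c1 r2 c3 s1 s3 h.1 (.inr c3) (Or.inr rfl) ?_)
        refine Pth_keep (bad := fun v => v = .inl r2 ∨ v = .inl r) ?_ l ?_ _ hp
        · intro x y hxy
          left; by_contra hh
          apply hxy
          have := swt_out (p := r2) (q := r) (a := c3) (b := c) (N := N) (f := (x, y))
          apply this
          simp only [Sum.inl.injEq] at hh
          simp [inZ]; tauto
        · rintro j hj v (rfl | rfl)
          · exact hminR j (by omega)
          · exact fun hh => hminR (j + 2) (by omega) ⟨.inr c, ha, .inl r, hb, hh⟩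
      · have h31 : c3 ≠ c1 := by
          rintro rfl
          omega
        have : swt r2 r c3 c N r2 c1 = N r2 c1 := swt_out (f := (r2, c1)) (by
          simp [inZ, h31.symm, hcc1.symm])
        omega
  · rcases l with _ | l
    · simp [Pth, TT, hc12.symm] at hp
    obtain ⟨r | u, ha, hp⟩ := hp
    on_goal 2 => exact ha.elim
    simp only [Arc] at ha
    have hrr2 : r ≠ r2 := by rintro rfl; exact hminR l (by omega) hp
    have hrr1 : r ≠ r1 := by rintro rfl; omega
    have b0 := hO.1 r c2
    have bb := hc.b r c2
    rcases l with _ | l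
    · simp [Pth, TT] at hp; exact hrr1 hp
    obtain ⟨u | c, hb, hp⟩ := hp
    · exact hb.elim
    simp only [Arc] at hb
    have hcc2 : c ≠ c2 := by rintro rfl; exact hminC _ (by omega) hp
    have b1 := hO.1 r c
    have bb1 := hc.b r c
    rcases l with _ | l
    · simp [Pth, TT] at hp; subst hp
      have e2 : N r c2 = 2 := by
        by_contra h
        have : N r c2 = 1 := by omega
        exact hn (hQ.trans _ _ _ _ (hP2 h1 this (by omega)) ((hA N hO r c2 this).2 r2 h2))
      have e0 : N r c = 0 := by
        by_contra h
        have : N r c = 1 := by omega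
        exact hn (hQ.trans _ _ _ _ ((hA N hO r1 c h1).2 r this) (hP2 this h2 (by omega)))
      have k1 := hc.b r1 c2
      apply hn
      refine hQ.tr N r r1 c2 c _ _ (r, c2) hO hrr1 hcc2.symm (by omega) (by omega) (by omega)
        (by omega) h1 h2 (by simp [inZ]) (by simp [swt, e2]) ?_
      rw [if_pos (by simp [inZ]), if_neg (by simp [inZ, hrr2.symm, hr12.symm])]
      refine (hA _ (swt_Om hO hrr1 hcc2.symm (by omega) (by omega) (by omega)
        (by omega)) _ _ ?_).2 _ ?_
      · simp [swt, e2]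
      · simp [swt, hrr2.symm, hr12.symm, h2]
    obtain ⟨r3 | u, hd, hp⟩ := hp
    on_goal 2 => exact hd.elim
    simp only [Arc] at hd
    have hcc1 : c ≠ c1 := by
      rintro rfl
      exact hminC 2 (by omega) ⟨.inl r, ha, .inr c, hb, Or.inr rfl⟩
    have hch : N r3 c2 = 0 := by
      by_contra h
      have := hO.1 r3 c2
      exact hminC (l + 1) (by omega) ⟨.inl r3, by simp only [Arc]; omega, hp⟩
    have hrr3 : r ≠ r3 := by rintro rfl; omega
    have hr32 : r3 ≠ r2 := by rintro rfl; omega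
    have bb3 := hc.b r3 c2
    have hO' := swt_Om hO hrr3 hcc2.symm ha hd hb (by omega)
    have i1 : ¬ inZ r r3 c2 c (r1, c1) := by simp [inZ, hc12, hcc1.symm]
    have i2 : ¬ inZ r r3 c2 c (r2, c2) := by simp [inZ, hrr2.symm, hr32.symm]
    have s3 : swt r r3 c2 c N r3 c2 = 1 := by simp [swt, hch, hrr3.symm]
    have s1 : swt r r3 c2 c N r1 c1 = 1 := by rw [← h1]; exact swt_out i1
    have s2 : swt r r3 c2 c N r2 c2 = 1 := by rw [← h2]; exact swt_out i2
    apply hn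
    refine hQ.tr N r r3 c2 c _ _ (r3, c2) hO hrr3 hcc2.symm ha hd hb
      (by omega) h1 h2 (by simp [inZ]) s3 ?_
    rw [if_neg i1, if_neg i2]
    refine hQ.trans _ _ _ _ ?_ ((hA _ hO' r3 c2 s3).2 r2 s2)
    by_cases h31 : r3 = r1
    · subst h31
      exact (hA _ hO' _ _ s1).1 _ s3
    · refine ih l (by omega) _ hO' r1 c1 r3 c2 s1 s3 ?_ (.inl r3) (Or.inl rfl) ?_
      · rw [← h12]; exact swt_out (f := (r1, c2)) (by simp [inZ, hrr1.symm, Ne.symm h31])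
      refine Pth_keep (bad := fun v => v = .inr c2 ∨ v = .inr c) ?_ l ?_ _ hp
      · intro x y hxy
        right; by_contra hh
        apply hxy
        have := swt_out (p := r) (q := r3) (a := c2) (b := c) (N := N) (f := (x, y))
        apply this
        simp only [Sum.inr.injEq] at hh
        simp [inZ]; tauto
      · rintro j hj v (rfl | rfl)
        · exact hminC j (by omega)
        · exact fun hh => hminC (j + 2) (by omega) ⟨.inl r, ha, .inr c, hb, hh⟩

/-- closure: a failing pair produces a closed pair of sets -/
theorem CL {cap : R → C → ℤ} {ρ κ Q} (hQ : QS cap ρ κ Q) (hc : CapOK cap)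
    (hA : AdjAll cap ρ κ Q) {N : R → C → ℤ} (hO : Om cap ρ κ N) {r1 c1 r2 c2}
    (h1 : N r1 c1 = 1) (h2 : N r2 c2 = 1) (h12 : N r1 c2 = 0) (hn : ¬ Q N (r1, c1) (r2, c2)) :
    ∃ (S : R → Prop) (T : C → Prop), S r2 ∧ T c1 ∧ (∀ r c, S r → T c → N r c = cap r c) ∧
      (∀ r c, ¬ S r → ¬ T c → N r c = 0) ∧ ¬ S r1 ∧ ¬ T c2 := by
  have hp := fun l v hv hp => hn (PL hQ hc hA l N hO r1 c1 r2 c2 h1 h2 h12 v hv hp)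
  refine ⟨fun r => ¬ ∃ l, Pth cap N (TT r1 c1) l (.inl r),
    fun c => ∃ l, Pth cap N (TT r1 c1) l (.inr c), fun ⟨l, h⟩ => hp l _ (Or.inl rfl) h,
    ⟨0, Or.inr rfl⟩, fun r c hr ⟨l, hl⟩ => ?_, fun r c hr ht => ?_,
    fun h => h ⟨0, Or.inl rfl⟩, fun ⟨l, h⟩ => hp l _ (Or.inr rfl) h⟩
  · by_contra h
    have := hO.1 r c
    exact hr ⟨l + 1, .inr c, by simp only [Arc]; omega, hl⟩
  · by_contra h
    have := hO.1 r c
    rw [not_not] at hr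
    obtain ⟨l, hl⟩ := hr
    exact ht ⟨l + 1, .inl r, by simp only [Arc]; omega, hl⟩

end Abs2

section Abs3
variable {R C : Type} [Fintype R] [Fintype C]

noncomputable def capLO (L : R) (O : C) : R → C → ℤ := fun r c => if r = L ∨ c = O then 1 else 2

lemma capLO_ok (L : R) (O : C) : CapOK (capLO L O) where
  b r c := by simp only [capLO]; split_ifs <;> omega
  m r r' c c' h h' := by
    simp only [capLO] at *; split_ifs at * <;> simp_all

structure AX (L : R) (O : C) (ρ : R → ℤ) (κ : C → ℤ)
    (Q : (R → C → ℤ) → R × C → R × C → Prop) : Prop where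
  qs : QS (capLO L O) ρ κ Q
  rowL : ∀ N c c', Om (capLO L O) ρ κ N → N L c = 1 → N L c' = 1 → Q N (L, c) (L, c')
  colO : ∀ N r r', Om (capLO L O) ρ κ N → N r O = 1 → N r' O = 1 → Q N (r, O) (r', O)
  rowc : ∀ N r c c', Om (capLO L O) ρ κ N → c ≠ O → c' ≠ O → N r c = 1 → N r c' = 1 →
    Q N (r, c) (r, c')
  colc : ∀ N r r' c, Om (capLO L O) ρ κ N → r ≠ L → r' ≠ L → N r c = 1 → N r' c = 1 →
    Q N (r, c) (r', c)
  rowO : ∀ N r c, Om (capLO L O) ρ κ N → N r c = 1 → N r O = 1 → (N L O ≠ 1 ∨ N L c ≠ 1) →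
    Q N (r, c) (r, O)
  colL : ∀ N r c, Om (capLO L O) ρ κ N → N r c = 1 → N L c = 1 → (N L O ≠ 1 ∨ N r O ≠ 1) →
    Q N (r, c) (L, c)

def HypS (L : R) (O : C) (N : R → C → ℤ) : Prop :=
  ∀ (S : R → Prop) (T : C → Prop), (∃ r, S r) → (∃ c, T c) → (S L ↔ T O) →
    (∀ r c, S r → T c → N r c = capLO L O r c) → (∀ r c, ¬ S r → ¬ T c → N r c = 0) →
    ((∀ r, S r) ∧ ∀ c, T c ↔ c = O) ∨ ((∀ r, S r ↔ r = L) ∧ ∀ c, T c)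

def TT3 (s : R) (t O : C) : R ⊕ C → Prop := fun v => v = .inl s ∨ v = .inr t ∨ v = .inr O

lemma E1aux {L : R} {O : C} {ρ κ} {Q : (R → C → ℤ) → R × C → R × C → Prop} (hX : AX L O ρ κ Q)
    {s : R} {t : C} (hs : s ≠ L) (ht : t ≠ O) :
    ∀ (l : ℕ) (N : R → C → ℤ), Om (capLO L O) ρ κ N → N s t = 1 → N s O = 1 → N L t = 1 →
    N L O = 1 → Pth (capLO L O) N (TT3 s t O) l (.inl L) → Q N (s, t) (L, O) := by
  intro l
  induction l using Nat.strong_induction_on with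
  | _ l ih =>
  intro N hO hst hsO hLt hLO hp
  by_contra hn
  have hmin : ∀ l' < l, ¬ Pth (capLO L O) N (TT3 s t O) l' (.inl L) :=
    fun l' hl hp => hn (ih l' hl N hO hst hsO hLt hLO hp)
  have cL : ∀ c, capLO L O L c = 1 := by simp [capLO]
  have cO : ∀ r, capLO L O r O = 1 := by simp [capLO]
  have hQ := hX.qs
  rcases l with _ | l
  · simp [Pth, TT3, hs.symm] at hp
  obtain ⟨u | t', ha, hp⟩ := hp
  · exact ha.elim
  simp only [Arc, cL] at ha
  have b1 := hO.1 L t'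
  have hLt' : N L t' = 0 := by omega
  have ett : t' ≠ t := by rintro rfl; omega
  have etO : t' ≠ O := by rintro rfl; omega
  rcases l with _ | l
  · simp [Pth, TT3, ett, etO] at hp
  obtain ⟨r | u, hb, hp⟩ := hp
  on_goal 2 => exact hb.elim
  simp only [Arc] at hb
  have hrL : r ≠ L := by rintro rfl; omega
  have br := hO.1 r t'
  have cr := (capLO_ok L O).b r t'
  by_cases hrs : r = s
  · subst hrs
    by_cases h1 : N r t' = 1
    · apply hn
      exact hQ.trans _ _ _ _ (hX.rowc N r t t' hO ht etO hst h1) (hQ.trans _ _ _ _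
        (hX.rowO N r t' hO h1 hsO (Or.inr (by omega))) (hX.colO N r L hO hsO hLO))
    · have c1 : capLO L O r t = 2 := by simp [capLO, hs, ht]
      apply hn
      have hO' := swt_Om hO hrL.symm ett.symm (by omega) hb (by rw [cL]; omega) (by omega)
      refine hQ.tr N L r t t' _ _ (L, t') hO hrL.symm ett.symm (by omega) hb (by rw [cL]; omega)
        (by omega) hst hLO (by simp [inZ]) (by simp [swt, ett, hLt']) ?_
      rw [if_pos (by simp [inZ]), if_neg (by simp [inZ, ht.symm, etO.symm])]
      exact hX.rowL _ _ _ hO' (by simp [swt, ett, hLt']) (by simp [swt, ht.symm, etO.symm, hLO])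
  rcases l with _ | l
  · simp [Pth, TT3, hrs] at hp
  obtain ⟨u | c, hd, hp⟩ := hp
  · exact hd.elim
  simp only [Arc] at hd
  have hLc : N L c = 1 := by
    by_contra h
    have := hO.1 L c
    rw [cL] at this
    exact hmin (l + 1) (by omega) ⟨.inr c, by simp only [Arc, cL]; omega, hp⟩
  have hct : c ≠ t' := by rintro rfl; omega
  have hO' := swt_Om hO hrL.symm hct (by omega) hb (by rw [cL]; omega) hd
  have sf : swt L r c t' N L t' = 1 := by simp [swt, hct.symm, hLt']
  have i1 : ¬ inZ L r c t' (s, t) := by simp [inZ, hs, Ne.symm hrs]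
  have i3 : ¬ inZ L r c t' (s, O) := by simp [inZ, hs, Ne.symm hrs]
  have s1 : swt L r c t' N s t = 1 := by rw [← hst]; exact swt_out i1
  have s3 : swt L r c t' N s O = 1 := by rw [← hsO]; exact swt_out i3
  have htr := fun f h1 h2 h3 => hn (hQ.tr N L r c t' (s, t) (L, O) f hO hrL.symm hct (by omega) hb
    (by rw [cL]; omega) hd hst hLO h1 h2 h3)
  by_cases hcO : c = O
  · subst hcO
    rw [cO] at hd
    have hr0 : N r c = 0 := by have := hO.1 r c; omega
    have s5 : swt L r c t' N r c = 1 := by simp [swt, hrL, hr0]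
    apply htr (r, c) (by simp [inZ]) s5
    rw [if_neg i1, if_pos (by simp [inZ])]
    exact hQ.trans _ _ _ _ (hX.rowO _ s t hO' s1 s3 (Or.inl (by simp [swt, hLc])))
      (hX.colO _ s r hO' s3 s5)
  have i2 : ¬ inZ L r c t' (L, O) := by simp [inZ, Ne.symm hcO, etO.symm]
  have s2 : swt L r c t' N L O = 1 := by rw [← hLO]; exact swt_out i2
  apply htr (L, t') (by simp [inZ]) sf
  rw [if_neg i1, if_neg i2]
  by_cases hct : c = t
  · subst hct
    exact hQ.trans _ _ _ _ (hX.rowO _ s c hO' s1 s3 (Or.inr (by simp [swt, hLc])))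
      (hX.colO _ s L hO' s3 s2)
  refine ih (l + 1) (by omega) _ hO' s1 s3 ?_ s2 ⟨.inr c, ?_, ?_⟩
  · rw [← hLt]; exact swt_out (f := (L, t)) (by simp [inZ, Ne.symm hct, ett.symm])
  · simp [Arc, cL, swt, hLc]
  · refine Pth_keep (bad := fun v => v = .inl L ∨ v = .inl r) ?_ l ?_ _ hp
    · intro x y hxy
      left; by_contra hh
      apply hxy
      have := swt_out (p := L) (q := r) (a := c) (b := t') (N := N) (f := (x, y))
      apply this
      simp only [Sum.inl.injEq] at hh
      simp [inZ]; tauto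
    · rintro j hj v (rfl | rfl)
      · exact hmin j (by omega)
      · exact fun hh => hmin (j + 2) (by omega) ⟨.inr t', by simp only [Arc, cL]; omega, .inl _, hb, hh⟩

lemma E1 {L : R} {O : C} {ρ κ} {Q : (R → C → ℤ) → R × C → R × C → Prop} (hX : AX L O ρ κ Q)
    {s : R} {t : C} (hs : s ≠ L) (ht : t ≠ O) {N : R → C → ℤ} (hO : Om (capLO L O) ρ κ N)
    (hst : N s t = 1) (hsO : N s O = 1) (hLt : N L t = 1) (hLO : N L O = 1) (hH : HypS L O N)
    {t0 : C} (h0 : N L t0 = 0) : Q N (s, t) (L, O) := by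
  by_contra hn
  have hno := fun l hp => hn (E1aux hX hs ht l N hO hst hsO hLt hLO hp)
  set U : R ⊕ C → Prop := fun v => Relation.ReflTransGen (Arc (capLO L O) N) (.inl L) v with hU
  have hUT : ∀ v, U v → ¬ TT3 s t O v := by
    have : ∀ v w, Relation.ReflTransGen (Arc (capLO L O) N) v w → TT3 s t O w →
        ∃ l, Pth (capLO L O) N (TT3 s t O) l v := by
      intro v w h hw
      induction h using Relation.ReflTransGen.head_induction_on with
      | refl => exact ⟨0, hw⟩
      | head h1 _ ih => obtain ⟨l, hl⟩ := ih; exact ⟨l + 1, _, h1, hl⟩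
    intro v hv hT
    obtain ⟨l, hl⟩ := this _ _ hv hT
    exact hno l hl
  have hUL : U (.inl L) := .refl
  have hU0 : U (.inr t0) := hUL.tail (by simp [Arc, capLO, h0])
  have hnO : ¬ U (.inr O) := fun h => hUT _ h (by simp [TT3])
  have hns : ¬ U (.inl s) := fun h => hUT _ h (by simp [TT3])
  rcases hH (fun r => U (.inl r)) (fun c => ¬ U (.inr c)) ⟨L, hUL⟩ ⟨O, hnO⟩ (by simp [hUL, hnO])
    (fun r c h1 h2 => by
      by_contra h
      have := hO.1 r c
      exact h2 (h1.tail (by simp only [Arc]; omega)))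
    (fun r c h1 h2 => by
      by_contra h
      have := hO.1 r c
      rw [not_not] at h2
      exact h1 (h2.tail (by simp only [Arc]; omega))) with h | h
  · exact hns (h.1 s)
  · exact h.2 t0 hU0

lemma swt_T {p q : R} {a b : C} (hp : p ≠ q) (ha : a ≠ b) (N : R → C → ℤ) :
    (fun c r => swt p q a b N r c) = swt a b p q (fun c r => N r c) := by
  funext c r; simp only [swt]; split_ifs <;> simp_all

lemma Om_T {cap : R → C → ℤ} {ρ κ} {N : R → C → ℤ} (h : Om cap ρ κ N) :
    Om (fun c r => cap r c) κ ρ (fun c r => N r c) := ⟨fun c r => h.1 r c, h.2.2, h.2.1⟩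

lemma capLO_T (L : R) (O : C) : (fun c r => capLO L O r c) = capLO O L := by
  funext c r; simp [capLO, or_comm]

lemma inZ_T {p q : R} {a b : C} (e : C × R) : inZ p q a b e.swap ↔ inZ a b p q e := by
  simp [inZ, and_comm]

lemma AX_T {L : R} {O : C} {ρ κ} {Q : (R → C → ℤ) → R × C → R × C → Prop} (hX : AX L O ρ κ Q) :
    AX O L κ ρ (fun N e e' => Q (fun r c => N c r) e.swap e'.swap) := by
  have hT : ∀ {N : C → R → ℤ}, Om (capLO O L) κ ρ N → Om (capLO L O) ρ κ (fun r c => N c r) :=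
    fun h => by have := Om_T h; rwa [capLO_T] at this
  refine ⟨⟨fun N e => hX.qs.refl _ _, fun N e e' => hX.qs.symm _ _ _,
    fun N e e' e'' => hX.qs.trans _ _ _ _, ?_⟩, fun N c c' h => hX.colO _ c c' (hT h),
    fun N c c' h => hX.rowL _ c c' (hT h), fun N r c c' h => hX.colc _ c c' r (hT h),
    fun N r r' c h => hX.rowc _ c r r' (hT h), fun N r c h => hX.colL _ c r (hT h),
    fun N r c h => hX.rowO _ c r (hT h)⟩
  intro N p q a b e e' f hO hp ha h1 h2 h3 h4 he he' hf hf1 hq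
  rw [← capLO_T L O] at h3 h4
  refine hX.qs.tr _ a b p q e.swap e'.swap f.swap (hT hO) ha hp h1 h2 h4 h3 he he'
    ((inZ_T f).2 hf) ?_ ?_
  · rw [← swt_T hp ha]; exact hf1
  · rw [← swt_T hp ha]
    simp only [inZ_T]
    convert hq using 1 <;> split_ifs <;> rfl

lemma HypS_T {L : R} {O : C} {N : R → C → ℤ} (h : HypS L O N) : HypS O L (fun c r => N r c) := by
  intro S T h1 h2 h3 h4 h5
  have := h T S h2 h1 h3.symm (fun r c hr hc => by
    exact (h4 c r hc hr).trans (by rw [← capLO_T L O])) (fun r c hr hc => h5 c r hc hr)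
  tauto

/-- all singles are equivalent in the nonspecial case -/
theorem allQ {L : R} {O : C} {ρ κ} {Q : (R → C → ℤ) → R × C → R × C → Prop} (hX : AX L O ρ κ Q)
    (hH : ∀ N, Om (capLO L O) ρ κ N → HypS L O N)
    (hns : ∀ N, Om (capLO L O) ρ κ N → (∃ c, N L c = 0) ∨ ∃ r, N r O = 0) :
    ∀ N, Om (capLO L O) ρ κ N → ∀ e e' : R × C, N e.1 e.2 = 1 → N e'.1 e'.2 = 1 → Q N e e' := by
  have hQ := hX.qs
  have hE : ∀ N, Om (capLO L O) ρ κ N → N L O = 1 → ∀ r c, N r c = 1 → Q N (r, c) (L, O) := by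
    intro N hO hLO r c h
    by_cases hr : r = L
    · subst hr; exact hX.rowL _ _ _ hO h hLO
    by_cases hc : c = O
    · subst hc; exact hX.colO _ _ _ hO h hLO
    have b1 := hO.1 r O; have b2 := hO.1 L c
    simp only [capLO, true_or, or_true, if_true] at b1 b2
    by_cases h1 : N r O = 1
    · by_cases h2 : N L c = 1
      · rcases hns N hO with ⟨c0, h0⟩ | ⟨r0, h0⟩
        · exact E1 hX hr hc hO h h1 h2 hLO (hH N hO) h0
        · have hO' := Om_T hO
          rw [capLO_T] at hO'
          exact E1 (AX_T hX) hc hr hO' h h2 h1 hLO (HypS_T (hH N hO)) h0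
      · exact hQ.trans _ _ _ _ (hX.rowO _ _ _ hO h h1 (Or.inr h2)) (hX.colO _ _ _ hO h1 hLO)
    · by_cases h2 : N L c = 1
      · exact hQ.trans _ _ _ _ (hX.colL _ _ _ hO h h2 (Or.inr h1)) (hX.rowL _ _ _ hO h2 hLO)
      · have c1 : capLO L O r O = 1 := by simp [capLO]
        have c2 : capLO L O L c = 1 := by simp [capLO]
        refine hQ.tr N r L c O _ _ (r, O) hO hr hc (by omega) (by omega) (by omega) (by omega)
          h hLO (by simp [inZ]) ?_ ?_
        · simp [swt, Ne.symm hc]; omega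
        · simp [inZ, hQ.refl]
  have hA : AdjAll (capLO L O) ρ κ Q := by
    intro N hO r c h
    by_cases hLO : N L O = 1
    · have := hE N hO hLO
      exact ⟨fun c' h' => hQ.trans _ _ _ _ (this r c h) (hQ.symm _ _ _ (this r c' h')),
        fun r' h' => hQ.trans _ _ _ _ (this r c h) (hQ.symm _ _ _ (this r' c h'))⟩
    · refine ⟨fun c' h' => ?_, fun r' h' => ?_⟩
      · by_cases hc : c = O
        · subst hc; exact hQ.symm _ _ _ (hX.rowO _ _ _ hO h' h (Or.inl hLO))
        by_cases hc' : c' = O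
        · subst hc'; exact hX.rowO _ _ _ hO h h' (Or.inl hLO)
        exact hX.rowc _ _ _ _ hO hc hc' h h'
      · by_cases hc : r = L
        · subst hc; exact hQ.symm _ _ _ (hX.colL _ _ _ hO h' h (Or.inl hLO))
        by_cases hc' : r' = L
        · subst hc'; exact hX.colL _ _ _ hO h h' (Or.inl hLO)
        exact hX.colc _ _ _ _ hO hc hc' h h'
  have hok := capLO_ok L O
  have key : ∀ N, Om (capLO L O) ρ κ N → ∀ r1 c1 r2 c2, N r1 c1 = 1 → N r2 c2 = 1 →
      N r1 c2 = 0 → N r2 c1 = 2 → N L O ≠ 1 → Q N (r1, c1) (r2, c2) := by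
    intro N hO r1 c1 r2 c2 h1 h2 h12 h21 hLO
    by_contra hn
    have cL : ∀ c, capLO L O L c = 1 := by simp [capLO]
    have cO : ∀ r, capLO L O r O = 1 := by simp [capLO]
    -- improve the second cell
    obtain ⟨c2', h2', h12', hO2, hn'⟩ : ∃ c2', N r2 c2' = 1 ∧ N r1 c2' = 0 ∧
        (c2' = O ∨ N r2 O = 0) ∧ ¬ Q N (r1, c1) (r2, c2') := by
      by_cases h : N r2 O = 1
      · have hq : ¬ Q N (r1, c1) (r2, O) := fun hq => hn (hQ.trans _ _ _ _ hq
          ((hA N hO r2 O h).1 c2 h2))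
        rcases P2 hQ hok hA hO h1 h hq with hh | hh
        · exact ⟨O, h, hh.1, Or.inl rfl, hq⟩
        · omega
      · have := hO.1 r2 O; rw [cO] at this
        exact ⟨c2, h2, h12, Or.inr (by omega), hn⟩
    obtain ⟨r1', h1', h12'', hL1, hn''⟩ : ∃ r1', N r1' c1 = 1 ∧ N r1' c2' = 0 ∧
        (r1' = L ∨ N L c1 = 0) ∧ ¬ Q N (r1', c1) (r2, c2') := by
      by_cases h : N L c1 = 1
      · have hq : ¬ Q N (L, c1) (r2, c2') := fun hq => hn' (hQ.trans _ _ _ _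
          ((hA N hO r1 c1 h1).2 L h) hq)
        rcases P2 hQ hok hA hO h h2' hq with hh | hh
        · exact ⟨L, h, hh.1, Or.inl rfl, hq⟩
        · omega
      · have := hO.1 L c1; rw [cL] at this
        exact ⟨r1, h1, h12', Or.inr (by omega), hn'⟩
    obtain ⟨S, T, hS, hT, hcl, hz, hS1, hT2⟩ := CL hQ hok hA hO h1' h2' h12'' hn''
    have hnL : ¬ S L := by
      rcases hL1 with rfl | h
      · exact hS1
      · intro hSL
        have e1 := hcl L c1 hSL hT
        rw [cL] at e1; omega
    have hnO : ¬ T O := by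
      rcases hO2 with rfl | h
      · exact hT2
      · intro hSL
        have e1 := hcl r2 O hS hSL
        rw [cO] at e1; omega
    rcases hH N hO S T ⟨_, hS⟩ ⟨_, hT⟩ (by tauto) hcl hz with h | h
    · exact hnL (h.1 _)
    · exact hnO (h.2 _)
  rintro N hO ⟨r1, c1⟩ ⟨r2, c2⟩ h1 h2
  by_cases hLO : N L O = 1
  · have := hE N hO hLO
    exact hQ.trans _ _ _ _ (this _ _ h1) (hQ.symm _ _ _ (this _ _ h2))
  by_contra hn
  rcases P2 hQ hok hA hO h1 h2 hn with h | h
  · exact hn (key N hO _ _ _ _ h1 h2 h.1 h.2 hLO)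
  · exact hn (hQ.symm _ _ _ (key N hO _ _ _ _ h2 h1 h.2 h.1 hLO))
end Abs3

section Abs4
variable {R C : Type} [Fintype R] [Fintype C]

lemma gp_congr {N : R → C → ℤ} {σ σ' : R × C → ZMod 2}
    (h : ∀ f : R × C, N f.1 f.2 = 1 → σ f = σ' f) : gp N σ = gp N σ' := by
  refine Finset.sum_congr rfl fun f _ => ?_
  simp only [ctb]; split_ifs with h1
  · exact h f h1
  · rfl
  · rfl

lemma z2ne {x y : ZMod 2} (h : x ≠ y) : x + 1 = y := by revert x y; decide

theorem sameN {cap : R → C → ℤ} {ρ κ al} {N : R → C → ℤ} (hO : Om cap ρ κ N)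
    (A : R × C → Prop)
    (hF : ∀ e e' : R × C, A e → A e' → N e.1 e.2 = 1 → N e'.1 e'.2 = 1 → QC cap ρ κ al N e e') :
    ∀ (k : ℕ) (σ σ' : R × C → ZMod 2), (∀ f, ¬ A f → σ f = σ' f) → gp N σ = gp N σ' →
    (Finset.univ.filter fun f : R × C => N f.1 f.2 = 1 ∧ σ f ≠ σ' f).card ≤ k →
    Cn cap ρ κ al (N, σ) (N, σ') := by
  intro k
  induction k with
  | zero =>
    intro σ σ' hA hg hk
    refine .single ⟨hO, hO, hg, Or.inl ⟨rfl, fun f hf => ?_⟩⟩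
    by_contra hne
    rw [Nat.le_zero, Finset.card_eq_zero] at hk
    have : f ∈ (∅ : Finset (R × C)) := by rw [← hk]; simp; exact ⟨hf, hne⟩
    simp at this
  | succ k ih =>
    intro σ σ' hA hg hk
    by_cases he : ∃ e : R × C, N e.1 e.2 = 1 ∧ σ e ≠ σ' e
    · obtain ⟨e, h1, h2⟩ := he
      have : ∃ e' : R × C, N e'.1 e'.2 = 1 ∧ σ e' ≠ σ' e' ∧ e' ≠ e := by
        by_contra hc
        push Not at hc
        have := gp_congr (N := N) (σ := σ + fl e) (σ' := σ') (fun f hf => by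
          by_cases hfe : f = e
          · subst hfe; simp [fl]; exact z2ne h2
          · simp [fl, hfe]; by_contra hne; exact hfe (hc f hf hne))
        rw [gp_fl1 _ _ _ h1, hg] at this
        simp at this
      obtain ⟨e', h1', h2', hne⟩ := this
      have a1 : A e := by by_contra h; exact h2 (hA e h)
      have a2 : A e' := by by_contra h; exact h2' (hA e' h)
      refine (hF e e' a1 a2 h1 h1' σ).trans (ih _ _ (fun f hf => by
        have f1 : f ≠ e := by rintro rfl; exact hf a1
        have f2 : f ≠ e' := by rintro rfl; exact hf a2
        simp [fl, f1, f2, hA f hf]) (by rw [gp_fl2 _ _ _ _ h1 h1', hg]) ?_)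
      have hlt := Finset.card_lt_card (s := Finset.univ.filter fun f : R × C =>
          N f.1 f.2 = 1 ∧ (σ + fl e + fl e') f ≠ σ' f)
        (t := Finset.univ.filter fun f : R × C => N f.1 f.2 = 1 ∧ σ f ≠ σ' f) (by
          refine Finset.ssubset_iff_subset_ne.2 ⟨fun f hf => ?_, fun hh => ?_⟩
          · simp only [Finset.mem_filter, Finset.mem_univ, true_and] at hf ⊢
            refine ⟨hf.1, ?_⟩
            by_cases hfe : f = e
            · subst hfe; exact h2
            by_cases hfe' : f = e'
            · subst hfe'; exact h2'
            have := hf.2; simpa [fl, hfe, hfe'] using this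
          · have : e ∈ Finset.univ.filter fun f : R × C => N f.1 f.2 = 1 ∧ σ f ≠ σ' f := by
              simp; exact ⟨h1, h2⟩
            rw [← hh] at this
            have h3 := (Finset.mem_filter.1 this).2.2
            simp [fl, Ne.symm hne] at h3
            exact h3 (z2ne h2))
      omega
    · refine ih _ _ hA hg ?_
      rw [Finset.card_eq_zero.2]; · omega
      rw [Finset.filter_eq_empty_iff]; rintro f - ⟨h1, h2⟩; exact he ⟨f, h1, h2⟩

lemma real_of_single {N : R → C → ℤ} {e : R × C} (h : N e.1 e.2 = 1) (par : ZMod 2) :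
    ∃ σ, gp N σ = par :=
  ⟨fun f => 0 + (par - gp N 0) * fl e f, by
    rw [gp_fl N (fun _ => 0) e h]; show gp N 0 + _ = _; ring⟩

lemma SwR_pa {cap : R → C → ℤ} {ρ κ} (hc : CapOK cap) {N M : R → C → ℤ} {p q a b}
    (hN : Om cap ρ κ N) (hM : Om cap ρ κ M) (h : M = swt p q a b N) :
    N p a = 1 ∨ M p a = 1 := by
  have h1 := hN.1 p a; have h2 := hM.1 p a; have h3 := hc.b p a
  have : M p a = N p a - 1 := by rw [h]; simp [swt]; ring
  omega

theorem lift {cap : R → C → ℤ} {ρ κ al} (hc : CapOK cap)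
    (hz : ∀ M N, Om cap ρ κ M → Om cap ρ κ N → (∀ r c, M r c ≠ 1) → ∀ r c, cap r c = 1 → N r c = 0)
    (hF : ∀ N, Om cap ρ κ N → ∀ e e' : R × C, N e.1 e.2 = 1 → N e'.1 e'.2 = 1 →
      QC cap ρ κ al N e e') {N0 M0 : R → C → ℤ} {σ0 τ0 : R × C → ZMod 2} (hN0 : Om cap ρ κ N0)
    (hM0 : Om cap ρ κ M0) (hg0 : gp N0 σ0 = gp M0 τ0) : Cn cap ρ κ al (N0, σ0) (M0, τ0) := by
  have hsame : ∀ N σ σ', Om cap ρ κ N → gp N σ = gp N σ' → Cn cap ρ κ al (N, σ) (N, σ') :=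
    fun N σ σ' h h' => sameN h (fun _ => True) (fun e e' _ _ => hF N h e e') _ σ σ' (fun f hf => absurd trivial hf) h' le_rfl
  set par := gp N0 σ0 with hpar
  set Rz : (R → C → ℤ) → Prop := fun M => ∃ σ, gp M σ = par with hRz
  set Eq : (R → C → ℤ) → (R → C → ℤ) → Prop := fun N M => ∀ σ τ, gp N σ = par → gp M τ = par →
    Cn cap ρ κ al (N, σ) (M, τ) with hEq
  have etr : ∀ N M K, Rz M → Eq N M → Eq M K → Eq N K := fun N M K ⟨τ, h⟩ h1 h2 σ υ hσ hυ =>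
    (h1 σ τ hσ h).trans (h2 τ υ h hυ)
  have one : ∀ N M p q a b, Om cap ρ κ N → Om cap ρ κ M → p ≠ q → a ≠ b → M = swt p q a b N →
      Rz N → ∀ z : R × C, inZ p q a b z → M z.1 z.2 = 1 → Eq N M := by
    rintro N M p q a b hN hM hp ha hs ⟨σ, hσ⟩ z hz h1 σ' τ' hσ' hτ'
    have hgM := gp_fl M σ z h1 (par - gp M σ)
    refine (hsame N σ' σ hN (by rw [hσ, hσ'])).trans (.trans (.single (b := (M,
      fun f => σ f + (par - gp M σ) * fl z f)) ⟨hN, hM, ?_, Or.inr (Or.inr ⟨p, q, a, b, hp, ha,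
      hs, ?_⟩)⟩) (hsame M _ τ' hM ?_))
    · show gp N σ = gp M _
      rw [hgM, hσ]; ring
    · intro f hf _
      have : f ≠ z := by rintro rfl; exact hf hz
      simp [fl, this]
    · rw [hgM, hτ']; ring
  have esymm : ∀ N M, Eq N M → Eq M N := fun N M h σ τ h1 h2 => Cn_symm (h τ σ h2 h1)
  have two : ∀ N M, SwR cap ρ κ N M → Rz N → Rz M → Eq N M := by
    rintro N M ⟨hN, hM, p, q, a, b, hp, ha, hs⟩ h1 h2
    rcases SwR_pa hc hN hM hs with h | h
    · have hs' : N = swt p q b a M := by rw [hs, swt_inv ha]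
      exact esymm _ _ (one M N p q b a hM hN hp ha.symm hs' h2 (p, a) (by simp [inZ]) h)
    · exact one N M p q a b hN hM hp ha hs h1 (p, a) (by simp [inZ]) h
  have hbar : ∀ M, ¬ Rz M → ∀ r c, M r c ≠ 1 := fun M h r c h1 =>
    h (real_of_single (e := (r, c)) h1 par)
  have main : (Rz M0 → Eq N0 M0) ∧ (¬ Rz M0 → ∃ P, SwR cap ρ κ P M0 ∧ Rz P ∧ Eq N0 P) := by
    have hch := ryser (ρ := ρ) (κ := κ) (fun r c => (hc.b r c).1) _ N0 M0 hN0 hM0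
      (Int.self_le_toNat _)
    clear hg0
    induction hch with
    | refl => exact ⟨fun _ σ τ h1 h2 => hsame _ _ _ hN0 (by rw [h1, h2]), fun h =>
        absurd ⟨σ0, rfl⟩ h⟩
    | @tail M M2 _ hs ih =>
      have hM := hs.1
      obtain ⟨ih1, ih2⟩ := ih hM
      by_cases hR : Rz M
      · exact ⟨fun h2 => etr _ _ _ hR (ih1 hR) (two _ _ hs hR h2), fun h2 => ⟨M, hs, hR, ih1 hR⟩⟩
      obtain ⟨P, hP, hPR, hEP⟩ := ih2 hR
      have hb := hbar M hR
      obtain ⟨-, hM2, p', q', a', b', hp', ha', hs'⟩ := hs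
      obtain ⟨hPO, -, p, q, a, b, hp, ha, hsP⟩ := hP
      have hPM : P = swt p q b a M := by rw [hsP, swt_inv ha]
      have h2R : Rz M2 := real_of_single (e := (p', a'))
        ((SwR_pa hc hM hM2 hs').resolve_left (hb _ _)) par
      refine ⟨fun _ => ?_, fun h => absurd h2R h⟩
      have d1 : ∀ r c, -1 ≤ P r c - M r c ∧ P r c - M r c ≤ 1 := by
        intro r c; rw [hPM]; simp only [swt]; split_ifs <;> omega
      have d2 : ∀ r c, -1 ≤ M2 r c - M r c ∧ M2 r c - M r c ≤ 1 := by
        intro r c; rw [hs']; simp only [swt]; split_ifs <;> omega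
      set P3 : R → C → ℤ := fun r c => P r c + M2 r c - M r c with hP3
      have hO3 : Om cap ρ κ P3 := by
        refine ⟨fun r c => ?_, fun r => ?_, fun c => ?_⟩
        · have k1 := hM.1 r c; have k2 := hM2.1 r c; have k3 := hPO.1 r c
          have k4 := hc.b r c; have k5 := hb r c
          have k6 := d1 r c; have k7 := d2 r c
          simp only [hP3]
          by_cases hcap : cap r c = 1
          · have := hz M P hM hPO hb r c hcap
            have := hz M M hM hM hb r c hcap
            omega
          · omega
        · simp only [hP3, Finset.sum_sub_distrib, Finset.sum_add_distrib, hPO.2.1, hM2.2.1,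
            hM.2.1]; ring
        · simp only [hP3, Finset.sum_sub_distrib, Finset.sum_add_distrib, hPO.2.2, hM2.2.2,
            hM.2.2]; ring
      by_cases h3 : ∃ r c, P3 r c = 1
      · obtain ⟨r, c, h3⟩ := h3
        have h3R : Rz P3 := real_of_single (e := (r, c)) h3 par
        have e1 : SwR cap ρ κ P P3 := ⟨hPO, hO3, p', q', a', b', hp', ha', by
          funext r c; simp only [hP3]; rw [hs']; simp only [swt]; ring⟩
        have e2 : SwR cap ρ κ M2 P3 := ⟨hM2, hO3, p, q, b, a, hp, ha.symm, by
          funext r c; simp only [hP3]; rw [hPM]; simp only [swt]; ring⟩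
        exact etr _ _ _ hPR hEP (etr _ _ _ h3R (two _ _ e1 hPR h3R)
          (esymm _ _ (two _ _ e2 h2R h3R)))
      · push Not at h3
        have : P = M2 := by
          funext r c
          have k1 := hM.1 r c; have k2 := hM2.1 r c; have k3 := hPO.1 r c
          have k4 := hc.b r c; have k5 := hb r c
          have k6 := d1 r c; have k7 := d2 r c; have k8 := h3 r c
          have k9 := hO3.1 r c
          simp only [hP3] at k8 k9
          omega
        rwa [← this]
  exact main.1 ⟨τ0, hg0.symm⟩ σ0 τ0 rfl hg0.symm

/-- connectedness of all states of equal parity in the nonspecial case -/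
theorem absNS {L : R} {O : C} {ρ : R → ℤ} {κ : C → ℤ}
    (hH : ∀ N, Om (capLO L O) ρ κ N → HypS L O N)
    (hns : ∀ N, Om (capLO L O) ρ κ N → (∃ c, N L c = 0) ∨ ∃ r, N r O = 0)
    {al : (R → C → ℤ) → R × C → R × C → Prop}
    (hrow : ∀ N r c c', r = L ∨ (c ≠ O ∧ c' ≠ O) ∨ (c' = O ∧ (N L O ≠ 1 ∨ N L c ≠ 1)) →
      al N (r, c) (r, c'))
    (hcol : ∀ N r r' c, c = O ∨ (r ≠ L ∧ r' ≠ L) ∨ (r' = L ∧ (N L O ≠ 1 ∨ N r O ≠ 1)) →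
      al N (r, c) (r', c))
    {N M : R → C → ℤ} {σ τ : R × C → ZMod 2} (hN : Om (capLO L O) ρ κ N)
    (hM : Om (capLO L O) ρ κ M) (hg : gp N σ = gp M τ) :
    Cn (capLO L O) ρ κ al (N, σ) (M, τ) := by
  have hX : AX L O ρ κ (QC (capLO L O) ρ κ al) :=
    ⟨QC_QS _ _ _ _, fun N c c' h h1 h2 => QC_al h h1 h2 (hrow _ _ _ _ (Or.inl rfl)),
      fun N c c' h h1 h2 => QC_al h h1 h2 (hcol _ _ _ _ (Or.inl rfl)),
      fun N r c c' h a b h1 h2 => QC_al h h1 h2 (hrow _ _ _ _ (Or.inr (Or.inl ⟨a, b⟩))),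
      fun N r c c' h a b h1 h2 => QC_al h h1 h2 (hcol _ _ _ _ (Or.inr (Or.inl ⟨a, b⟩))),
      fun N r c h h1 h2 h3 => QC_al h h1 h2 (hrow _ _ _ _ (Or.inr (Or.inr ⟨rfl, h3⟩))),
      fun N r c h h1 h2 h3 => QC_al h h1 h2 (hcol _ _ _ _ (Or.inr (Or.inr ⟨rfl, h3⟩)))⟩
  refine lift (capLO_ok L O) ?_ (allQ hX hH hns) hN hM hg
  intro M N hM hN hb r c hcap
  have b1 := hN.1
  have key : ∀ r c, capLO L O r c = 1 → M r c = 0 := by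
    intro r c h; have := hM.1 r c; have := hb r c; omega
  by_cases hr : r = L
  · subst hr
    have h0 : ∑ c, N r c = 0 := by
      rw [hN.2.1, ← hM.2.1]; exact Finset.sum_eq_zero fun c _ => key r c (by simp [capLO])
    exact (Finset.sum_eq_zero_iff_of_nonneg (fun i _ => (b1 r i).1)).1 h0 c (Finset.mem_univ _)
  · have : c = O := by by_contra h; simp [capLO, hr, h] at hcap
    subst this
    have h0 : ∑ r, N r c = 0 := by
      rw [hN.2.2, ← hM.2.2]; exact Finset.sum_eq_zero fun r _ => key r c (by simp [capLO])
    exact (Finset.sum_eq_zero_iff_of_nonneg (fun i _ => (b1 i c).1)).1 h0 r (Finset.mem_univ _)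

/-- core version: all caps equal to two -/
theorem absCore {ρ : R → ℤ} {κ : C → ℤ}
    (hH : ∀ N, Om (fun _ _ => 2) ρ κ N → ∀ (S : R → Prop) (T : C → Prop), (∃ r, S r) →
      (∃ c, T c) → (∀ r c, S r → T c → N r c = 2) → (∀ r c, ¬ S r → ¬ T c → N r c = 0) → False)
    {al : (R → C → ℤ) → R × C → R × C → Prop}
    (hrow : ∀ N r c c', al N (r, c) (r, c')) (hcol : ∀ N r r' c, al N (r, c) (r', c))
    {N M : R → C → ℤ} {σ τ : R × C → ZMod 2} (hN : Om (fun _ _ => 2) ρ κ N)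
    (hM : Om (fun _ _ => 2) ρ κ M) (hg : gp N σ = gp M τ) :
    Cn (fun _ _ => 2) ρ κ al (N, σ) (M, τ) := by
  have hc : CapOK (fun (_ : R) (_ : C) => (2 : ℤ)) := ⟨by simp, by simp⟩
  have hQ := QC_QS (fun (_ : R) (_ : C) => (2 : ℤ)) ρ κ al
  have hA : AdjAll (fun (_ : R) (_ : C) => (2 : ℤ)) ρ κ (QC (fun _ _ => 2) ρ κ al) :=
    fun N hO r c h => ⟨fun c' h' => QC_al hO h h' (hrow _ _ _ _),
      fun r' h' => QC_al hO h h' (hcol _ _ _ _)⟩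
  refine lift hc (fun _ _ _ _ _ _ _ h => by simp at h) ?_ hN hM hg
  rintro N hO ⟨r1, c1⟩ ⟨r2, c2⟩ h1 h2
  by_contra hn
  have fin : ∀ {r1 c1 r2 c2}, N r1 c1 = 1 → N r2 c2 = 1 → N r1 c2 = 0 →
      ¬ QC (fun _ _ => 2) ρ κ al N (r1, c1) (r2, c2) → False := by
    intro r1 c1 r2 c2 h1 h2 h3 hn
    obtain ⟨S, T, hS, hT, hcl, hz, -, -⟩ := CL hQ hc hA hO h1 h2 h3 hn
    exact hH N hO S T ⟨_, hS⟩ ⟨_, hT⟩ hcl hz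
  rcases P2 hQ hc hA hO h1 h2 hn with h | h
  · exact fin h1 h2 h.1 hn
  · exact fin h2 h1 h.2 (fun h => hn (hQ.symm _ _ _ h))

end Abs4

section Real1
variable {R C : Type} [Fintype R] [Fintype C] {n : ℕ}

noncomputable def mv (e : ℝ) (i j : Fin n) (x : Fin n → ℝ) : Fin n → ℝ :=
  fun k => (if k = i ∨ k = j then e else 1) * x (Equiv.swap i j k)

lemma mv_l (e : ℝ) (i j : Fin n) (x : Fin n → ℝ) : mv e i j x i = e * x j := by simp [mv]
lemma mv_r (e : ℝ) (i j : Fin n) (x : Fin n → ℝ) : mv e i j x j = e * x i := by simp [mv]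
lemma mv_o (e : ℝ) {i j k : Fin n} (x : Fin n → ℝ) (h : k ≠ i) (h' : k ≠ j) : mv e i j x k = x k := by
  simp [mv, h, h', Equiv.swap_apply_of_ne_of_ne]
lemma mv_comm (e : ℝ) (i j : Fin n) (x : Fin n → ℝ) : mv e i j x = mv e j i x := by
  funext k; simp [mv, Equiv.swap_comm i j, or_comm]
lemma mv_abs {e : ℝ} (he : e = 1 ∨ e = -1) (i j : Fin n) (x : Fin n → ℝ) (k : Fin n) :
    |mv e i j x k| = |x (Equiv.swap i j k)| := by
  rcases he with rfl | rfl <;> simp only [mv] <;> split_ifs <;> simp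

def Rg (row : Fin n → R) (L : R) (x : Fin n → ℝ) : Prop :=
  ∀ i j, i ≠ j → row i = row j → |x i| = |x j| → row i ≠ L ∧ x i ≠ 0 ∧ x i = -x j

noncomputable def cnt (row : Fin n → R) (a : C → ℝ) (x : Fin n → ℝ) (r : R) (c : C) : ℤ :=
  ∑ k, if row k = r ∧ |x k| = a c then 1 else 0

noncomputable def sg (y : ℝ) : ZMod 2 := if y < 0 then 1 else 0

lemma sg_neg {y : ℝ} (h : y ≠ 0) : sg (-y) = sg y + 1 := by
  rcases lt_or_gt_of_ne h with h | h
  · simp [sg, h, not_lt.2 h.le]; decide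
  · simp [sg, h, not_lt.2 h.le]

lemma sg_inj {x y : ℝ} (h : |x| = |y|) (hs : sg x = sg y) : x = y := by
  rcases abs_eq_abs.1 h with h | h
  · exact h
  by_cases hy : y = 0
  · simp [h, hy]
  rw [h, sg_neg hy] at hs; simp at hs

lemma sg_ne {x y : ℝ} (h : |x| = |y|) (hs : sg x ≠ sg y) : x = -y := by
  rcases abs_eq_abs.1 h with h | h
  · exact absurd (by rw [h]) hs
  · exact h

structure Rep (row : Fin n → R) (L : R) (a : C → ℝ) (O : C) (x : Fin n → ℝ) (N : R → C → ℤ)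
    (σ : R × C → ZMod 2) : Prop where
  rg : Rg row L x
  ab : ∀ k, ∃ c, |x k| = a c
  ct : N = cnt row a x
  sn : ∀ k c, |x k| = a c → c ≠ O → N (row k) c = 1 → sg (x k) = σ (row k, c)

def ExP (row : Fin n → R) (L : R) (a : C → ℝ) (O : C) (x : Fin n → ℝ) (i j : Fin n) : Prop :=
  cnt row a x L O = 1 ∧ ((row i = row j ∧ row i ≠ L ∧ ∃ c, c ≠ O ∧
    ((x i = 0 ∧ |x j| = a c) ∨ (x j = 0 ∧ |x i| = a c)) ∧ cnt row a x L c = 1) ∨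
    (|x i| = |x j| ∧ x i ≠ 0 ∧ row i ≠ row j ∧ ((row i = L ∧ cnt row a x (row j) O = 1) ∨
      (row j = L ∧ cnt row a x (row i) O = 1))))

structure KR (row : Fin n → R) (L : R) (a : C → ℝ) (O : C)
    (K : (Fin n → ℝ) → (Fin n → ℝ) → Prop) : Prop where
  rf : ∀ x, Rg row L x → K x x
  tr : ∀ x y z, K x y → K y z → K x z
  m1 : ∀ x i j, Rg row L x → i ≠ j → row i = row j → K x (mv 1 i j x)
  m2 : ∀ x i j e, e = 1 ∨ e = -1 → i ≠ j → Rg row L x → Rg row L (mv e i j x) →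
    ¬ ExP row L a O x i j → K x (mv e i j x)

def alP (L : R) (O : C) (N : R → C → ℤ) (e e' : R × C) : Prop :=
  (e.1 = e'.1 ∧ (e.1 = L ∨ (e.2 ≠ O ∧ e'.2 ≠ O) ∨ (e'.2 = O ∧ (N L O ≠ 1 ∨ N L e.2 ≠ 1)))) ∨
  (e.2 = e'.2 ∧ (e.2 = O ∨ (e.1 ≠ L ∧ e'.1 ≠ L) ∨ (e'.1 = L ∧ (N L O ≠ 1 ∨ N e.1 O ≠ 1))))

structure AH (a : C → ℝ) (O : C) : Prop where
  inj : Function.Injective a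
  z : a O = 0
  nn : ∀ c, 0 ≤ a c

variable {row : Fin n → R} {L : R} {a : C → ℝ} {O : C}

lemma Rg_swap {x : Fin n → ℝ} (h : Rg row L x) {i j : Fin n} (hr : row i = row j) :
    Rg row L (mv 1 i j x) := by
  have hrow : ∀ k, row (Equiv.swap i j k) = row k := by
    intro k; rw [Equiv.swap_apply_def]; split_ifs with h1 h2
    · rw [h1, hr]
    · rw [h2, hr]
    · rfl
  have hm : ∀ k, mv 1 i j x k = x (Equiv.swap i j k) := by intro k; simp [mv]
  intro k l hkl hrr ha
  rw [hm, hm] at *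
  have := h _ _ ((Equiv.swap i j).injective.ne hkl) (by rw [hrow, hrow, hrr]) ha
  rwa [hrow] at this

lemma cnt_set (x : Fin n → ℝ) (r : R) (c : C) :
    cnt row a x r c = ((Finset.univ.filter fun k => row k = r ∧ |x k| = a c).card : ℤ) := by
  simp [cnt]

lemma cnt_pos {x : Fin n → ℝ} {r : R} {c : C} (h : 0 < cnt row a x r c) :
    ∃ k, row k = r ∧ |x k| = a c := by
  rw [cnt_set] at h
  obtain ⟨k, hk⟩ := Finset.card_pos.1 (by exact_mod_cast h)
  exact ⟨k, (Finset.mem_filter.1 hk).2⟩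

lemma cnt_uniq {x : Fin n → ℝ} {r : R} {c : C} (h : cnt row a x r c = 1) {k l : Fin n}
    (h1 : row k = r) (h2 : |x k| = a c) (h3 : row l = r) (h4 : |x l| = a c) : k = l := by
  rw [cnt_set] at h
  have h := Finset.card_eq_one.1 (by exact_mod_cast h)
  obtain ⟨m, hm⟩ := h
  have a1 : k ∈ ({m} : Finset (Fin n)) := by rw [← hm]; simp [h1, h2]
  have a2 : l ∈ ({m} : Finset (Fin n)) := by rw [← hm]; simp [h3, h4]
  simp at a1 a2; rw [a1, a2]

lemma cnt_ge1 {x : Fin n → ℝ} {r : R} {c : C} {k : Fin n}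
    (h1 : row k = r) (h2 : |x k| = a c) : 1 ≤ cnt row a x r c := by
  rw [cnt_set]
  exact_mod_cast Finset.card_pos.2 ⟨k, by simp [h1, h2]⟩

lemma cnt_le {x : Fin n → ℝ} (ha : AH a O) (h : Rg row L x) (r : R) (c : C) :
    0 ≤ cnt row a x r c ∧ cnt row a x r c ≤ capLO L O r c := by
  refine ⟨by rw [cnt_set]; positivity, ?_⟩
  have h2 : cnt row a x r c ≤ 2 := by
    by_contra hc
    rw [cnt_set] at hc
    have hc : 2 < (Finset.univ.filter fun k => row k = r ∧ |x k| = a c).card := by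
      have := not_le.1 hc; exact_mod_cast this
    obtain ⟨p, q, s, hp, hq, hs, h1, h2, h3⟩ := Finset.two_lt_card_iff.1 hc
    simp only [Finset.mem_filter, Finset.mem_univ, true_and] at hp hq hs
    have a1 := h p q h1 (by rw [hp.1, hq.1]) (by rw [hp.2, hq.2])
    have a2 := h p s h2 (by rw [hp.1, hs.1]) (by rw [hp.2, hs.2])
    have a3 := h q s h3 (by rw [hq.1, hs.1]) (by rw [hq.2, hs.2])
    have := a1.2.2; have := a2.2.2; have := a3.2.2
    apply a1.2.1; linarith
  simp only [capLO]; split_ifs with hs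
  · by_contra hc
    rw [cnt_set] at hc
    have hc : 1 < (Finset.univ.filter fun k => row k = r ∧ |x k| = a c).card := by
      have := not_le.1 hc; exact_mod_cast this
    obtain ⟨p, hp, q, hq, h1⟩ := Finset.one_lt_card.1 hc
    simp only [Finset.mem_filter, Finset.mem_univ, true_and] at hp hq
    have a1 := h p q h1 (by rw [hp.1, hq.1]) (by rw [hp.2, hq.2])
    rcases hs with rfl | rfl
    · exact a1.1 hp.1
    · apply a1.2.1; rw [← abs_eq_zero, hp.2, ha.z]
  · exact h2

lemma ne0 (ha : AH a O) {y : ℝ} {c : C} (h : |y| = a c) : y ≠ 0 ↔ c ≠ O := by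
  rw [not_iff_not, ← abs_eq_zero, h, ← ha.z]; exact ha.inj.eq_iff

/-- choose an entry of a cell with prescribed sign -/
lemma pick (ha : AH a O) {x : Fin n → ℝ} {N σ} (h : Rep row L a O x N σ) {r : R} {c : C}
    (hN : 0 < N r c) (s : ZMod 2) (hs : N r c = 1 → c ≠ O → s = σ (r, c)) :
    ∃ k, row k = r ∧ |x k| = a c ∧ (c ≠ O → sg (x k) = s) := by
  obtain ⟨k, hk, hc⟩ := cnt_pos (by rw [h.ct] at hN; exact hN)
  by_cases h1 : N r c = 1
  · refine ⟨k, hk, hc, fun hO => ?_⟩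
    rw [hs h1 hO, ← hk]; exact h.sn k c hc hO (by rw [hk, h1])
  by_cases hss : sg (x k) = s
  · exact ⟨k, hk, hc, fun _ => hss⟩
  have h2 : 1 < (Finset.univ.filter fun k => row k = r ∧ |x k| = a c).card := by
    have : (1 : ℤ) < cnt row a x r c := by rw [← h.ct]; omega
    rw [cnt_set] at this; exact_mod_cast this
  obtain ⟨l, hl, hne⟩ := Finset.exists_mem_ne h2 k
  simp only [Finset.mem_filter, Finset.mem_univ, true_and] at hl
  refine ⟨l, hl.1, hl.2, fun hO => ?_⟩
  have := h.rg l k hne (by rw [hl.1, hk]) (by rw [hl.2, hc])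
  rw [this.2.2, sg_neg ((ne0 ha hc).2 hO)]
  exact z2ne hss

/-- in-row sorting -/
lemma sameRep (ha : AH a O) {K} (hK : KR row L a O K) {N σ} {y : Fin n → ℝ}
    (hy : Rep row L a O y N σ) : ∀ (t : ℕ) (x : Fin n → ℝ), Rep row L a O x N σ →
    (Finset.univ.filter fun k => x k ≠ y k).card ≤ t → K x y := by
  intro t
  induction t with
  | zero =>
    intro x hx h
    rw [Nat.le_zero, Finset.card_eq_zero, Finset.filter_eq_empty_iff] at h
    have : x = y := by funext k; simpa using h (Finset.mem_univ k)
    rw [this]; exact hK.rf _ hy.rg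
  | succ t ih =>
    intro x hx h
    by_cases hne : ∃ i, x i ≠ y i
    · obtain ⟨i, hi⟩ := hne
      obtain ⟨c, hc⟩ := hy.ab i
      obtain ⟨j, hj, hjc, hs⟩ := pick ha hx (r := row i) (c := c)
        (by rw [hy.ct]; exact lt_of_lt_of_le one_pos (cnt_ge1 rfl hc)) (sg (y i))
        (fun h1 hO => hy.sn i c hc hO h1)
      have hxy : x j = y i := by
        by_cases hO : c = O
        · rw [hO, ha.z, abs_eq_zero] at hc hjc; rw [hc, hjc]
        · exact sg_inj (by rw [hc, hjc]) (hs hO)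
      have hij : i ≠ j := by rintro rfl; exact hi hxy
      have hyj : x j ≠ y j := by
        intro hh
        have h0 := hy.rg i j hij hj.symm (by rw [← hh, hxy])
        have : y i = y j := by rw [← hxy, hh]
        apply h0.2.1; linarith [h0.2.2]
      refine hK.tr _ _ _ (hK.m1 x i j hx.rg hij hj.symm) (ih _ ?_ ?_)
      · have hm : ∀ k, mv 1 i j x k = x (Equiv.swap i j k) := by intro k; simp [mv]
        have hrow : ∀ k, row (Equiv.swap i j k) = row k := by
          intro k; rw [Equiv.swap_apply_def]; split_ifs with h1 h2
          · rw [h1, hj]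
          · rw [h2, hj]
          · rfl
        refine ⟨Rg_swap hx.rg hj.symm, fun k => by rw [hm]; exact hx.ab _, ?_, fun k c h1 h2 h3 => ?_⟩
        · rw [hx.ct]; funext r c; simp only [cnt, hm]
          rw [← Equiv.sum_comp (Equiv.swap i j)]
          simp only [hrow]
        · rw [hm] at h1 ⊢
          rw [← hrow k] at h3 ⊢
          exact hx.sn _ _ h1 h2 h3
      · have hlt := Finset.card_lt_card (s := Finset.univ.filter fun k => mv 1 i j x k ≠ y k)
          (t := Finset.univ.filter fun k => x k ≠ y k) (by
            refine Finset.ssubset_iff_subset_ne.2 ⟨fun k hk => ?_, fun hh => ?_⟩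
            · simp only [Finset.mem_filter, Finset.mem_univ, true_and] at hk ⊢
              by_cases h1 : k = i
              · subst h1; exact hi
              by_cases h2 : k = j
              · subst h2; exact hyj
              rwa [mv_o _ _ h1 h2] at hk
            · have : i ∈ Finset.univ.filter fun k => x k ≠ y k := by simp [hi]
              rw [← hh] at this
              exact (Finset.mem_filter.1 this).2 (by rw [mv_l, one_mul, hxy]))
        omega
    · push Not at hne
      rw [show x = y from funext hne]; exact hK.rf _ hy.rg

/-- flip two signs in single cells -/
lemma flipRep (ha : AH a O) {K} (hK : KR row L a O K) {N σ} {x : Fin n → ℝ}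
    (hx : Rep row L a O x N σ) {e e' : R × C} (hne : e ≠ e') (he : N e.1 e.2 = 1)
    (he' : N e'.1 e'.2 = 1) (hal : alP L O N e e') :
    ∃ y, Rep row L a O y N (σ + fl e + fl e') ∧ K x y := by
  obtain ⟨i, hi, hic⟩ := cnt_pos (row := row) (a := a) (x := x) (r := e.1) (c := e.2) (by
    rw [← hx.ct, he]; norm_num)
  obtain ⟨j, hj, hjc⟩ := cnt_pos (row := row) (a := a) (x := x) (r := e'.1) (c := e'.2) (by
    rw [← hx.ct, he']; norm_num)
  have hij : i ≠ j := by
    rintro rfl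
    exact hne (Prod.ext (by rw [← hi, hj]) (ha.inj (by rw [← hic, hjc])))
  set y : Fin n → ℝ := fun k => if k = i ∨ k = j then -x k else x k with hy
  have hyab : ∀ k, |y k| = |x k| := by intro k; simp only [hy]; split_ifs <;> simp
  have hui : ∀ k, row k = e.1 → |x k| = a e.2 → k = i := fun k h1 h2 =>
    cnt_uniq (row := row) (a := a) (x := x) (by rw [← hx.ct]; exact he) h1 h2 hi hic
  have huj : ∀ k, row k = e'.1 → |x k| = a e'.2 → k = j := fun k h1 h2 =>
    cnt_uniq (row := row) (a := a) (x := x) (by rw [← hx.ct]; exact he') h1 h2 hj hjc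
  have hyR : Rep row L a O y N (σ + fl e + fl e') := by
    refine ⟨?_, fun k => by rw [hyab]; exact hx.ab k, ?_, ?_⟩
    · intro k l hkl hr hab
      rw [hyab, hyab] at hab
      have key : ∀ k l, k ≠ l → row k = row l → |x k| = |x l| → ¬ (k = i ∨ k = j) := by
        rintro k l hkl hr hab (rfl | rfl)
        · exact hkl (hui l (by rw [← hr, hi]) (by rw [← hab, hic])).symm
        · exact hkl (huj l (by rw [← hr, hj]) (by rw [← hab, hjc])).symm
      have k1 := key k l hkl hr hab
      have k2 := key l k hkl.symm hr.symm hab.symm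
      simp only [hy, if_neg k1, if_neg k2]
      exact hx.rg k l hkl hr hab
    · rw [hx.ct]; funext r c; simp only [cnt, hyab]
    · intro k c h1 h2 h3
      rw [hyab] at h1
      have hs := hx.sn k c h1 h2 h3
      have h0 := (ne0 ha h1).2 h2
      have f1 : ((row k, c) = e) ↔ k = i := ⟨fun h => by
        subst h; exact hui k rfl h1, fun h => Prod.ext (by rw [h, hi]) (ha.inj (by
          rw [← h1, h, hic]))⟩
      have f2 : ((row k, c) = e') ↔ k = j := ⟨fun h => by
        subst h; exact huj k rfl h1, fun h => Prod.ext (by rw [h, hj]) (ha.inj (by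
          rw [← h1, h, hjc]))⟩
      simp only [hy, Pi.add_apply, fl, f1, f2]
      by_cases g1 : k = i
      · have g2 : k ≠ j := by rw [g1]; exact hij
        simp [g1, hij]; rw [← g1, sg_neg h0, hs]
      · by_cases g2 : k = j
        · simp [g2, hij.symm]; rw [← g2, sg_neg h0, hs]
        · simp [g1, g2, hs]
  refine ⟨y, hyR, ?_⟩
  by_cases hrr : e.1 = e'.1
  · have hr : row i = row j := by rw [hi, hj, hrr]
    have hcc : e.2 ≠ e'.2 := fun h => hne (Prod.ext hrr h)
    have hy1 : mv (-1) i j x = mv 1 i j y := by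
      funext k
      by_cases h1 : k = i
      · subst h1; simp [mv_l, hy]
      by_cases h2 : k = j
      · subst h2; simp [mv_r, hy]
      rw [mv_o _ _ h1 h2, mv_o _ _ h1 h2]; simp [hy, h1, h2]
    have hy2 : mv 1 i j (mv (-1) i j x) = y := by
      rw [hy1]; funext k
      by_cases h1 : k = i
      · subst h1; simp [mv_l, mv_r]
      by_cases h2 : k = j
      · subst h2; simp [mv_l, mv_r]
      rw [mv_o _ _ h1 h2, mv_o _ _ h1 h2]
    have hRg : Rg row L (mv (-1) i j x) := by rw [hy1]; exact Rg_swap hyR.rg hr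
    refine hK.tr _ _ _ (hK.m2 x i j (-1) (Or.inr rfl) hij hx.rg hRg ?_) ?_
    · rw [ExP, ← hx.ct]
      rintro ⟨g1, ⟨g2, g3, c, g4, g5, g6⟩ | ⟨-, -, g2, -⟩⟩
      · rcases hal with ⟨-, h | h | h⟩ | ⟨h, -⟩
        · exact g3 (by rw [hi, h])
        · rcases g5 with ⟨g, -⟩ | ⟨g, -⟩
          · exact (ne0 ha hic).2 h.1 g
          · exact (ne0 ha hjc).2 h.2 g
        · rcases g5 with ⟨g, -⟩ | ⟨-, g⟩
          · exact hcc (by rw [h.1]; by_contra hc; exact (ne0 ha hic).2 hc g)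
          · have : c = e.2 := ha.inj (by rw [← g, hic])
            rw [this] at g6; tauto
        · exact hcc h
      · exact g2 hr
    · have := hK.m1 (mv (-1) i j x) i j hRg hij hr
      rwa [hy2] at this
  · have hcc : e.2 = e'.2 := by
      rcases hal with ⟨h, -⟩ | ⟨h, -⟩
      · exact absurd h hrr
      · exact h
    have hr : row i ≠ row j := by rw [hi, hj]; exact hrr
    have hab : |x i| = |x j| := by rw [hic, hjc, hcc]
    have hex : ¬ ExP row L a O x i j := by
      rw [ExP, ← hx.ct]
      rintro ⟨g1, ⟨g2, -⟩ | ⟨-, g2, -, g3⟩⟩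
      · exact hr g2
      · rcases hal with ⟨h, -⟩ | ⟨-, h | h | h⟩
        · exact hrr h
        · exact (ne0 ha hic).1 g2 h
        · rw [hi, hj] at g3; tauto
        · rw [hi, hj] at g3; rcases g3 with ⟨g, -⟩ | ⟨-, g⟩
          · exact hrr (by rw [g, h.1])
          · tauto
    have : ∃ ε : ℝ, (ε = 1 ∨ ε = -1) ∧ mv ε i j x = y := by
      rcases abs_eq_abs.1 hab with h | h
      · refine ⟨-1, Or.inr rfl, ?_⟩
        funext k
        by_cases h1 : k = i
        · subst h1; simp [mv_l, hy, h]
        by_cases h2 : k = j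
        · subst h2; simp [mv_r, hy, h]
        rw [mv_o _ _ h1 h2]; simp [hy, h1, h2]
      · refine ⟨1, Or.inl rfl, ?_⟩
        funext k
        by_cases h1 : k = i
        · subst h1; simp [mv_l, hy, h]
        by_cases h2 : k = j
        · subst h2; simp [mv_r, hy, h]
        rw [mv_o _ _ h1 h2]; simp [hy, h1, h2]
    obtain ⟨ε, hε, hm⟩ := this
    have := hK.m2 x i j ε hε hij hx.rg (by rw [hm]; exact hyR.rg) hex
    rwa [hm] at this

end Real1

section Real2
variable {R C : Type} [Fintype R] [Fintype C] {n : ℕ}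
variable {row : Fin n → R} {L : R} {a : C → ℝ} {O : C}

lemma half (ha : AH a O) {x y : Fin n → ℝ} {N N' : R → C → ℤ} {σ σ' : R × C → ZMod 2}
    (hx : Rep row L a O x N σ) {p : R} {i : Fin n} (hi : row i = p) {c0 c1 : C} (hc : c0 ≠ c1)
    (hxy : ∀ k, row k = p → k ≠ i → y k = x k) (hx0 : |x i| = a c0) (hy1 : |y i| = a c1)
    (hN : ∀ c, N' p c = N p c - (if c = c0 then 1 else 0) + if c = c1 then 1 else 0)
    (hcap : ∀ c, 0 ≤ N' p c ∧ N' p c ≤ capLO L O p c)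
    (hs0 : c0 ≠ O → sg (x i) = ctb N σ (p, c0) + ctb N' σ' (p, c0))
    (hs1 : c1 ≠ O → sg (y i) = ctb N σ (p, c1) + ctb N' σ' (p, c1))
    (hss : ∀ c, c ≠ c0 → c ≠ c1 → N p c = 1 → σ (p, c) = σ' (p, c)) :
    (∀ k l, k ≠ l → row k = p → row l = p → |y k| = |y l| → p ≠ L ∧ y k ≠ 0 ∧ y k = -y l) ∧
    (∀ c, cnt row a y p c = N' p c) ∧
    (∀ k c, row k = p → |y k| = a c → c ≠ O → N' p c = 1 → sg (y k) = σ' (p, c)) := by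
  have hcapN := fun c => cnt_le ha hx.rg p c
  rw [← hx.ct] at hcapN
  have key : ∀ l, l ≠ i → row l = p → |y i| = |y l| → p ≠ L ∧ y i ≠ 0 ∧ y i = -y l := by
    intro l hl hr hab
    rw [hxy l hr hl] at hab ⊢
    have h1 : 1 ≤ N p c1 := by rw [hx.ct]; exact cnt_ge1 hr (by rw [← hab, hy1])
    have h2 := hN c1
    rw [if_neg hc.symm, if_pos rfl] at h2
    have h3 := (hcap c1).2
    simp only [capLO] at h3
    split_ifs at h3 with hs
    · omega
    push Not at hs
    have h4 : N p c1 = 1 := by omega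
    have h5 : N' p c1 = 2 := by omega
    have h6 := hs1 hs.2
    have h7 := hx.sn l c1 (by rw [← hab, hy1]) hs.2 (by rw [hr, h4])
    refine ⟨hs.1, (ne0 ha hy1).2 hs.2, sg_ne hab ?_⟩
    rw [h6, h7, hr]; simp [ctb, h4, h5]
  refine ⟨?_, ?_, ?_⟩
  · intro k l hkl hk hl hab
    by_cases h1 : k = i
    · subst h1; exact key l hkl.symm hl hab
    by_cases h2 : l = i
    · subst h2
      have := key k hkl hk hab.symm
      refine ⟨this.1, ?_, ?_⟩
      · intro h0; apply this.2.1; rw [this.2.2, h0, neg_zero]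
      · rw [this.2.2, neg_neg]
    rw [hxy k hk h1, hxy l hl h2] at *
    have := hx.rg k l hkl (by rw [hk, hl]) hab
    rwa [hk] at this
  · intro c
    rw [hN c, hx.ct]
    have : cnt row a y p c - cnt row a x p c = ∑ k, if k = i then
        ((if c = c1 then (1:ℤ) else 0) - if c = c0 then 1 else 0) else 0 := by
      simp only [cnt]; rw [← Finset.sum_sub_distrib]
      refine Finset.sum_congr rfl fun k _ => ?_
      by_cases h1 : k = i
      · subst h1
        simp only [hi, hx0, hy1, true_and, ha.inj.eq_iff, if_true]
        simp only [eq_comm]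
      · simp only [h1, if_false]
        by_cases h2 : row k = p
        · rw [hxy k h2 h1]; simp
        · simp [h2]
    simp at this; omega
  · intro k c hk hkc hO hN1
    have h2 := hN c
    by_cases h1 : k = i
    · subst h1
      have : c = c1 := ha.inj (by rw [← hkc, hy1])
      subst this
      rw [if_neg hc.symm, if_pos rfl] at h2
      have h4 : N p c = 0 := by omega
      rw [hs1 hO]; simp [ctb, h4, hN1]
    · rw [hxy k hk h1] at hkc ⊢
      have h3 : 1 ≤ N p c := by rw [hx.ct]; exact cnt_ge1 hk hkc
      by_cases e1 : c = c1
      · subst e1; rw [if_neg hc.symm, if_pos rfl] at h2; omega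
      by_cases e0 : c = c0
      · subst e0; rw [if_pos rfl, if_neg e1] at h2
        have h4 : N p c = 2 := by omega
        have := hx.rg k i h1 (by rw [hk, hi]) (by rw [hkc, hx0])
        rw [this.2.2, sg_neg ((ne0 ha hx0).2 hO), hs0 hO]
        simp [ctb, h4, hN1]
        have := z2 (1 : ZMod 2); linear_combination this
      · rw [if_neg e0, if_neg e1] at h2
        have h4 : N p c = 1 := by omega
        rw [hx.sn k c hkc hO (by rw [hk, h4]), hk, hss c e0 e1 h4]

lemma z2ex (d : ZMod 2) : ∃ e : ℝ, (e = 1 ∨ e = -1) ∧ ∀ y : ℝ, y ≠ 0 → sg (e * y) = sg y + d := by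
  fin_cases d
  · exact ⟨1, Or.inl rfl, fun y _ => by rw [one_mul]; exact (add_zero _).symm⟩
  · exact ⟨-1, Or.inr rfl, fun y h => by rw [neg_one_mul, sg_neg h]; rfl⟩

lemma stepK (ha : AH a O) {K} (hK : KR row L a O K) {ρ κ}
    {S S' : (R → C → ℤ) × (R × C → ZMod 2)} (hS : Stp (capLO L O) ρ κ (alP L O) S S')
    {x : Fin n → ℝ} (hx : Rep row L a O x S.1 S.2) :
    ∃ y, Rep row L a O y S'.1 S'.2 ∧ K x y := by
  obtain ⟨N, σ⟩ := S
  obtain ⟨N', σ'⟩ := S'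
  obtain ⟨hO, hO', hg, h⟩ := hS
  dsimp only at *
  have cong : ∀ y τ, Rep row L a O y N τ → (∀ f : R × C, N f.1 f.2 = 1 → τ f = σ' f) →
      Rep row L a O y N σ' := fun y τ h1 h2 => ⟨h1.rg, h1.ab, h1.ct, fun k c e1 e2 e3 => by
        rw [h1.sn k c e1 e2 e3]; exact h2 _ e3⟩
  rcases h with ⟨rfl, h⟩ | ⟨rfl, e, e', he, he', hal, h⟩ | ⟨p, q, c0, c1, hpq, hab, rfl, h⟩
  · exact ⟨x, cong x σ hx h, hK.rf _ hx.rg⟩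
  · by_cases hne : e = e'
    · subst hne
      refine ⟨x, cong x σ hx fun f hf => ?_, hK.rf _ hx.rg⟩
      by_cases hfe : f = e
      · subst hfe
        by_contra hc
        have h1 : gp N σ' = gp N (σ + fl f) := gp_congr fun g hg => by
          by_cases hgf : g = f
          · subst hgf; simp [fl, z2ne hc]
          · simp [fl, hgf, h g hg hgf hgf]
        rw [h1, gp_fl1 _ _ _ hf] at hg
        simp at hg
      · exact h f hf hfe hfe
    · by_cases hee : σ e = σ' e
      · refine ⟨x, cong x σ hx fun f hf => ?_, hK.rf _ hx.rg⟩
        by_cases hfe : f = e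
        · rw [hfe, hee]
        by_cases hfe' : f = e'
        · subst hfe'
          by_contra hc
          have h1 : gp N σ' = gp N (σ + fl f) := gp_congr fun g hg => by
            by_cases hgf : g = f
            · subst hgf; simp [fl, z2ne hc]
            by_cases hge : g = e
            · simp [fl, hgf, hge, hee, hne]
            · simp [fl, hgf, h g hg hge hgf]
          rw [h1, gp_fl1 _ _ _ hf] at hg
          simp at hg
        · exact h f hf hfe hfe'
      · obtain ⟨y, hy, hk⟩ := flipRep ha hK hx hne he he' hal
        refine ⟨y, cong y _ hy fun f hf => ?_, hk⟩
        by_cases hfe : f = e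
        · subst hfe; simp [fl, hne, z2ne hee]
        by_cases hfe' : f = e'
        · subst hfe'
          by_contra hc
          have h1 : gp N σ' = gp N (σ + fl e) := gp_congr fun g hg => by
            by_cases hgf : g = f
            · subst hgf
              simp [fl, hfe] at hc ⊢
              have := z2ne hc
              rw [← this, add_assoc, z2, add_zero]
            by_cases hge : g = e
            · subst hge; simp [fl, z2ne hee]
            · simp [fl, hge, h g hg hge hgf]
          rw [h1, gp_fl1 _ _ _ he] at hg
          simp at hg
        · simp [fl, hfe, hfe', h f hf hfe hfe']
  · set N' := swt p q c0 c1 N with hN'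
    set d : R × C → ZMod 2 := fun e => ctb N σ e + ctb N' σ' e with hd
    have hrp : ∀ c, N' p c = N p c - (if c = c0 then 1 else 0) + if c = c1 then 1 else 0 := by
      intro c; simp only [hN', swt]; split_ifs <;> first | omega | simp_all
    have hrq : ∀ c, N' q c = N q c - (if c = c1 then 1 else 0) + if c = c0 then 1 else 0 := by
      intro c; simp only [hN', swt]; split_ifs <;> first | omega | simp_all
    have hro : ∀ r c, r ≠ p → r ≠ q → N' r c = N r c := by
      intro r c h1 h2; simp [hN', swt, h1, h2]
    have hsum : d (p, c0) + d (p, c1) + (d (q, c0) + d (q, c1)) = 0 := by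
      have h1 : ∑ e, d e = 0 := by
        rw [hd, Finset.sum_add_distrib]; change gp N σ + gp N' σ' = 0
        rw [hg, z2]
      have h2 : ∀ e, ¬ inZ p q c0 c1 e → d e = 0 := by
        intro e he
        have h3 := h e he
        have h4 : N' e.1 e.2 = N e.1 e.2 := swt_out he
        simp only [hd, ctb, h4]
        by_cases h5 : N e.1 e.2 = 1
        · simp [h5, h3 h5, z2]
        · simp only [h5, if_false]; exact z2 _
      rw [Fintype.sum_prod_type] at h1
      rw [Fintype.sum_eq_add p q hpq (fun r hr => Finset.sum_eq_zero fun c _ => h2 _ (by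
        simp only [inZ]; tauto))] at h1
      rw [Fintype.sum_eq_add c0 c1 hab (fun c hc => h2 _ (by simp only [inZ]; tauto)),
        Fintype.sum_eq_add c0 c1 hab (fun c hc => h2 _ (by simp only [inZ]; tauto))] at h1
      exact h1
    have hp0 := hrp c0
    have hq1 := hrq c1
    have hnp := (hO'.1 p c0).1
    have hnq := (hO'.1 q c1).1
    rw [if_pos rfl, if_neg hab] at hp0
    rw [if_pos rfl, if_neg hab.symm] at hq1
    obtain ⟨i, hi, hic, his⟩ := pick ha hx (r := p) (c := c0) (by omega) (d (p, c0)) (by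
      intro h1 _
      have : N' p c0 = 0 := by omega
      simp [hd, ctb, h1, this])
    obtain ⟨j, hj, hjc, hjs⟩ := pick ha hx (r := q) (c := c1) (by omega) (d (q, c1)) (by
      intro h1 _
      have : N' q c1 = 0 := by omega
      simp [hd, ctb, h1, this])
    have hij : i ≠ j := by rintro rfl; exact hpq (by rw [← hi, hj])
    obtain ⟨ε, hε, hεs⟩ := z2ex (d (p, c1) + d (q, c1))
    have hεa : |ε| = 1 := by rcases hε with rfl | rfl <;> simp
    set y := mv ε i j x with hy
    have H1 := half (N' := N') (σ' := σ') (y := y) ha hx hi hab (fun k hk hki => mv_o _ _ hki (by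
        rintro rfl; exact hpq (by rw [← hk, hj]))) hic (by rw [hy, mv_l, abs_mul, hεa, one_mul, hjc])
      hrp (fun c => hO'.1 p c) his (fun h1 => by
        rw [hy, mv_l, hεs _ ((ne0 ha hjc).2 h1), hjs h1]
        have := z2 (d (q, c1)); linear_combination this)
      (fun c h0 h1 hs => h (p, c) (by simp [inZ, h0, h1]) hs)
    have H2 := half (N' := N') (σ' := σ') (y := y) ha hx hj hab.symm (fun k hk hki => mv_o _ _ (by
        rintro rfl; exact hpq (by rw [← hk, hi])) hki) hjc (by rw [hy, mv_r, abs_mul, hεa, one_mul, hic])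
      hrq (fun c => hO'.1 q c) hjs (fun h1 => by
        rw [hy, mv_r, hεs _ ((ne0 ha hic).2 h1), his h1]
        have := z2 (d (q, c0)); linear_combination hsum - this)
      (fun c h0 h1 hs => h (q, c) (by simp [inZ, h0, h1]) hs)
    have hyo : ∀ k, row k ≠ p → row k ≠ q → y k = x k := fun k h1 h2 => mv_o _ _ (by
      rintro rfl; exact h1 hi) (by rintro rfl; exact h2 hj)
    have hR : Rep row L a O y N' σ' := by
      refine ⟨?_, ?_, ?_, ?_⟩
      · intro k l hkl hr hab
        by_cases hp : row k = p
        · rw [hp]; exact H1.1 k l hkl hp (by rw [← hr, hp]) hab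
        by_cases hq : row k = q
        · rw [hq]; exact H2.1 k l hkl hq (by rw [← hr, hq]) hab
        rw [hyo k hp hq, hyo l (by rwa [← hr]) (by rwa [← hr])] at *
        exact hx.rg k l hkl hr hab
      · intro k; rw [hy, mv_abs hε]; exact hx.ab _
      · funext r c
        by_cases hp : r = p
        · rw [hp]; exact (H1.2.1 c).symm
        by_cases hq : r = q
        · rw [hq]; exact (H2.2.1 c).symm
        rw [hro r c hp hq, hx.ct]
        refine Finset.sum_congr rfl fun k _ => ?_
        by_cases hk : row k = r
        · rw [hyo k (by rwa [hk]) (by rwa [hk])]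
        · simp [hk]
      · intro k c h1 h2 h3
        by_cases hp : row k = p
        · rw [hp] at h3 ⊢; exact H1.2.2 k c hp h1 h2 h3
        by_cases hq : row k = q
        · rw [hq] at h3 ⊢; exact H2.2.2 k c hq h1 h2 h3
        rw [hyo k hp hq] at *
        rw [hro _ c hp hq] at h3
        rw [hx.sn k c h1 h2 h3]
        exact h (row k, c) (by simp [inZ, hp, hq]) h3
    refine ⟨y, hR, hK.m2 x i j ε hε hij hx.rg hR.rg ?_⟩
    rintro ⟨-, ⟨g, -⟩ | ⟨g, -⟩⟩
    · exact hpq (by rw [← hi, ← hj, g])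
    · exact hab (ha.inj (by rw [← hic, ← hjc, g]))

lemma CnK (ha : AH a O) {K} (hK : KR row L a O K) {ρ κ}
    {S S' : (R → C → ℤ) × (R × C → ZMod 2)} (hS : Cn (capLO L O) ρ κ (alP L O) S S')
    {x : Fin n → ℝ} (hx : Rep row L a O x S.1 S.2) :
    ∃ y, Rep row L a O y S'.1 S'.2 ∧ K x y := by
  induction hS with
  | refl => exact ⟨x, hx, hK.rf _ hx.rg⟩
  | tail _ h ih =>
    obtain ⟨y, hy, hk⟩ := ih
    obtain ⟨z, hz, hk'⟩ := stepK ha hK h hy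
    exact ⟨z, hz, hK.tr _ _ _ hk hk'⟩

lemma CnK2 (ha : AH a O) {K} (hK : KR row L a O K) {ρ κ}
    {S S' : (R → C → ℤ) × (R × C → ZMod 2)} (hS : Cn (capLO L O) ρ κ (alP L O) S S')
    {x y : Fin n → ℝ} (hx : Rep row L a O x S.1 S.2) (hy : Rep row L a O y S'.1 S'.2) : K x y := by
  obtain ⟨z, hz, hk⟩ := CnK ha hK hS hx
  exact hK.tr _ _ _ hk (sameRep ha hK hy _ z hz le_rfl)

end Real2

section Real3
variable {R C : Type} [Fintype R] [Fintype C] {n : ℕ}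
variable {row : Fin n → R} {L : R} {a : C → ℝ} {O : C}

noncomputable def exN (L : R) (O : C) (N : {r // r ≠ L} → {c // c ≠ O} → ℤ) (r : R) (c : C) : ℤ :=
  if h : r ≠ L ∧ c ≠ O then N ⟨r, h.1⟩ ⟨c, h.2⟩ else 1
noncomputable def exS (L : R) (O : C) (β : R × C → ZMod 2)
    (σ : {r // r ≠ L} × {c // c ≠ O} → ZMod 2) (e : R × C) : ZMod 2 :=
  if h : e.1 ≠ L ∧ e.2 ≠ O then σ (⟨e.1, h.1⟩, ⟨e.2, h.2⟩) else β e

lemma splitE (L : R) (O : C) (g : R × C → ZMod 2) : ∑ e, g e = ∑ c, g (L, c) +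
    ∑ r : {r // r ≠ L}, g (r, O) + ∑ e : {r // r ≠ L} × {c // c ≠ O}, g (e.1, e.2) := by
  rw [Fintype.sum_prod_type, Fintype.sum_eq_add_sum_subtype_ne _ L, add_assoc]
  congr 1
  rw [Fintype.sum_prod_type, ← Finset.sum_add_distrib]
  refine Finset.sum_congr rfl fun r _ => ?_
  rw [Fintype.sum_eq_add_sum_subtype_ne _ O]

lemma exN_in {N} (r : {r // r ≠ L}) (c : {c // c ≠ O}) : exN L O N r c = N r c := by
  simp [exN, r.2, c.2]
lemma exN_L {N} (c) : exN L O N L c = 1 := by simp [exN]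
lemma exN_O {N} (r) : exN L O N r O = 1 := by simp [exN]

lemma ex_gp (β : R × C → ZMod 2) (N σ) : gp (exN L O N) (exS L O β σ) =
    ∑ c, β (L, c) + ∑ r : {r // r ≠ L}, β (r, O) + gp N σ := by
  rw [gp, splitE L O]
  congr 1
  · congr 1
    · refine Finset.sum_congr rfl fun c _ => ?_
      simp [ctb, exN, exS]
    · refine Finset.sum_congr rfl fun c _ => ?_
      simp [ctb, exN, exS]
  · refine Finset.sum_congr rfl fun e _ => ?_
    simp [ctb, exN, exS, e.1.2, e.2.2]

lemma ex_Om {ρ : R → ℤ} {κ : C → ℤ} (hL : ∑ c : C, (1 : ℤ) = ρ L) (hO : ∑ r : R, (1 : ℤ) = κ O) (N) :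
    Om (capLO L O) ρ κ (exN L O N) ↔ Om (fun _ _ => 2) (fun r : {r // r ≠ L} => ρ r - 1)
      (fun c : {c // c ≠ O} => κ c - 1) N := by
  have hr : ∀ r : {r // r ≠ L}, ∑ c, exN L O N r c = 1 + ∑ c, N r c := fun r => by
    rw [Fintype.sum_eq_add_sum_subtype_ne _ O, exN_O]; simp only [exN_in]
  have hc : ∀ c : {c // c ≠ O}, ∑ r, exN L O N r c = 1 + ∑ r, N r c := fun c => by
    rw [Fintype.sum_eq_add_sum_subtype_ne _ L, exN_L]; simp only [exN_in]
  constructor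
  · rintro ⟨h1, h2, h3⟩
    refine ⟨fun r c => ?_, fun r => ?_, fun c => ?_⟩
    · have := h1 r c; rw [exN_in] at this; simpa [capLO, r.2, c.2] using this
    · have := h2 r; rw [hr] at this; linarith
    · have := h3 c; rw [hc] at this; linarith
  · rintro ⟨h1, h2, h3⟩
    refine ⟨fun r c => ?_, fun r => ?_, fun c => ?_⟩
    · by_cases h : r ≠ L ∧ c ≠ O
      · have := h1 ⟨r, h.1⟩ ⟨c, h.2⟩
        rw [← exN_in (L := L) (O := O) (N := N)] at this
        simpa [capLO, h.1, h.2] using this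
      · have h' : r = L ∨ c = O := by tauto
        simp [exN, capLO, h, h']
    · by_cases h : r = L
      · subst h; simp only [exN_L]; exact hL
      · have := h2 ⟨r, h⟩; have := hr ⟨r, h⟩; simp only at *; linarith
    · by_cases h : c = O
      · subst h; simp only [exN_O]; exact hO
      · have := h3 ⟨c, h⟩; have := hc ⟨c, h⟩; simp only at *; linarith

lemma absSp {ρ : R → ℤ} {κ : C → ℤ} (hH : ∀ N, Om (capLO L O) ρ κ N → HypS L O N)
    (hsp : ∀ N, Om (capLO L O) ρ κ N → ∀ r c, (r = L ∨ c = O) → N r c = 1)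
    {N M : R → C → ℤ} {σ τ : R × C → ZMod 2} (hN : Om (capLO L O) ρ κ N)
    (hM : Om (capLO L O) ρ κ M) (hst : ∀ r, r ≠ L → σ (r, O) = τ (r, O)) (hg : gp N σ = gp M τ)
    (hcore : ∑ e : R × C, (if e.1 ≠ L ∧ e.2 ≠ O then ctb N σ e else 0) =
      ∑ e : R × C, (if e.1 ≠ L ∧ e.2 ≠ O then ctb M τ e else 0)) :
    Cn (capLO L O) ρ κ (alP L O) (N, σ) (M, τ) := by
  have hL : ∑ c : C, (1 : ℤ) = ρ L := by
    rw [← hN.2.1 L]; exact Finset.sum_congr rfl fun c _ => (hsp N hN L c (Or.inl rfl)).symm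
  have hOO : ∑ r : R, (1 : ℤ) = κ O := by
    rw [← hN.2.2 O]; exact Finset.sum_congr rfl fun r _ => (hsp N hN r O (Or.inr rfl)).symm
  set rN : (R → C → ℤ) → {r // r ≠ L} → {c // c ≠ O} → ℤ := fun N r c => N r c with hrN
  set rS : (R × C → ZMod 2) → {r // r ≠ L} × {c // c ≠ O} → ZMod 2 := fun σ e => σ (e.1, e.2) with hrS
  have hex : ∀ N, Om (capLO L O) ρ κ N → exN L O (rN N) = N := by
    intro N hN; funext r c
    by_cases h : r ≠ L ∧ c ≠ O
    · simp [exN, h, hrN]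
    · simp only [exN, h, dif_neg, not_false_iff]; exact (hsp N hN r c (by tauto)).symm
  have hexs : ∀ σ, exS L O σ (rS σ) = σ := by
    intro σ; funext e; simp only [exS]; split_ifs <;> rfl
  have hOm : ∀ N, Om (capLO L O) ρ κ N → Om (fun _ _ => 2) (fun r : {r // r ≠ L} => ρ r - 1)
      (fun c : {c // c ≠ O} => κ c - 1) (rN N) := fun N hN => by
    rw [← ex_Om hL hOO, hex N hN]; exact hN
  have hcg : ∀ N σ, ∑ e : R × C, (if e.1 ≠ L ∧ e.2 ≠ O then ctb N σ e else 0) = gp (rN N) (rS σ) := by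
    intro N σ; rw [splitE L O]; simp only [ne_eq, not_true, false_and, and_false, if_false,
      Finset.sum_const_zero, zero_add]
    refine Finset.sum_congr rfl fun e _ => ?_
    simp [e.1.2, e.2.2, ctb, hrN, hrS]
  rw [hcg, hcg] at hcore
  have hC := absCore (al := fun _ e e' => e.1 = e'.1 ∨ e.2 = e'.2) (fun N' hN' S T hS hT h1 h2 => by
      obtain ⟨s, hs⟩ := hS
      obtain ⟨t, ht⟩ := hT
      have hh := hH _ ((ex_Om hL hOO N').2 hN')
        (fun r => ∀ h : r ≠ L, S ⟨r, h⟩) (fun c => ∀ h : c ≠ O, T ⟨c, h⟩)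
        ⟨L, fun h => absurd rfl h⟩ ⟨O, fun h => absurd rfl h⟩
        ⟨fun _ h => absurd rfl h, fun _ h => absurd rfl h⟩ (fun r c hr hc => by
          by_cases h : r ≠ L ∧ c ≠ O
          · rw [exN, dif_pos h, h1 _ _ (hr h.1) (hc h.2)]; simp [capLO, h]
          · rw [exN, dif_neg h, capLO, if_pos (by tauto)])
        (fun r c hr hc => by
          push Not at hr hc
          obtain ⟨h, hr⟩ := hr
          obtain ⟨h', hc⟩ := hc
          rw [exN, dif_pos ⟨h, h'⟩, h2 _ _ hr hc])
      rcases hh with ⟨-, h⟩ | ⟨h, -⟩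
      · exact t.2 ((h t).1 fun _ => ht)
      · exact s.2 ((h s).1 fun _ => hs))
    (fun _ _ _ _ => Or.inl rfl) (fun _ _ _ _ => Or.inr rfl) (hOm N hN) (hOm M hM) hcore
  have hlift : ∀ S S', Cn (fun _ _ => 2) (fun r : {r // r ≠ L} => ρ r - 1)
      (fun c : {c // c ≠ O} => κ c - 1) (fun _ e e' => e.1 = e'.1 ∨ e.2 = e'.2) S S' →
      Cn (capLO L O) ρ κ (alP L O) (exN L O S.1, exS L O σ S.2) (exN L O S'.1, exS L O σ S'.2) := by
    intro S S' h
    induction h with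
    | refl => exact .refl
    | tail _ h ih =>
      refine ih.tail ?_
      obtain ⟨h1, h2, h3, h⟩ := h
      have hfs : ∀ (A B : {r // r ≠ L} × {c // c ≠ O} → ZMod 2) (f : R × C),
          (∀ h : f.1 ≠ L ∧ f.2 ≠ O, A (⟨f.1, h.1⟩, ⟨f.2, h.2⟩) = B (⟨f.1, h.1⟩, ⟨f.2, h.2⟩)) →
          exS L O σ A f = exS L O σ B f := by
        intro A B f h; simp only [exS]; split_ifs with hh
        · exact h hh
        · rfl
      refine ⟨(ex_Om hL hOO _).2 h1, (ex_Om hL hOO _).2 h2, by rw [ex_gp, ex_gp, h3], ?_⟩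
      rcases h with ⟨e, h⟩ | ⟨e, x, y, hx, hy, hal, h⟩ | ⟨p, q, b, c, hp, hq, e, h⟩
      · refine Or.inl ⟨by simp only [e], fun f hf => hfs _ _ _ fun hh => h _ ?_⟩
        simp only [exN] at hf; rw [dif_pos hh] at hf; exact hf
      · refine Or.inr (Or.inl ⟨by simp only [e], (x.1, x.2), (y.1, y.2), ?_, ?_, ?_,
          fun f hf hf1 hf2 => hfs _ _ _ fun hh => h _ ?_ ?_ ?_⟩)
        · simp only [exN_in]; exact hx
        · simp only [exN_in]; exact hy
        · rcases hal with hal | hal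
          · exact Or.inl ⟨by simp [hal], Or.inr (Or.inl ⟨x.2.2, y.2.2⟩)⟩
          · exact Or.inr ⟨by simp [hal], Or.inr (Or.inl ⟨x.1.2, y.1.2⟩)⟩
        · simp only [exN] at hf; rw [dif_pos hh] at hf; exact hf
        · rintro rfl; exact hf1 rfl
        · rintro rfl; exact hf2 rfl
      · refine Or.inr (Or.inr ⟨p, q, b, c, fun h => hp (Subtype.ext h), fun h => hq (Subtype.ext h),
          ?_, fun f hf hf1 => hfs _ _ _ fun hh => h _ ?_ ?_⟩)
        · simp only [e]; funext r d
          by_cases hh : r ≠ L ∧ d ≠ O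
          · simp only [exN, hh, swt, dif_pos, ne_eq, not_false_iff, and_self, Subtype.ext_iff]
          · simp only [exN, swt, dif_neg hh]
            have : r = L ∨ d = O := by tauto
            rcases this with h | h
            · have e1 : r ≠ p := fun h' => p.2 (by rw [← h', h])
              have e2 : r ≠ q := fun h' => q.2 (by rw [← h', h])
              simp [e1, e2]
            · have e1 : d ≠ b := fun h' => b.2 (by rw [← h', h])
              have e2 : d ≠ c := fun h' => c.2 (by rw [← h', h])
              simp [e1, e2]
        · simp only [inZ, Subtype.ext_iff] at hf ⊢; exact hf
        · simp only [exN] at hf1; rw [dif_pos hh] at hf1; exact hf1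
  have h1 := hlift _ _ hC
  simp only [hex N hN, hex M hM, hexs] at h1
  refine h1.trans (sameN hM (fun e => e.1 = L) (fun e e' h h' he he' => QC_al hM he he'
    (Or.inl ⟨by rw [h, h'], Or.inl h⟩)) _ _ _ ?_ ?_ le_rfl)
  · intro f hf
    by_cases hfO : f.2 = O
    · have : f = (f.1, O) := Prod.ext rfl hfO
      rw [this, ← hst _ hf]; simp [exS]
    · simp only [exS]; rw [dif_pos ⟨hf, hfO⟩]
  · rw [← hg]; have := ex_gp (L := L) (O := O) σ (rN M) (rS τ)
    rw [hex M hM] at this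
    rw [this, ← hcore, ← ex_gp, hex N hN, hexs]

noncomputable def rhoF (row : Fin n → R) (r : R) : ℤ := ∑ k, if row k = r then 1 else 0
noncomputable def kapF (a : C → ℝ) (x : Fin n → ℝ) (c : C) : ℤ := ∑ k, if |x k| = a c then 1 else 0

lemma cnt_Om (ha : AH a O) {x : Fin n → ℝ} (hx : Rg row L x) (hab : ∀ k, ∃ c, |x k| = a c) :
    Om (capLO L O) (rhoF row) (kapF a x) (cnt row a x) := by
  refine ⟨fun r c => cnt_le ha hx r c, fun r => ?_, fun c => ?_⟩
  · simp only [cnt, rhoF]; rw [Finset.sum_comm]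
    refine Finset.sum_congr rfl fun k _ => ?_
    obtain ⟨c, hc⟩ := hab k
    simp only [hc, ha.inj.eq_iff]
    by_cases h : row k = r <;> simp [h]
  · simp only [cnt, kapF]; rw [Finset.sum_comm]
    refine Finset.sum_congr rfl fun k _ => ?_
    by_cases h : |x k| = a c <;> simp [h]

lemma exRep (ha : AH a O) {x : Fin n → ℝ} (hx : Rg row L x) (hab : ∀ k, ∃ c, |x k| = a c) :
    ∃ σ, Rep row L a O x (cnt row a x) σ ∧ (∀ r, σ (r, O) = 0) ∧
      ∀ (A : R × C → Prop) (B : Fin n → Prop), (∀ k c, |x k| = a c → (A (row k, c) ∧ c ≠ O ↔ B k ∧ c ≠ O)) →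
      ∑ e, (if A e then ctb (cnt row a x) σ e else 0) = ∑ k, if B k then sg (x k) else 0 := by
  choose col hcol using hab
  set σ : R × C → ZMod 2 := fun e => ∑ k, if row k = e.1 ∧ |x k| = a e.2 then sg (x k) else 0 with hσ
  have hO : ∀ r, σ (r, O) = 0 := by
    intro r; refine Finset.sum_eq_zero fun k _ => ?_
    split_ifs with h
    · have := h.2; rw [ha.z, abs_eq_zero] at this; rw [this]; simp [sg]
    · rfl
  have h1 : ∀ k c, |x k| = a c → cnt row a x (row k) c = 1 → σ (row k, c) = sg (x k) := by
    intro k c hk hc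
    simp only [hσ]
    rw [Finset.sum_eq_single k]
    · simp [hk]
    · intro l _ hl; rw [if_neg]; rintro ⟨e1, e2⟩
      exact hl (cnt_uniq hc e1 e2 rfl hk)
    · simp
  refine ⟨σ, ⟨hx, fun k => ⟨_, hcol k⟩, rfl, fun k c e1 _ e3 => (h1 k c e1 e3).symm⟩, hO, ?_⟩
  intro A B hAB
  have hct : ∀ e, ctb (cnt row a x) σ e = σ e := by
    rintro ⟨r, c⟩
    simp only [ctb]; split_ifs with e1 e2
    · rfl
    · rw [cnt_set] at e2
      obtain ⟨k, l, hkl, hs⟩ := Finset.card_eq_two.1 (by exact_mod_cast e2)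
      have hk : k ∈ Finset.univ.filter fun k => row k = r ∧ |x k| = a c := by rw [hs]; simp
      have hl : l ∈ Finset.univ.filter fun k => row k = r ∧ |x k| = a c := by rw [hs]; simp
      simp only [Finset.mem_filter, Finset.mem_univ, true_and] at hk hl
      have := hx l k hkl.symm (by rw [hk.1, hl.1]) (by rw [hk.2, hl.2])
      have h0 : x k ≠ 0 := fun h => this.2.1 (by rw [this.2.2, h, neg_zero])
      simp only [hσ]
      rw [← Finset.sum_filter, hs, Finset.sum_pair hkl, this.2.2, sg_neg h0, ← add_assoc, z2, zero_add]
    · have := cnt_le ha hx r c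
      have hc2 : capLO L O r c ≤ 2 := by simp only [capLO]; split_ifs <;> omega
      have e0 : cnt row a x r c = 0 := by change cnt row a x r c ≠ 1 at e1; change cnt row a x r c ≠ 2 at e2; omega
      symm; refine Finset.sum_eq_zero fun k _ => if_neg ?_
      rintro ⟨e1, e2⟩; simp only at e1 e2
      have := cnt_ge1 (row := row) (a := a) e1 e2; omega
  simp only [hct]
  have : ∀ e : R × C, (if A e then ∑ k, (if row k = e.1 ∧ |x k| = a e.2 then sg (x k) else 0) else 0)
      = ∑ k, if e = (row k, col k) then (if A e then sg (x k) else 0) else 0 := by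
    intro e
    by_cases hA : A e
    · simp only [hA, if_true]
      refine Finset.sum_congr rfl fun k _ => ?_
      have : (row k = e.1 ∧ |x k| = a e.2) ↔ e = (row k, col k) := by
        rw [hcol k, ha.inj.eq_iff, Prod.ext_iff]; simp only [eq_comm]
      simp only [this]
    · simp [hA]
  refine (Finset.sum_congr rfl fun e _ => this e).trans ?_
  rw [Finset.sum_comm]
  refine Finset.sum_congr rfl fun k _ => ?_
  rw [Finset.sum_ite_eq' Finset.univ (row k, col k)]
  simp only [Finset.mem_univ, if_true]
  have := hAB k (col k) (hcol k)
  by_cases hc : col k = O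
  · have h0 := hcol k; rw [hc, ha.z, abs_eq_zero] at h0; simp [h0, sg]
  · simp only [hc, ne_eq, not_false_iff, and_true] at this; simp only [this]

lemma Rep_fl (ha : AH a O) {x : Fin n → ℝ} {N σ} (h : Rep row L a O x N σ) (r : R) (z : ZMod 2) :
    Rep row L a O x N (fun f => σ f + z * fl (r, O) f) :=
  ⟨h.rg, h.ab, h.ct, fun k c e1 e2 e3 => by
    rw [h.sn k c e1 e2 e3]; simp [fl, e2]⟩

theorem RL_NS (ha : AH a O) {K} (hK : KR row L a O K) {x y : Fin n → ℝ}
    (hx : Rg row L x) (hy : Rg row L y) (hxa : ∀ k, ∃ c, |x k| = a c) (hya : ∀ k, ∃ c, |y k| = a c)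
    (hκ : kapF a y = kapF a x) (hp : (∃ k, x k = 0) ∨ ∑ k, sg (x k) = ∑ k, sg (y k))
    (hH : ∀ N, Om (capLO L O) (rhoF row) (kapF a x) N → HypS L O N)
    (hns : ∀ N, Om (capLO L O) (rhoF row) (kapF a x) N → (∃ c, N L c = 0) ∨ ∃ r, N r O = 0) :
    K x y := by
  have hNx := cnt_Om ha hx hxa
  have hNy := cnt_Om ha hy hya
  rw [hκ] at hNy
  obtain ⟨σ, hσ, hσO, hσs⟩ := exRep ha hx hxa
  obtain ⟨τ, hτ, hτO, hτs⟩ := exRep ha hy hya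
  have g1 := hσs (fun _ => True) (fun _ => True) (by simp)
  have g2 := hτs (fun _ => True) (fun _ => True) (by simp)
  simp only [if_true] at g1 g2
  change gp _ _ = _ at g1
  change gp _ _ = _ at g2
  have hal : ∀ {N M : R → C → ℤ} {σ τ : R × C → ZMod 2}, Om (capLO L O) (rhoF row) (kapF a x) N →
    Om (capLO L O) (rhoF row) (kapF a x) M → gp N σ = gp M τ →
    Cn (capLO L O) (rhoF row) (kapF a x) (alP L O) (N, σ) (M, τ) :=
    absNS hH hns (fun N r c c' h => Or.inl ⟨rfl, h⟩) (fun N r r' c h => Or.inr ⟨rfl, h⟩)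
  rcases hp with ⟨k, hk⟩ | hp
  · have hkO : |x k| = a O := by rw [hk, ha.z, abs_zero]
    have h1 : cnt row a x (row k) O = 1 := by
      have := cnt_ge1 (row := row) (a := a) (x := x) rfl hkO
      have h2 := (cnt_le ha hx (row k) O).2
      simp [capLO] at h2; omega
    refine CnK2 ha hK (hal hNx hNy ?_) (Rep_fl ha hσ (row k) (gp (cnt row a y) τ - gp (cnt row a x) σ)) hτ
    rw [gp_fl _ _ _ h1]; ring
  · exact CnK2 ha hK (hal hNx hNy (by rw [g1, g2, hp])) hσ hτ

theorem RL_Sp (ha : AH a O) {K} (hK : KR row L a O K) {x y : Fin n → ℝ}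
    (hx : Rg row L x) (hy : Rg row L y) (hxa : ∀ k, ∃ c, |x k| = a c) (hya : ∀ k, ∃ c, |y k| = a c)
    (hκ : kapF a y = kapF a x)
    (hp : ∑ k, (if row k ≠ L then sg (x k) else 0) = ∑ k, if row k ≠ L then sg (y k) else 0)
    (hH : ∀ N, Om (capLO L O) (rhoF row) (kapF a x) N → HypS L O N)
    (hsp : ∀ N, Om (capLO L O) (rhoF row) (kapF a x) N → ∀ r c, (r = L ∨ c = O) → N r c = 1) :
    K x y := by
  have hNx := cnt_Om ha hx hxa
  have hNy := cnt_Om ha hy hya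
  rw [hκ] at hNy
  obtain ⟨σ, hσ, hσO, hσs⟩ := exRep ha hx hxa
  obtain ⟨τ, hτ, hτO, hτs⟩ := exRep ha hy hya
  have g1 : ∑ e : R × C, (if e.1 ≠ L ∧ e.2 ≠ O then ctb (cnt row a x) σ e else 0) =
      ∑ k, if row k ≠ L then sg (x k) else 0 := by
    convert hσs (fun e => e.1 ≠ L ∧ e.2 ≠ O) (fun k => row k ≠ L) (by intro k c _; simp)
  have g2 : ∑ e : R × C, (if e.1 ≠ L ∧ e.2 ≠ O then ctb (cnt row a y) τ e else 0) =
      ∑ k, if row k ≠ L then sg (y k) else 0 := by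
    convert hτs (fun e => e.1 ≠ L ∧ e.2 ≠ O) (fun k => row k ≠ L) (by intro k c _; simp)
  refine CnK2 ha hK (absSp hH hsp hNx hNy ?_ ?_ ?_)
    (Rep_fl ha hσ L (gp (cnt row a y) τ - gp (cnt row a x) σ)) hτ
  · intro r hr; simp [hσO, hτO, fl, hr]
  · rw [gp_fl _ _ _ (hsp _ hNx L O (Or.inl rfl))]; ring
  · rw [g2, ← hp, ← g1]
    refine Finset.sum_congr rfl fun e _ => ?_
    split_ifs with h
    · have : e ≠ (L, O) := by rintro rfl; exact h.1 rfl
      simp [ctb, fl, this]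
    · rfl

end Real3

section Refl
variable {n : ℕ}

def rt (e : ℝ) (i j : Fin n) : V n := ee i - e • ee j

lemma inn_add (x y z : V n) : inn x (y + z) = inn x y + inn x z := by
  simp [inn, mul_add, Finset.sum_add_distrib]
lemma inn_smul (x y : V n) (c : ℝ) : inn x (c • y) = c * inn x y := by
  simp only [inn, Finset.mul_sum, Pi.smul_apply, smul_eq_mul]
  exact Finset.sum_congr rfl fun _ _ => by ring
lemma inn_ee (x : V n) (i : Fin n) : inn x (ee i) = x i := by
  simp [inn, ee, Pi.single_apply]
lemma inn_sub (x y z : V n) : inn x (y - z) = inn x y - inn x z := by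
  simp [inn, mul_sub, Finset.sum_sub_distrib]
lemma inn_neg (x y : V n) : inn x (-y) = - inn x y := by simp [inn]
lemma inn_rt (x : V n) (e : ℝ) (i j : Fin n) : inn x (rt e i j) = x i - e * x j := by
  rw [rt, inn_sub, inn_smul, inn_ee, inn_ee]
lemma ee_ap (i k : Fin n) : (ee i : V n) k = if k = i then 1 else 0 := by
  simp [ee, Pi.single_apply]
lemma rt_ap (e : ℝ) (i j k : Fin n) : rt e i j k = (if k = i then 1 else 0) - e * if k = j then 1 else 0 := by
  simp [rt, ee_ap]
lemma inn_rt_self {e : ℝ} (he : e = 1 ∨ e = -1) {i j : Fin n} (h : i ≠ j) :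
    inn (rt e i j) (rt e i j) = 2 := by
  rw [inn_rt]; simp only [rt_ap, h, h.symm, if_true, if_false]
  rcases he with rfl | rfl <;> norm_num

lemma sRefl_rt {e : ℝ} (he : e = 1 ∨ e = -1) {i j : Fin n} (h : i ≠ j) (x : V n) :
    sRefl (rt e i j) x = mv e i j x := by
  funext k
  simp only [sRefl, inn_rt_self he h, inn_rt, Pi.sub_apply, Pi.smul_apply, smul_eq_mul, rt_ap]
  by_cases h1 : k = i
  · subst h1; rw [mv_l]; simp [h]
  by_cases h2 : k = j
  · subst h2; rw [mv_r]; simp [h1]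
    rcases he with rfl | rfl <;> ring
  rw [mv_o _ _ h1 h2]; simp [h1, h2]

lemma sRefl_neg (v x : V n) : sRefl (-v) x = sRefl v x := by
  simp only [sRefl, inn_neg]
  have : inn (-v) v = - inn v v := by simp [inn]
  rw [this]; funext k; simp; ring

lemma rt_sy {e : ℝ} (he : e = 1 ∨ e = -1) (i j : Fin n) : rt e j i = (-e) • rt e i j := by
  rcases he with rfl | rfl <;> simp [rt]
  abel

lemma root_cases {v : V n} (h : v ∈ DRoots n) : ∃ i j e, i ≠ j ∧ (e = 1 ∨ e = -1) ∧
    (v = rt e i j ∨ v = -rt e i j) := by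
  obtain ⟨i, j, hij, rfl | rfl | rfl⟩ := h
  · exact ⟨i, j, -1, hij, Or.inr rfl, Or.inl (by simp [rt])⟩
  · exact ⟨i, j, 1, hij, Or.inl rfl, Or.inl (by simp [rt])⟩
  · exact ⟨i, j, -1, hij, Or.inr rfl, Or.inr (by simp [rt]; abel)⟩

lemma rt_root {e : ℝ} (he : e = 1 ∨ e = -1) {i j : Fin n} (h : i ≠ j) : rt e i j ∈ DRoots n := by
  rcases he with rfl | rfl
  · exact ⟨i, j, h, Or.inr (Or.inl (by simp [rt]))⟩
  · exact ⟨i, j, h, Or.inl (by simp [rt])⟩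

lemma rt_pos {e : ℝ} (he : e = 1 ∨ e = -1) {i j : Fin n} (h : i < j) : rt e i j ∈ PhiPos n .D := by
  refine ⟨rt_root he h.ne, i, ?_, fun k hk => ?_⟩
  · simp [rt_ap, h.ne]
  · simp [rt_ap, hk.ne, (hk.trans h).ne]

lemma pos_cases {v : V n} (h : v ∈ PhiPos n .D) : ∃ i j e, i < j ∧ (e = 1 ∨ e = -1) ∧ v = rt e i j := by
  obtain ⟨h, k, hk, hk'⟩ := h
  have key : ∀ (i j : Fin n) (e c : ℝ), i < j → (e = 1 ∨ e = -1) → (c = 1 ∨ c = -1) → v = c • rt e i j →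
      ∃ i j e, i < j ∧ (e = 1 ∨ e = -1) ∧ v = rt e i j := by
    intro i j e c hij he hc hv
    rcases hc with rfl | rfl
    · exact ⟨i, j, e, hij, he, by rw [hv, one_smul]⟩
    exfalso
    have hki : k = i := by
      by_contra hne
      have h1 : ¬ i < k := fun hlt => by
        have := hk' i hlt
        simp [hv, rt_ap, hij.ne] at this
      have hlt : k < i := lt_of_le_of_ne (not_lt.1 h1) hne
      simp [hv, rt_ap, hlt.ne, (hlt.trans hij).ne] at hk
    subst hki
    simp [hv, rt_ap, hij.ne] at hk; linarith
  obtain ⟨i, j, e, hij, he, hv⟩ := root_cases h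
  have hv : ∃ c : ℝ, (c = 1 ∨ c = -1) ∧ v = c • rt e i j := by
    rcases hv with hv | hv
    · exact ⟨1, Or.inl rfl, by simp [hv]⟩
    · exact ⟨-1, Or.inr rfl, by simp [hv]⟩
  obtain ⟨c, hc, hv⟩ := hv
  rcases lt_or_gt_of_ne hij with h1 | h1
  · exact key i j e c h1 he hc hv
  · refine key j i e (c * -e) h1 he ?_ ?_
    · rcases hc with rfl | rfl <;> rcases he with rfl | rfl <;> simp
    · rw [hv, rt_sy he j i, smul_smul]

lemma alpha_lt {k : Fin n} (h : k.1 + 1 < n) : alphaR n .D k = rt 1 k ⟨k.1 + 1, h⟩ := by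
  simp [alphaR, h, rt]
lemma alpha_last {k : Fin n} (h : k.1 + 1 = n) (h2 : 2 ≤ n) :
    alphaR n .D k = rt (-1) ⟨n - 2, by omega⟩ k := by
  simp [alphaR, h, rt]

lemma alpha_rt (h2 : 2 ≤ n) (k : Fin n) : ∃ i j e, i ≠ j ∧ (e = 1 ∨ e = -1) ∧
    alphaR n .D k = rt e i j := by
  by_cases h : k.1 + 1 < n
  · exact ⟨_, _, 1, by intro h; simp [Fin.ext_iff] at h, Or.inl rfl, alpha_lt h⟩
  · exact ⟨_, _, -1, by intro h; simp [Fin.ext_iff] at h; omega, Or.inr rfl, alpha_last (by omega) h2⟩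

lemma WIOrb_ind (h2 : 2 ≤ n) {I : Finset (Fin n)} (P : V n → Prop)
    (h : ∀ k ∈ I, ∀ i j e, i ≠ j → (e = 1 ∨ e = -1) → alphaR n .D k = rt e i j → ∀ x, P x → P (mv e i j x))
    {x y : V n} (hxy : WIOrb n .D I x y) (hx : P x) : P y := by
  induction hxy with
  | refl => exact hx
  | tail _ hs ih =>
    obtain ⟨k, hk, rfl⟩ := hs
    obtain ⟨i, j, e, hij, he, ha⟩ := alpha_rt h2 k
    rw [ha, sRefl_rt he hij]
    exact h k hk i j e hij he ha _ ih

lemma WIOrb_mono {I I' : Finset (Fin n)} (h : I ⊆ I') {x y : V n} (hxy : WIOrb n .D I x y) :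
    WIOrb n .D I' x y := by
  induction hxy with
  | refl => exact .refl
  | tail _ hs ih =>
    obtain ⟨k, hk, e⟩ := hs
    exact ih.tail ⟨k, h hk, e⟩

lemma mv_mv {e : ℝ} (he : e = 1 ∨ e = -1) (i j : Fin n) (x : V n) : mv e i j (mv e i j x) = x := by
  have he2 : ∀ t : ℝ, e * (e * t) = t := by rcases he with rfl | rfl <;> simp
  funext k
  by_cases h1 : k = i
  · subst h1; rw [mv_l, mv_r, he2]
  by_cases h2 : k = j
  · subst h2; rw [mv_r, mv_l, he2]
  rw [mv_o _ _ h1 h2, mv_o _ _ h1 h2]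

lemma WIOrb_symm (h2 : 2 ≤ n) {I : Finset (Fin n)} {x y : V n} (h : WIOrb n .D I x y) :
    WIOrb n .D I y x := by
  induction h with
  | refl => exact .refl
  | tail _ hs ih =>
    obtain ⟨k, hk, rfl⟩ := hs
    refine .head ⟨k, hk, ?_⟩ ih
    obtain ⟨i, j, e, hij, he, ha⟩ := alpha_rt h2 k
    rw [ha, sRefl_rt he hij, sRefl_rt he hij, mv_mv he]

lemma mv_conj (e : ℝ) {i j k : Fin n} (h1 : i ≠ j) (h2 : j ≠ k) (h3 : i ≠ k) (x : V n) :
    mv 1 j k (mv e i j (mv 1 j k x)) = mv e i k x := by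
  funext l
  by_cases a1 : l = i
  · subst a1; rw [mv_l, mv_o _ _ h1 h3, mv_l, mv_l, one_mul]
  by_cases a2 : l = j
  · subst a2; rw [mv_l, mv_o _ _ h3.symm h2.symm, mv_r, mv_o _ _ a1 h2]; simp
  by_cases a3 : l = k
  · subst a3; rw [mv_r, mv_r, mv_r, mv_o _ _ h1 h3, one_mul]
  rw [mv_o _ _ a2 a3, mv_o _ _ a1 a2, mv_o _ _ a2 a3, mv_o _ _ a1 a3]

end Refl

section Conc
variable {n : ℕ}

noncomputable def rowN (I : Finset (Fin n)) (i : Fin n) : ℕ :=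
  (Finset.univ.filter fun k => k ∉ I ∧ k < i).card

lemma mval_eq (I : Finset (Fin n)) : mval n I = (Finset.univ \ I).card + 1 := by
  simp [mval, Qlist]

lemma rowN_lt (I : Finset (Fin n)) (i : Fin n) : rowN I i < mval n I := by
  rw [mval_eq, Nat.lt_succ_iff]
  exact Finset.card_le_card fun k hk => by simp at hk ⊢; exact hk.1

noncomputable def rowF (I : Finset (Fin n)) (i : Fin n) : Fin (mval n I) := ⟨rowN I i, rowN_lt I i⟩

lemma m_pos (I : Finset (Fin n)) : mval n I - 1 < mval n I := by rw [mval_eq]; omega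
def lastF (I : Finset (Fin n)) : Fin (mval n I) := ⟨mval n I - 1, m_pos I⟩

lemma qval_spec (I : Finset (Fin n)) {s : ℕ} (hs : s ≤ mval n I) (i : Fin n) :
    i.1 + 1 ≤ qval n I s ↔ rowN I i < s := by
  unfold qval
  split_ifs with h1 h2
  · simp [h1]
  · have hc : s - 1 < (Finset.univ \ I).card := by rw [mval_eq] at h2; omega
    have hlen : s - 1 < (Qlist n I).length := by simpa [Qlist] using hc
    rw [List.getD_eq_getElem _ _ hlen]
    let f := (Finset.univ \ I).orderEmbOfFin rfl
    have hf : (Qlist n I)[s-1] = (f ⟨s - 1, hc⟩).1 + 1 := by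
      simp [Qlist, f, Finset.orderEmbOfFin_apply]
    rw [hf]
    have hr : ∀ k, k ∉ I → ∃ t, f t = k := fun k hk => by
      have : k ∈ Set.range f := by simp [f, hk]
      exact this
    have hm : ∀ t, f t ∉ I := fun t => by
      have := Finset.orderEmbOfFin_mem (Finset.univ \ I) rfl t
      exact (Finset.mem_sdiff.1 this).2
    constructor
    · intro h
      have hle : i ≤ f ⟨s - 1, hc⟩ := by rw [Fin.le_def]; omega
      have : (Finset.univ.filter fun k => k ∉ I ∧ k < i) ⊆
          (Finset.univ.filter fun t : Fin (Finset.univ \ I).card => t < ⟨s - 1, hc⟩).image f := by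
        intro k hk
        simp at hk
        obtain ⟨t, rfl⟩ := hr k hk.1
        simp
        exact f.lt_iff_lt.1 (hk.2.trans_le hle)
      have := (Finset.card_le_card this).trans Finset.card_image_le
      rw [Finset.filter_gt_eq_Iio, Fin.card_Iio] at this
      simp only at this
      unfold rowN; omega
    · intro h
      by_contra hlt
      have hle : f ⟨s - 1, hc⟩ < i := by rw [Fin.lt_def]; omega
      have : (Finset.univ.filter fun t : Fin (Finset.univ \ I).card => t ≤ ⟨s - 1, hc⟩).image f ⊆
          (Finset.univ.filter fun k => k ∉ I ∧ k < i) := by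
        intro k hk
        simp at hk
        obtain ⟨t, ht, rfl⟩ := hk
        simp [hm]
        exact (f.le_iff_le.2 ht).trans_lt hle
      have := Finset.card_le_card this
      rw [Finset.card_image_of_injective _ f.injective, Finset.filter_ge_eq_Iic, Fin.card_Iic] at this
      simp only at this
      unfold rowN at h; omega
  · have := rowN_lt I i
    have := i.2
    omega

lemma rowN_mono (I : Finset (Fin n)) {i j : Fin n} (h : i ≤ j) : rowN I i ≤ rowN I j :=
  Finset.card_le_card fun k hk => by simp at hk ⊢; exact ⟨hk.1, hk.2.trans_le h⟩

lemma rowN_ne {I : Finset (Fin n)} {i j k : Fin n} (hk : k ∉ I) (h1 : i ≤ k) (h2 : k < j) :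
    rowN I i < rowN I j := by
  refine Finset.card_lt_card ⟨fun l hl => by simp at hl ⊢; exact ⟨hl.1, hl.2.trans (h1.trans_lt h2)⟩, ?_⟩
  intro hs
  have := hs (show k ∈ _ by simp; exact ⟨hk, h2⟩)
  simp at this
  exact absurd this.2 (not_lt.2 h1)

lemma rowN_succ {I : Finset (Fin n)} {i j : Fin n} (hi : i ∈ I) (h : j.1 = i.1 + 1) :
    rowN I i = rowN I j := by
  unfold rowN; congr 1; ext k; simp only [Finset.mem_filter, Finset.mem_univ, true_and]
  refine and_congr_right fun hk => ?_
  have : k ≠ i := fun e => hk (e ▸ hi)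
  rw [Ne, Fin.ext_iff] at this
  rw [Fin.lt_def, Fin.lt_def]; omega

lemma rowN_last_mem {I : Finset (Fin n)} {l : Fin n} (hl : l.1 + 1 = n) (h : l ∈ I) :
    rowN I l = mval n I - 1 := by
  rw [mval_eq, Nat.add_sub_cancel]; unfold rowN; congr 1; ext k
  simp only [Finset.mem_filter, Finset.mem_univ, true_and, Finset.mem_sdiff, and_iff_left_iff_imp]
  intro hk
  have : k ≠ l := fun e => hk (e ▸ h)
  rw [Ne, Fin.ext_iff] at this
  rw [Fin.lt_def]; omega

lemma rowN_last_nmem {I : Finset (Fin n)} {l : Fin n} (hl : l.1 + 1 = n) (h : l ∉ I) (i : Fin n) :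
    rowN I i + 1 < mval n I := by
  rw [mval_eq, Nat.add_lt_add_iff_right]
  refine Finset.card_lt_card ⟨fun k hk => by simp at hk ⊢; exact hk.1, fun hs => ?_⟩
  have := hs (show l ∈ _ by simp [h])
  simp at this
  have := this.2
  rw [Fin.lt_def] at this; omega

noncomputable def TI (I : Finset (Fin n)) : Finset (Fin n) := if StandardI n .D I then I else phiIdx n I

lemma swapLast_val (j : Fin n) : (swapLast n j).1 = if j.1 = n - 1 then n - 2 else if j.1 = n - 2 then n - 1 else j.1 := by
  unfold swapLast; split_ifs <;> rfl

lemma swapLast_inv (j : Fin n) : swapLast n (swapLast n j) = j := by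
  rw [Fin.ext_iff, swapLast_val, swapLast_val]
  have := j.2
  split_ifs <;> omega

lemma mem_phiIdx (I : Finset (Fin n)) (j : Fin n) : j ∈ phiIdx n I ↔ swapLast n j ∈ I := by
  simp only [phiIdx, Finset.mem_image]
  constructor
  · rintro ⟨k, hk, rfl⟩; rwa [swapLast_inv]
  · intro h; exact ⟨_, h, swapLast_inv j⟩

lemma phi_phi (I : Finset (Fin n)) : phiIdx n (phiIdx n I) = I := by
  ext j; rw [mem_phiIdx, mem_phiIdx, swapLast_inv]

lemma mval_phi (I : Finset (Fin n)) : mval n (phiIdx n I) = mval n I := by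
  rw [mval_eq, mval_eq]
  have h : (phiIdx n I).card = I.card := Finset.card_image_of_injective _
    (Function.Involutive.injective swapLast_inv)
  rw [Finset.card_univ_diff, Finset.card_univ_diff, h]

lemma mval_TI (I : Finset (Fin n)) : mval n (TI I) = mval n I := by
  unfold TI; split_ifs; rfl; exact mval_phi I

lemma nonstd {I : Finset (Fin n)} (h : ¬ StandardI n .D I) : ∃ h2 : 2 ≤ n,
    (⟨n - 2, by omega⟩ : Fin n) ∉ I ∧ (⟨n - 1, by omega⟩ : Fin n) ∈ I := by
  unfold StandardI at h; push Not at h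
  obtain ⟨_, h2, h⟩ := h
  exact ⟨h2, h⟩

lemma sl1 (h2 : 2 ≤ n) : swapLast n ⟨n - 1, by omega⟩ = ⟨n - 2, by omega⟩ := by simp [swapLast]
lemma sl2 (h2 : 2 ≤ n) : swapLast n ⟨n - 2, by omega⟩ = ⟨n - 1, by omega⟩ := by
  rw [← sl1 h2, swapLast_inv]

lemma TI_std (h2 : 2 ≤ n) (I : Finset (Fin n)) (h : (⟨n - 1, by omega⟩ : Fin n) ∈ TI I) :
    (⟨n - 2, by omega⟩ : Fin n) ∈ TI I := by
  unfold TI at *; split_ifs at * with hs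
  · rcases hs rfl h2 with h' | h'
    · exact h'
    · exact absurd h h'
  · obtain ⟨_, h1, h3⟩ := nonstd hs
    rw [mem_phiIdx, sl1 h2] at h; exact absurd h h1

lemma qval_mem (I : Finset (Fin n)) (s : ℕ) : qval n I s ≤ n := by
  unfold qval
  split_ifs with h1 h2
  · omega
  · have hc : s - 1 < (Finset.univ \ I).card := by rw [mval_eq] at h2; omega
    have hlen : s - 1 < (Qlist n I).length := by simpa [Qlist] using hc
    rw [List.getD_eq_getElem _ _ hlen]
    simp [Qlist]
  · exact le_rfl

lemma qv_le (I : Finset (Fin n)) (s : ℕ) : qv n .D I s ≤ n := by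
  unfold qv; split_ifs; exact le_rfl; exact qval_mem I s

lemma qv_spec (I : Finset (Fin n)) {s : ℕ} (hs : s ≤ mval n I) (i : Fin n) :
    i.1 + 1 ≤ qv n .D I s ↔ rowN (TI I) i < s := by
  by_cases hst : StandardI n .D I
  · simp only [qv, hst, not_true, false_and, if_false, TI, if_true]; exact qval_spec I hs i
  simp only [qv, hst, not_false_iff, true_and, if_false, TI]
  obtain ⟨h2, h1, h3⟩ := nonstd hst
  have hl : (⟨n - 1, by omega⟩ : Fin n) ∉ phiIdx n I := by rw [mem_phiIdx, sl1 h2]; exact h1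
  have hb := rowN_last_nmem (by simp; omega) hl i
  rw [mval_phi] at hb
  split_ifs with h
  · have := i.2
    constructor <;> intro _ <;> omega
  rw [qval_spec I hs i]
  by_cases hi : i.1 = n - 1
  · have e1 : rowN I i = mval n I - 1 := rowN_last_mem (by omega) (by convert h3)
    have e2 : rowN (phiIdx n I) i + 2 = mval n I := by
      have : rowN (phiIdx n I) i + 1 = rowN I i := by
        unfold rowN
        have : (Finset.univ.filter fun k => k ∉ I ∧ k < i) =
          insert ⟨n - 2, by omega⟩ (Finset.univ.filter fun k => k ∉ phiIdx n I ∧ k < i) := by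
          ext k
          simp only [Finset.mem_filter, Finset.mem_univ, true_and, Finset.mem_insert, mem_phiIdx]
          by_cases hk : k.1 = n - 2
          · have : k = ⟨n - 2, by omega⟩ := Fin.ext hk
            rw [this]
            simp [h1]; rw [Fin.lt_def]; simp; omega
          · by_cases hk2 : k < i
            · have : swapLast n k = k := by
                rw [Fin.ext_iff, swapLast_val, if_neg (by rw [Fin.lt_def] at hk2; omega), if_neg hk]
              rw [this]; simp [Fin.ext_iff, hk]
            · simp [hk2, Fin.ext_iff, hk]
        rw [this, Finset.card_insert_of_notMem]
        simp [mem_phiIdx, sl2 h2, h3]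
      omega
    omega
  · have : rowN I i = rowN (phiIdx n I) i := by
      unfold rowN; congr 1; ext k
      simp only [Finset.mem_filter, Finset.mem_univ, true_and, mem_phiIdx, and_congr_left_iff]
      intro hk
      have : swapLast n k = k := by
        have := i.2
        rw [Fin.lt_def] at hk
        rw [Fin.ext_iff, swapLast_val, if_neg (by omega), if_neg (by omega)]
      rw [this]
    rw [this]

lemma InSeg_iff (I : Finset (Fin n)) {s : ℕ} (hs : s < mval n I) (i : Fin n) :
    InSeg n .D I (s + 1) i ↔ rowN (TI I) i = s := by
  unfold InSeg
  rw [← not_le, qv_spec I (by omega), qv_spec I hs]; simp; omega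

lemma nsval_last (I : Finset (Fin n)) : nsval n .D I (mval n I) =
    (Finset.univ.filter fun i => rowN (TI I) i = mval n I - 1).card := by
  have hm : mval n I = mval n I - 1 + 1 := by rw [mval_eq]; omega
  have h1 : qv n .D I (mval n I) = n := by
    unfold qv; rw [if_neg (by omega)]; unfold qval; rw [if_neg (by omega), if_neg (by omega)]
  rw [nsval, h1]
  have : (Finset.univ.filter fun i => rowN (TI I) i = mval n I - 1) =
      Finset.univ.filter fun i : Fin n => ¬ i.1 < qv n .D I (mval n I - 1) := by
    ext i; simp only [Finset.mem_filter, Finset.mem_univ, true_and]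
    have a1 := qv_spec I (s := mval n I - 1) (by omega) i
    have a2 := rowN_lt (TI I) i
    rw [mval_TI] at a2
    rw [← Nat.succ_le_iff, Nat.succ_eq_add_one, a1]; omega
  rw [this, Finset.filter_not, Finset.card_univ_diff, Fintype.card_fin, Fin.card_filter_val_lt,
    min_eq_right (qv_le I _)]
end Conc

section Conc2
variable {n : ℕ}

def Std2 (I : Finset (Fin n)) : Prop := ∀ h2 : 2 ≤ n, (⟨n - 1, by omega⟩ : Fin n) ∈ I →
    (⟨n - 2, by omega⟩ : Fin n) ∈ I

lemma rowF_eq {I : Finset (Fin n)} {i j : Fin n} : rowF I i = rowF I j ↔ rowN I i = rowN I j := by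
  simp [rowF, Fin.ext_iff]
lemma rowF_L {I : Finset (Fin n)} {i : Fin n} : rowF I i = lastF I ↔ rowN I i = mval n I - 1 := by
  simp [rowF, lastF, Fin.ext_iff]

lemma rowL_last {I : Finset (Fin n)} (h2 : 2 ≤ n) {i : Fin n} (h : rowF I i = lastF I) :
    (⟨n - 1, by omega⟩ : Fin n) ∈ I := by
  by_contra hc
  have := rowN_last_nmem (by simp; omega) hc i
  rw [rowF_L] at h; omega

lemma closeG (h2 : 2 ≤ n) {I : Finset (Fin n)} (hI : Std2 I) (G : ℝ → Fin n → Fin n → Prop)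
    (sy : ∀ e i j, e = 1 ∨ e = -1 → i ≠ j → G e i j → G e j i)
    (cj : ∀ e i j k, e = 1 ∨ e = -1 → i ≠ j → j ≠ k → i ≠ k → G e i j → G 1 j k → G e i k)
    (b1 : ∀ k ∈ I, ∀ h : k.1 + 1 < n, G 1 k ⟨k.1 + 1, h⟩)
    (b2 : ∀ k ∈ I, k.1 + 1 = n → G (-1) ⟨n - 2, by omega⟩ k)
    {i j : Fin n} {e : ℝ} (hij : i ≠ j) (hr : rowF I i = rowF I j)
    (he : e = 1 ∨ (e = -1 ∧ rowF I i = lastF I)) : G e i j := by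
  have A : ∀ d : ℕ, ∀ i j : Fin n, j.1 = i.1 + d + 1 → rowN I i = rowN I j → G 1 i j := by
    intro d
    induction d with
    | zero =>
      intro i j hj hr
      have hi : i ∈ I := by
        by_contra hc
        have := rowN_ne hc le_rfl (show i < j by rw [Fin.lt_def]; omega); omega
      have := b1 i hi (by omega)
      convert this
    | succ d ih =>
      intro i j hj hr
      have hlt : i.1 + d + 1 < n := by omega
      have a1 := rowN_mono I (show i ≤ ⟨i.1 + d + 1, hlt⟩ by rw [Fin.le_def]; simp; omega)
      have a2 := rowN_mono I (show ⟨i.1 + d + 1, hlt⟩ ≤ j by rw [Fin.le_def]; simp; omega)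
      have hk : (⟨i.1 + d + 1, hlt⟩ : Fin n) ∈ I := by
        by_contra hc
        have := rowN_ne hc le_rfl (show ⟨i.1 + d + 1, hlt⟩ < j by rw [Fin.lt_def]; simp; omega)
        omega
      refine cj 1 i ⟨i.1 + d + 1, hlt⟩ j (Or.inl rfl) ?_ ?_ ?_ (ih i _ rfl (by omega)) ?_
      · rw [Ne, Fin.ext_iff]; simp; omega
      · rw [Ne, Fin.ext_iff]; simp; omega
      · rw [Ne, Fin.ext_iff]; omega
      · have := b1 _ hk (by simp; omega)
        convert this
        simp; omega
  have B : ∀ i j : Fin n, i ≠ j → rowF I i = rowF I j → G 1 i j := by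
    intro i j hij hr
    rw [rowF_eq] at hr
    rcases lt_or_gt_of_ne hij with h | h
    · exact A (j.1 - i.1 - 1) i j (by rw [Fin.lt_def] at h; omega) hr
    · exact sy _ _ _ (Or.inl rfl) hij.symm (A (i.1 - j.1 - 1) j i (by rw [Fin.lt_def] at h; omega) hr.symm)
  rcases he with rfl | ⟨rfl, hL⟩
  · exact B i j hij hr
  have hq := rowL_last h2 hL
  have hp := hI h2 hq
  have hG := b2 _ hq (by simp; omega)
  have hqL : rowF I ⟨n - 1, by omega⟩ = lastF I := rowF_L.2 (rowN_last_mem (by simp; omega) hq)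
  have hpL : rowF I ⟨n - 2, by omega⟩ = lastF I := by
    rw [← hqL, rowF_eq]; exact rowN_succ hp (by simp; omega)
  set p : Fin n := ⟨n - 2, by omega⟩ with hpd
  set q : Fin n := ⟨n - 1, by omega⟩ with hqd
  have hpq : p ≠ q := by rw [Ne, Fin.ext_iff]; simp [hpd, hqd]; omega
  have C : ∀ j, j ≠ p → rowF I j = lastF I → G (-1) p j := by
    intro j hj hjL
    by_cases h : j = q
    · rw [h]; exact hG
    · exact cj _ p q j (Or.inr rfl) hpq (Ne.symm h) hj.symm hG (B q j (Ne.symm h) (hqL.trans hjL.symm))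
  by_cases h1 : i = p
  · rw [h1]; exact C j (by rw [← h1]; exact hij.symm) (hr.symm.trans hL)
  by_cases h3 : j = p
  · rw [h3]; exact sy _ _ _ (Or.inr rfl) (Ne.symm h1) (C i h1 hL)
  have := sy _ _ _ (Or.inr rfl) (Ne.symm h3) (C j h3 (hr.symm.trans hL))
  exact sy _ _ _ (Or.inr rfl) hij.symm (cj _ j p i (Or.inr rfl) h3 (Ne.symm h1) hij.symm this
    (B p i (Ne.symm h1) (hpL.trans hL.symm)))

lemma span_mem (h2 : 2 ≤ n) {I : Finset (Fin n)} (hI : Std2 I) {i j : Fin n} {e : ℝ} (hij : i ≠ j)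
    (hr : rowF I i = rowF I j) (he : e = 1 ∨ (e = -1 ∧ rowF I i = lastF I)) :
    rt e i j ∈ Submodule.span ℝ (alphaR n .D '' (I : Set (Fin n))) := by
  refine closeG h2 hI (fun e i j => rt e i j ∈ Submodule.span ℝ (alphaR n .D '' (I : Set (Fin n))))
    ?_ ?_ ?_ ?_ hij hr he
  · intro e i j he _ h
    show rt e j i ∈ _
    rw [rt_sy he]; exact Submodule.smul_mem _ _ h
  · intro e i j k he _ _ _ h h'
    have : rt e i k = rt e i j + e • rt 1 j k := by simp [rt, smul_sub]
    show rt e i k ∈ _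
    rw [this]; exact Submodule.add_mem _ h (Submodule.smul_mem _ _ h')
  · intro k hk h
    exact Submodule.subset_span ⟨k, hk, alpha_lt h⟩
  · intro k hk h
    exact Submodule.subset_span ⟨k, hk, alpha_last h h2⟩

lemma WIOrb_mv (h2 : 2 ≤ n) {I : Finset (Fin n)} (hI : Std2 I) {i j : Fin n} {e : ℝ} (hij : i ≠ j)
    (hr : rowF I i = rowF I j) (he : e = 1 ∨ (e = -1 ∧ rowF I i = lastF I)) (x : V n) :
    WIOrb n .D I x (mv e i j x) := by
  refine closeG h2 hI (fun e i j => ∀ x, WIOrb n .D I x (mv e i j x)) ?_ ?_ ?_ ?_ hij hr he x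
  · intro e i j he _ h x
    rw [mv_comm]; exact h x
  · intro e i j k he a1 a2 a3 h h' x
    rw [← mv_conj e a1 a2 a3]
    exact ((h' x).trans (h _)).trans (h' _)
  · intro k hk h x
    refine .single ⟨k, hk, ?_⟩
    rw [alpha_lt h, sRefl_rt (Or.inl rfl)]; intro hc; simp [Fin.ext_iff] at hc
  · intro k hk h x
    refine .single ⟨k, hk, ?_⟩
    rw [alpha_last h h2, sRefl_rt (Or.inr rfl)]; intro hc; simp [Fin.ext_iff] at hc; omega

lemma alpha_row (h2 : 2 ≤ n) {I : Finset (Fin n)} (hI : Std2 I) {k : Fin n} (hk : k ∈ I) :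
    ∃ i j e, i ≠ j ∧ (e = 1 ∨ e = -1) ∧ rowF I i = rowF I j ∧ (e = 1 ∨ rowF I i = lastF I) ∧
      alphaR n .D k = rt e i j := by
  by_cases h : k.1 + 1 < n
  · refine ⟨_, _, 1, by intro h; simp [Fin.ext_iff] at h, Or.inl rfl, ?_, Or.inl rfl, alpha_lt h⟩
    rw [rowF_eq]; exact rowN_succ hk rfl
  · have hk' : k = ⟨n - 1, by omega⟩ := by rw [Fin.ext_iff]; simp; omega
    have hp := hI h2 (hk' ▸ hk)
    have hqL := rowN_last_mem (show k.1 + 1 = n by omega) hk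
    have hpL := rowN_succ hp (show k.1 = _ by simp; omega)
    refine ⟨_, _, -1, by intro h; simp [Fin.ext_iff] at h; omega, Or.inr rfl, ?_, Or.inr ?_,
      alpha_last (by omega) h2⟩
    · rw [rowF_eq]; exact hpL
    · rw [rowF_L, hpL, hqL]

lemma span_inv (h2 : 2 ≤ n) {I : Finset (Fin n)} (hI : Std2 I) {v : V n}
    (hv : v ∈ Submodule.span ℝ (alphaR n .D '' (I : Set (Fin n)))) (s : Fin (mval n I)) (hs : s ≠ lastF I) :
    inn v (fun k => if rowF I k = s then 1 else 0) = 0 := by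
  have inn_comm : ∀ x y : V n, inn x y = inn y x := fun x y => by simp [inn, mul_comm]
  induction hv using Submodule.span_induction with
  | mem x hx =>
    obtain ⟨k, hk, rfl⟩ := hx
    obtain ⟨i, j, e, hij, he, hr, hL, h⟩ := alpha_row h2 hI hk
    rw [h, inn_comm, inn_rt, hr]
    split_ifs with h3
    · rcases hL with rfl | hL
      · ring
      · exact absurd (h3.symm.trans (hr.symm.trans hL)) hs
    · ring
  | zero => simp [inn]
  | add x y _ _ h h' => rw [inn_comm, inn_add, inn_comm _ x, inn_comm _ y, h, h', add_zero]
  | smul c x _ h => rw [inn_comm, inn_smul, inn_comm, h, mul_zero]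

lemma PhiI_rt (h2 : 2 ≤ n) {I : Finset (Fin n)} (hI : Std2 I) {i j : Fin n} {e : ℝ} (hij : i ≠ j)
    (he : e = 1 ∨ e = -1) :
    rt e i j ∈ PhiI n .D I ↔ rowF I i = rowF I j ∧ (e = 1 ∨ rowF I i = lastF I) := by
  have inn_comm : ∀ x y : V n, inn x y = inn y x := fun x y => by simp [inn, mul_comm]
  constructor
  · rintro ⟨_, h⟩
    have key := fun s hs => span_inv h2 hI h s hs
    simp only [fun s => inn_comm (rt e i j) (fun k => if rowF I k = s then 1 else 0), inn_rt] at key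
    by_cases hL : rowF I i = lastF I
    · refine ⟨?_, Or.inr hL⟩
      by_contra hc
      have := key (rowF I j) (fun h => hc (hL.trans h.symm))
      simp [hc] at this
      rcases he with rfl | rfl <;> norm_num at this
    · have := key _ hL
      simp only [if_true] at this
      split_ifs at this with h3
      · refine ⟨h3.symm, Or.inl (by linarith)⟩
      · linarith
  · rintro ⟨hr, h⟩
    refine ⟨rt_root he hij, span_mem h2 hI hij hr ?_⟩
    rcases he with rfl | rfl
    · exact Or.inl rfl
    · exact Or.inr ⟨rfl, h.resolve_left (by norm_num)⟩

lemma RegI_iff (h2 : 2 ≤ n) {I : Finset (Fin n)} (hI : Std2 I) (x : V n) :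
    RegI n .D I x ↔ Rg (rowF I) (lastF I) x := by
  constructor
  · intro h i j hij hr ha
    have a1 := h _ ((PhiI_rt h2 hI hij (Or.inl rfl)).2 ⟨hr, Or.inl rfl⟩)
    rw [inn_rt] at a1
    have a2 : x i = - x j := by
      rcases abs_eq_abs.1 ha with h | h
      · exact absurd (by rw [h]; ring) a1
      · exact h
    refine ⟨fun hL => ?_, fun h0 => ?_, a2⟩
    · have a3 := h _ ((PhiI_rt h2 hI hij (Or.inr rfl)).2 ⟨hr, Or.inr hL⟩)
      rw [inn_rt] at a3; exact a3 (by rw [a2]; ring)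
    · apply a1; rw [h0] at a2; have : x j = 0 := by linarith
      rw [h0, this]; ring
  · intro h β hβ h0
    obtain ⟨i, j, e, hij, he, hv⟩ := root_cases hβ.1
    have hβ' : rt e i j ∈ PhiI n .D I := by
      rcases hv with rfl | rfl
      · exact hβ
      · exact ⟨rt_root he hij, by simpa using Submodule.neg_mem _ hβ.2⟩
    have h0 : x i - e * x j = 0 := by
      rcases hv with rfl | rfl
      · rw [inn_rt] at h0; exact h0
      · rw [inn_neg, inn_rt] at h0; linarith
    obtain ⟨hr, hL⟩ := (PhiI_rt h2 hI hij he).1 hβ'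
    have ha : |x i| = |x j| := by
      rw [sub_eq_zero.1 h0]; rcases he with rfl | rfl <;> simp
    obtain ⟨b1, b2, b3⟩ := h i j hij hr ha
    rcases hL with rfl | hL
    · apply b2; linarith
    · exact b1 hL

lemma Std2_TI (I : Finset (Fin n)) : Std2 (TI I) := fun h2 => TI_std h2 I

lemma rowF_univ (k : Fin n) : rowF Finset.univ k = lastF Finset.univ := by
  rw [rowF_L, mval_eq]; simp [rowN]

lemma WOrb_mv (h2 : 2 ≤ n) {i j : Fin n} {e : ℝ} (he : e = 1 ∨ e = -1) (hij : i ≠ j) (x : V n) :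
    WOrb n .D x (mv e i j x) :=
  WIOrb_mv h2 (fun _ _ => Finset.mem_univ _) hij (by rw [rowF_univ, rowF_univ])
    (by rcases he with h | h; exact Or.inl h; exact Or.inr ⟨h, rowF_univ i⟩) x
end Conc2

section Sp
variable {R C : Type} [Fintype R] [Fintype C] {n : ℕ}
variable {row : Fin n → R} {L : R} {a : C → ℝ} {O : C}

noncomputable def Pst (row : Fin n → R) (L : R) (x : Fin n → ℝ) : ZMod 2 :=
  ∑ k, if row k ≠ L then sg (x k) else 0

lemma spFlip (ha : AH a O) {K : (Fin n → ℝ) → (Fin n → ℝ) → Prop}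
    (tr : ∀ x y z, K x y → K y z → K x z)
    (hm : ∀ x i j e, e = 1 ∨ e = -1 → i ≠ j → K x (mv e i j x)) {x : Fin n → ℝ} (hx : Rg row L x)
    {r : R} {c : C} (hr : r ≠ L) (hc : c ≠ O) (h1 : cnt row a x r c = 1) (h0 : cnt row a x r O = 1) :
    ∃ y, Rg row L y ∧ K x y ∧ Pst row L y = Pst row L x + 1 := by
  obtain ⟨k, hkr, hk⟩ := cnt_pos (by rw [h1]; norm_num : 0 < cnt row a x r c)
  obtain ⟨j, hjr, hj⟩ := cnt_pos (by rw [h0]; norm_num : 0 < cnt row a x r O)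
  rw [ha.z, abs_eq_zero] at hj
  have hk0 : x k ≠ 0 := by
    intro h; rw [h, abs_zero, ← ha.z] at hk; exact hc (ha.inj hk).symm
  have hkj : k ≠ j := by rintro rfl; exact hk0 hj
  refine ⟨mv 1 k j (mv (-1) k j x), ?_, tr _ _ _ (hm _ _ _ _ (Or.inr rfl) hkj) (hm _ _ _ _ (Or.inl rfl) hkj), ?_⟩
  · have hy : ∀ l, l ≠ k → mv 1 k j (mv (-1) k j x) l = x l := by
      intro l hl
      by_cases h : l = j
      · subst h; rw [mv_r, mv_l, hj]; ring
      · rw [mv_o _ _ hl h, mv_o _ _ hl h]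
    have hyk : mv 1 k j (mv (-1) k j x) k = - x k := by rw [mv_l, mv_r]; ring
    generalize mv 1 k j (mv (-1) k j x) = y at hy hyk
    have hab : ∀ l, |y l| = |x l| := fun l => by
      by_cases h : l = k
      · rw [h, hyk, abs_neg]
      · rw [hy l h]
    intro i l hil hrr haa
    rw [hab, hab] at haa
    have hik : i ≠ k := by
      rintro rfl; exact hil (cnt_uniq h1 hkr hk (hrr ▸ hkr) (haa ▸ hk))
    have hlk : l ≠ k := by
      rintro rfl; exact hil.symm (cnt_uniq h1 hkr hk (hrr.trans hkr) (haa.trans hk))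
    rw [hy i hik, hy l hlk]; exact hx i l hil hrr haa
  · have : ∀ l, (if row l ≠ L then sg (mv 1 k j (mv (-1) k j x) l) else 0) =
        (if row l ≠ L then sg (x l) else 0) + if l = k then 1 else 0 := by
      intro l
      by_cases h : l = k
      · subst h; rw [mv_l, mv_r]; simp [hkr, hr, sg_neg hk0]
      · by_cases h' : l = j
        · subst h'; rw [mv_r, mv_l, hj]; simp [h]
        · rw [mv_o _ _ h h', mv_o _ _ h h']; simp [h]
    simp only [Pst, this, Finset.sum_add_distrib]; simp

theorem spBoth (ha : AH a O) {K} (hK : KR row L a O K)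
    (hm : ∀ x i j e, e = 1 ∨ e = -1 → i ≠ j → K x (mv e i j x)) {x : Fin n → ℝ} (hx : Rg row L x)
    (hxa : ∀ k, ∃ c, |x k| = a c)
    (hsp : ∀ N, Om (capLO L O) (rhoF row) (kapF a x) N → ∀ r c, (r = L ∨ c = O) → N r c = 1)
    {M} (hM : Om (capLO L O) (rhoF row) (kapF a x) M) (hne : M ≠ cnt row a x) :
    ∃ y, Rg row L y ∧ K x y ∧ Pst row L y ≠ Pst row L x := by
  have hNx := cnt_Om ha hx hxa
  by_cases hs : ∃ r c, r ≠ L ∧ c ≠ O ∧ cnt row a x r c = 1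
  · obtain ⟨r, c, hr, hc, h1⟩ := hs
    obtain ⟨y, h1, h2, h3⟩ := spFlip ha hK.tr hm hx hr hc h1 (hsp _ hNx r O (Or.inr rfl))
    exact ⟨y, h1, h2, by rw [h3]; simp⟩
  have hcap : ∀ r c, 1 ≤ capLO L O r c := fun r c => by unfold capLO; split_ifs <;> norm_num
  have hR := ryser hcap (∑ e : R × C, |M e.1 e.2 - cnt row a x e.1 e.2|).toNat _ _ hNx hM
    (by exact Int.self_le_toNat _)
  rcases hR.cases_head with h | ⟨N1, hst, _⟩
  · exact absurd h.symm hne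
  obtain ⟨_, hN1, p, q, b, d, hpq, hbd, hN⟩ := hst
  have e1 : N1 p b = cnt row a x p b - 1 := by rw [hN]; simp [swt]; ring
  have hcore : p ≠ L ∧ b ≠ O := by
    by_contra hc
    have hc' : p = L ∨ b = O := by tauto
    have := hsp _ hNx p b hc'; have := hsp _ hN1 p b hc'; omega
  have h1 : N1 p b = 1 := (SwR_pa (capLO_ok L O) hNx hN1 hN).resolve_left
    fun h => hs ⟨p, b, hcore.1, hcore.2, h⟩
  obtain ⟨σ, hσ, -, -⟩ := exRep ha hx hxa
  obtain ⟨y1, hy1, hK1⟩ := stepK ha hK (S := (cnt row a x, σ))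
    (S' := (N1, fun f => σ f + (gp (cnt row a x) σ - gp N1 σ) * fl (p, b) f))
    (ρ := rhoF row) (κ := kapF a x) ⟨hNx, hN1, by
      show _ = gp N1 _
      rw [gp_fl _ _ _ h1]; ring, Or.inr (Or.inr ⟨p, q, b, d, hpq, hbd, hN, fun f hf _ => by
        have : f ≠ (p, b) := by rintro rfl; exact hf ⟨Or.inl rfl, Or.inl rfl⟩
        simp [fl, this]⟩)⟩ hσ
  by_cases hP : Pst row L y1 = Pst row L x
  · have hc : cnt row a y1 = N1 := hy1.ct.symm
    obtain ⟨y, a1, a2, a3⟩ := spFlip ha hK.tr hm hy1.rg hcore.1 hcore.2 (by rw [hc]; exact h1)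
      (by rw [hc]; exact hsp _ hN1 p O (Or.inr rfl))
    exact ⟨y, a1, hK.tr _ _ _ hK1 a2, by rw [a3, hP]; simp⟩
  · exact ⟨y1, hy1.rg, hK1, hP⟩
end Sp

section Psi
variable {n : ℕ}

noncomputable def psi (I : Finset (Fin n)) (x : V n) : V n := if StandardI n .D I then x else phiW x

lemma phiW_inv (x : V n) : phiW (phiW x) = x := by
  funext k; simp only [phiW]; split_ifs <;> simp
lemma psi_inv (I : Finset (Fin n)) (x : V n) : psi I (psi I x) = x := by
  unfold psi; split_ifs; rfl; exact phiW_inv x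
lemma phiW_inn (x y : V n) : inn (phiW x) (phiW y) = inn x y := by
  simp only [inn, phiW]; refine Finset.sum_congr rfl fun k _ => ?_
  split_ifs <;> ring
lemma phiW_add (x y : V n) : phiW (x + y) = phiW x + phiW y := by
  funext k; simp only [phiW, Pi.add_apply]; split_ifs <;> ring
lemma phiW_sub (x y : V n) : phiW (x - y) = phiW x - phiW y := by
  funext k; simp only [phiW, Pi.sub_apply]; split_ifs <;> ring
lemma phiW_smul (c : ℝ) (y : V n) : phiW (c • y) = c • phiW y := by
  funext k; simp only [phiW, Pi.smul_apply, smul_eq_mul]; split_ifs <;> ring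
lemma phiW_abs (x : V n) (k : Fin n) : |phiW x k| = |x k| := by
  simp only [phiW]; split_ifs <;> simp
lemma psi_abs (I : Finset (Fin n)) (x : V n) (k : Fin n) : |psi I x k| = |x k| := by
  unfold psi; split_ifs; rfl; exact phiW_abs x k
lemma phiW_refl (v x : V n) : sRefl (phiW v) (phiW x) = phiW (sRefl v x) := by
  simp only [sRefl, phiW_inn, phiW_sub, phiW_smul]

lemma phiW_ee (i : Fin n) : phiW (ee i) = (if i.1 = n - 1 then (-1 : ℝ) else 1) • ee i := by
  funext k; simp only [phiW, ee_ap, Pi.smul_apply, smul_eq_mul]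
  by_cases h : k = i
  · subst h; simp
  · simp [h]

lemma phiW_rt {e : ℝ} (he : e = 1 ∨ e = -1) {i j : Fin n} (hij : i ≠ j) : ∃ e' c : ℝ,
    (e' = 1 ∨ e' = -1) ∧ (c = 1 ∨ c = -1) ∧ phiW (rt e i j) = c • rt e' i j := by
  rw [rt, phiW_sub, phiW_smul, phiW_ee, phiW_ee]
  split_ifs with h1 h2 h2
  · exact absurd (Fin.ext (h1.trans h2.symm)) hij
  · exact ⟨-e, -1, by rcases he with rfl | rfl <;> simp, Or.inr rfl, by simp [rt]; abel⟩
  · exact ⟨-e, 1, by rcases he with rfl | rfl <;> simp, Or.inl rfl, by simp [rt]⟩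
  · exact ⟨e, 1, he, Or.inl rfl, by simp [rt]⟩

lemma phiW_root {v : V n} (h : v ∈ DRoots n) : phiW v ∈ DRoots n := by
  have neg : ∀ {v : V n}, v ∈ DRoots n → -v ∈ DRoots n := by
    rintro v ⟨i, j, hij, rfl | rfl | rfl⟩
    · exact ⟨i, j, hij, Or.inr (Or.inr (by abel))⟩
    · exact ⟨j, i, hij.symm, Or.inr (Or.inl (by abel))⟩
    · exact ⟨i, j, hij, Or.inl (by abel)⟩
  obtain ⟨i, j, e, hij, he, hv⟩ := root_cases h
  obtain ⟨e', c, he', hc, h⟩ := phiW_rt he hij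
  have hpn : ∀ v : V n, phiW (-v) = - phiW v := fun v => by
    have := phiW_smul (-1) v; simpa using this
  have key : phiW (rt e i j) ∈ DRoots n := by
    rw [h]; rcases hc with rfl | rfl
    · rw [one_smul]; exact rt_root he' hij
    · rw [neg_one_smul]; exact neg (rt_root he' hij)
  rcases hv with rfl | rfl
  · exact key
  · rw [hpn]; exact neg key

lemma phiW_alpha (h2 : 2 ≤ n) (k : Fin n) : phiW (alphaR n .D k) = alphaR n .D (swapLast n k) := by
  by_cases hk1 : k.1 = n - 1
  · have : swapLast n k = ⟨n - 2, by omega⟩ := by rw [Fin.ext_iff, swapLast_val, if_pos hk1]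
    rw [this, alpha_last (by omega) h2, alpha_lt (by simp; omega), rt, phiW_sub, phiW_smul, phiW_ee,
      phiW_ee, if_neg (by simp; omega), if_pos hk1]
    have : k = ⟨n - 2 + 1, by omega⟩ := by rw [Fin.ext_iff]; simp; omega
    rw [rt, ← this]; simp
  by_cases hk2 : k.1 = n - 2
  · have : swapLast n k = ⟨n - 1, by omega⟩ := by rw [Fin.ext_iff, swapLast_val, if_neg hk1, if_pos hk2]
    rw [this, alpha_last (k := ⟨n - 1, by omega⟩) (by show n - 1 + 1 = n; omega) h2,
      alpha_lt (show k.1 + 1 < n by omega), rt, phiW_sub, phiW_smul, phiW_ee,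
      phiW_ee, if_neg (by omega), if_pos (by show k.1 + 1 = n - 1; omega)]
    have e1 : k = ⟨n - 2, by omega⟩ := Fin.ext hk2
    have e2 : (⟨k.1 + 1, by omega⟩ : Fin n) = ⟨n - 1, by omega⟩ := Fin.ext (by show k.1 + 1 = n - 1; omega)
    rw [rt, ← e1, e2]; simp
  · have : swapLast n k = k := by rw [Fin.ext_iff, swapLast_val, if_neg hk1, if_neg hk2]
    have hk := k.2
    rw [this, alpha_lt (by omega), rt, phiW_sub, phiW_smul, phiW_ee, phiW_ee, if_neg (by omega),
      if_neg (by simp; omega)]; simp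

lemma phiW_PhiI (h2 : 2 ≤ n) (I : Finset (Fin n)) {v : V n} (h : v ∈ PhiI n .D I) :
    phiW v ∈ PhiI n .D (phiIdx n I) := by
  refine ⟨phiW_root h.1, ?_⟩
  have hv : v ∈ Submodule.span _ _ := h.2
  show _ ∈ Submodule.span _ _
  clear h
  induction hv using Submodule.span_induction with
  | mem x hx =>
    obtain ⟨k, hk, rfl⟩ := hx
    rw [phiW_alpha h2]
    exact Submodule.subset_span ⟨_, by simpa [mem_phiIdx, swapLast_inv] using hk, rfl⟩
  | zero => convert Submodule.zero_mem _; funext k; simp [phiW]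
  | add x y _ _ h h' => rw [phiW_add]; exact Submodule.add_mem _ h h'
  | smul c x _ h => rw [phiW_smul]; exact Submodule.smul_mem _ _ h

lemma RegI_phi (h2 : 2 ≤ n) {I : Finset (Fin n)} {x : V n} (h : RegI n .D I x) :
    RegI n .D (phiIdx n I) (phiW x) := by
  intro β hβ
  have := h _ (by have := phiW_PhiI h2 _ hβ; rwa [phi_phi] at this)
  rwa [← phiW_inn, phiW_inv] at this

lemma RegI_psi (h2 : 2 ≤ n) (I : Finset (Fin n)) (x : V n) :
    RegI n .D I (psi I x) ↔ Rg (rowF (TI I)) (lastF (TI I)) x := by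
  rw [← RegI_iff h2 (Std2_TI I)]
  unfold TI psi; split_ifs with h
  · rfl
  · constructor
    · intro h; have := RegI_phi h2 h; rwa [phiW_inv] at this
    · intro h; have := RegI_phi h2 h; rwa [phi_phi] at this

lemma WIOrb_psi (h2 : 2 ≤ n) (I : Finset (Fin n)) {x y : V n} (h : WIOrb n .D (TI I) x y) :
    WIOrb n .D I (psi I x) (psi I y) := by
  unfold TI psi at *; split_ifs at * with hs
  · exact h
  · induction h with
    | refl => exact .refl
    | tail _ hst ih =>
      obtain ⟨k, hk, rfl⟩ := hst
      refine ih.tail ⟨swapLast n k, (mem_phiIdx _ _).1 hk, ?_⟩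
      rw [← phiW_refl, phiW_alpha h2]

lemma Linked_psi (I : Finset (Fin n)) {x β : V n} (h : PlainLinked n .D (TI I) x β) :
    LinkedRoot n .D I (psi I x) (psi I β) := by
  unfold LinkedRoot TI psi at *; split_ifs at * with hs
  · exact h
  · rwa [phiW_inv, phiW_inv]

lemma sRefl_psi (I : Finset (Fin n)) (x β : V n) : sRefl (psi I β) (psi I x) = psi I (sRefl β x) := by
  unfold psi; split_ifs; rfl; exact phiW_refl _ _

lemma TI_stdI (I : Finset (Fin n)) : StandardI n .D (TI I) := by
  intro _ h2
  by_cases h : (⟨n - 1, by omega⟩ : Fin n) ∈ TI I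
  · exact Or.inl (TI_std h2 I h)
  · exact Or.inr h

lemma TI_TI (I : Finset (Fin n)) : TI (TI I) = TI I := by
  have := TI_stdI I
  show (if StandardI n .D (TI I) then TI I else _) = _
  rw [if_pos this]

lemma nsl_cnt {C : Type} [Fintype C] (I : Finset (Fin n)) (a : C → ℝ) (x : V n) (r : Fin (mval n (TI I))) (c : C) :
    (nsl n .D I x (r.1 + 1) (a c) : ℤ) = cnt (rowF (TI I)) a x r c := by
  rw [cnt_set, nsl]; congr 2; ext k; simp only [Finset.mem_filter, Finset.mem_univ, true_and]
  rw [InSeg_iff I (r.2.trans_eq (mval_TI I))]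
  simp [rowF, Fin.ext_iff]

lemma rt_inj {e e' : ℝ} (he : e = 1 ∨ e = -1) (he' : e' = 1 ∨ e' = -1) {i j p q : Fin n} (hij : i ≠ j)
    (hpq : p ≠ q) (h : rt e i j = rt e' p q) : (i = p ∧ j = q) ∨ (i = q ∧ j = p) := by
  have h1 := congrFun h i
  have h2 := congrFun h j
  simp only [rt_ap, hij, hij.symm, if_true, if_false] at h1 h2
  have e0 : e ≠ 0 := by rcases he with rfl | rfl <;> norm_num
  by_cases a1 : i = p
  · by_cases a2 : j = q
    · exact Or.inl ⟨a1, a2⟩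
    · exfalso; have : j ≠ p := fun h => hij (a1.trans h.symm)
      simp [this, a2] at h2; exact e0 h2
  · by_cases a2 : i = q
    · by_cases a3 : j = p
      · exact Or.inr ⟨a2, a3⟩
      · exfalso; have : j ≠ q := fun h => hij (a2.trans h.symm)
        simp [this, a3] at h2; exact e0 h2
    · simp [a1, a2] at h1

lemma ExcD_ExP {C : Type} [Fintype C] (I : Finset (Fin n)) {a : C → ℝ} {O : C} (ha : AH a O) {x : V n}
    (hxa : ∀ k, ∃ c, |x k| = a c) {e : ℝ} (he : e = 1 ∨ e = -1) {i j : Fin n} (hij : i ≠ j)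
    (h : ExcD n (TI I) x (rt e i j)) : ExP (rowF (TI I)) (lastF (TI I)) a O x i j := by
  obtain ⟨s, hs1, hsm, a0, ha0, n1, n2, n3, n4, p, q, k, l, hp, hq, hk, hl, xq, xl, hb⟩ := h
  obtain ⟨s, rfl⟩ : ∃ t, s = t + 1 := ⟨s - 1, by omega⟩
  have hmm : mval n (TI I) = (lastF (TI I)).1 + 1 := by simp [lastF]; have := mval_eq (TI I); omega
  have hs' : s < mval n (TI I) := by omega
  have Lm := (lastF (TI I)).2
  rw [hmm] at n2 n4 hk hl
  rw [InSeg_iff _ hs', TI_TI] at hp hq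
  rw [InSeg_iff _ Lm, TI_TI] at hk hl
  have rp : rowF (TI I) p = ⟨s, hs'⟩ := Fin.ext hp
  have rq : rowF (TI I) q = ⟨s, hs'⟩ := Fin.ext hq
  have rk : rowF (TI I) k = lastF (TI I) := Fin.ext hk
  have hsL : (⟨s, hs'⟩ : Fin _) ≠ lastF (TI I) := by rw [Ne, Fin.ext_iff]; simp; omega
  have xp : |x p| = a0 := by
    rcases hb with ⟨h | h, _⟩ | ⟨h | h, _⟩ <;> rw [h.1] <;> simp [abs_of_pos ha0]
  have xk : |x k| = a0 := by
    rcases hb with ⟨h | h, _⟩ | ⟨h | h, _⟩ <;> rw [h.2] <;> simp [abs_of_pos ha0]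
  obtain ⟨c, hc⟩ := hxa p
  have hcO : c ≠ O := by rintro rfl; rw [ha.z, xp] at hc; exact ha0.ne' hc
  have hac : a0 = a c := xp.symm.trans hc
  have hT := TI_TI I
  have cv : ∀ (r : Fin (mval n (TI I))) c, (nsl n .D (TI I) x (r.1 + 1) (a c) : ℤ) = cnt (rowF (TI I)) a x r c := by
    intro r c
    rw [cnt_set, nsl]; congr 2; ext k; simp only [Finset.mem_filter, Finset.mem_univ, true_and]
    rw [InSeg_iff (TI I) r.2, TI_TI]
    simp [rowF, Fin.ext_iff]
  have d2 : cnt (rowF (TI I)) a x (lastF (TI I)) c = 1 := by rw [← cv, ← hac, n2]; rfl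
  have d4 : cnt (rowF (TI I)) a x (lastF (TI I)) O = 1 := by rw [← cv, ha.z, n4]; rfl
  have d3 : cnt (rowF (TI I)) a x ⟨s, hs'⟩ O = 1 := by rw [← cv, ha.z, n3]; rfl
  have p0 : x p ≠ 0 := by intro h; rw [h, abs_zero] at xp; exact ha0.ne xp
  have k0 : x k ≠ 0 := by intro h; rw [h, abs_zero] at xk; exact ha0.ne xk
  have hpq : p ≠ q := by rintro rfl; exact p0 xq
  have hpk : p ≠ k := by rintro rfl; exact hsL (rp.symm.trans rk)
  have hset : ∃ z, (z = q ∨ z = k) ∧ ((i = p ∧ j = z) ∨ (i = z ∧ j = p)) := by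
    have ep : ∀ z, ee p + ee z = rt (-1) p z := fun z => by simp [rt]
    have em : ∀ z, ee p - ee z = rt 1 p z := fun z => by simp [rt]
    rw [ep, ep, em] at hb
    rcases hb with ⟨_, h | h⟩ | ⟨_, h | h⟩
    · exact ⟨q, Or.inl rfl, rt_inj he (Or.inr rfl) hij hpq h⟩
    · exact ⟨k, Or.inr rfl, rt_inj he (Or.inr rfl) hij hpk h⟩
    · exact ⟨q, Or.inl rfl, rt_inj he (Or.inr rfl) hij hpq h⟩
    · exact ⟨k, Or.inr rfl, rt_inj he (Or.inl rfl) hij hpk h⟩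
  refine ⟨d4, ?_⟩
  obtain ⟨z, rfl | rfl, ⟨rfl, rfl⟩ | ⟨rfl, rfl⟩⟩ := hset
  · exact Or.inl ⟨rp.trans rq.symm, by rw [rp]; exact hsL, c, hcO, Or.inr ⟨xq, hc⟩, d2⟩
  · exact Or.inl ⟨rq.trans rp.symm, by rw [rq]; exact hsL, c, hcO, Or.inl ⟨xq, hc⟩, d2⟩
  · exact Or.inr ⟨xp.trans xk.symm, p0, by rw [rp, rk]; exact hsL, Or.inr ⟨rk, by rw [rp]; exact d3⟩⟩
  · exact Or.inr ⟨xk.trans xp.symm, k0, by rw [rp, rk]; exact hsL.symm, Or.inl ⟨rk, by rw [rp]; exact d3⟩⟩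

lemma ConnStep_Conn {I : Finset (Fin n)} {x y : V n} (h : ConnStep n .D I x y) : Conn n .D I x y :=
  ⟨h.1, h.2.1, .single h⟩

lemma Conn_tr {I : Finset (Fin n)} {x y z : V n} (h : Conn n .D I x y) (h' : Conn n .D I y z) : Conn n .D I x z :=
  ⟨h.1, h'.2.1, h.2.2.trans h'.2.2⟩

def Kc {C : Type} [Fintype C] (I : Finset (Fin n)) (a : C → ℝ) (x y : V n) : Prop :=
  (∀ k, ∃ c, |x k| = a c) → Conn n .D I (psi I x) (psi I y) ∧ ∀ k, ∃ c, |y k| = a c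

lemma KR_Conn (h2 : 2 ≤ n) {C : Type} [Fintype C] (I : Finset (Fin n)) {a : C → ℝ} {O : C} (ha : AH a O) :
    KR (rowF (TI I)) (lastF (TI I)) a O (Kc I a) := by
  have hR := RegI_psi h2 I
  refine ⟨?_, ?_, ?_, ?_⟩
  · intro x hx hxa; exact ⟨⟨(hR x).2 hx, (hR x).2 hx, .refl⟩, hxa⟩
  · intro x y z h h' hxa
    obtain ⟨a1, a2⟩ := h hxa
    obtain ⟨a3, a4⟩ := h' a2
    exact ⟨Conn_tr a1 a3, a4⟩
  · intro x i j hx hij hr hxa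
    refine ⟨ConnStep_Conn ⟨(hR x).2 hx, (hR _).2 (Rg_swap hx hr), Or.inl ?_⟩, fun k => ?_⟩
    · exact WIOrb_psi h2 I (WIOrb_mv h2 (Std2_TI I) hij hr (Or.inl rfl) x)
    · rw [mv_abs (Or.inl rfl)]; exact hxa _
  · have main : ∀ x i j e, e = 1 ∨ e = -1 → i < j → Rg (rowF (TI I)) (lastF (TI I)) x →
      Rg (rowF (TI I)) (lastF (TI I)) (mv e i j x) →
      ¬ ExP (rowF (TI I)) (lastF (TI I)) a O x i j → Kc I a x (mv e i j x) := by
      intro x i j e he hij hx hy hE hxa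
      refine ⟨?_, fun k => by rw [mv_abs he]; exact hxa _⟩
      by_cases hxy : mv e i j x = x
      · rw [hxy]; exact ⟨(hR x).2 hx, (hR x).2 hx, .refl⟩
      refine ConnStep_Conn ⟨(hR x).2 hx, (hR _).2 hy, ?_⟩
      by_cases hP : rt e i j ∈ PhiI n .D (TI I)
      · left
        rw [PhiI_rt h2 (Std2_TI I) hij.ne he] at hP
        refine WIOrb_psi h2 I (WIOrb_mv h2 (Std2_TI I) hij.ne hP.1 ?_ x)
        rcases he with rfl | rfl
        · exact Or.inl rfl
        · exact Or.inr ⟨rfl, hP.2.resolve_left (by norm_num)⟩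
      · right
        refine ⟨psi I (rt e i j), Linked_psi I ⟨?_, rt_pos he hij, hP, ?_, ?_, ?_⟩, ?_⟩
        · exact (RegI_iff h2 (Std2_TI I) x).2 hx
        · rw [sRefl_rt he hij.ne]; exact (RegI_iff h2 (Std2_TI I) _).2 hy
        · rw [sRefl_rt he hij.ne]; exact hxy
        · intro h; exact hE (ExcD_ExP I ha hxa he hij.ne h)
        · rw [sRefl_psi, sRefl_rt he hij.ne]; exact .refl
    intro x i j e he hij hx hy hE
    rcases lt_or_gt_of_ne hij with h | h
    · exact main x i j e he h hx hy hE
    · rw [mv_comm] at hy ⊢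
      refine main x j i e he h hx hy fun hE' => hE ⟨hE'.1, ?_⟩
      rcases hE'.2 with ⟨b1, b2, c, b3, b4, b5⟩ | ⟨b1, b2, b3, b4⟩
      · exact Or.inl ⟨b1.symm, b1 ▸ b2, c, b3, b4.symm, b5⟩
      · exact Or.inr ⟨b1.symm, fun h => b2 (by rw [← abs_eq_zero, b1, abs_eq_zero]; exact h), b3.symm, b4.symm⟩

lemma KR_WOrb (h2 : 2 ≤ n) {R C : Type} [Fintype R] [Fintype C] (row : Fin n → R) (L : R) (a : C → ℝ) (O : C) :
    KR row L a O (WOrb n .D) where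
  rf _ _ := .refl
  tr _ _ _ h h' := h.trans h'
  m1 x i j _ h _ := WOrb_mv h2 (Or.inl rfl) h x
  m2 x i j e he h _ _ _ := WOrb_mv h2 he h x
end Psi

section Orb
variable {n : ℕ}

lemma kapF_mv {C : Type} [Fintype C] (a : C → ℝ) {e : ℝ} (he : e = 1 ∨ e = -1) (i j : Fin n) (x : V n) :
    kapF a (mv e i j x) = kapF a x := by
  funext c; simp only [kapF, mv_abs he]
  exact Equiv.sum_comp (Equiv.swap i j) (fun k => if |x k| = a c then (1 : ℤ) else 0)

lemma sg_mv {e : ℝ} (he : e = 1 ∨ e = -1) {i j : Fin n} (hij : i ≠ j) {x : V n} (hx : ∀ k, x k ≠ 0) :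
    ∑ k, sg (mv e i j x k) = ∑ k, sg (x k) := by
  rw [← Equiv.sum_comp (Equiv.swap i j) (fun k => sg (x k))]
  rcases he with rfl | rfl
  · simp [mv]
  · have : ∀ k, sg (mv (-1) i j x k) = sg (x (Equiv.swap i j k)) + ((if k = i then 1 else 0) + if k = j then 1 else 0) := by
      intro k
      by_cases h1 : k = i
      · subst h1; simp [mv, hij, sg_neg (hx _)]
      by_cases h3 : k = j
      · subst h3; simp [mv, h1, sg_neg (hx _)]
      simp [mv, h1, h3]
    simp only [this, Finset.sum_add_distrib]
    simp; exact z2 1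

lemma WOrb_kap (h2 : 2 ≤ n) {C : Type} [Fintype C] (a : C → ℝ) {x y : V n} (h : WOrb n .D x y) :
    kapF a y = kapF a x := by
  refine WIOrb_ind h2 (fun y => kapF a y = kapF a x) ?_ h rfl
  intro k _ i j e hij he _ y hy
  show kapF a _ = _
  rw [kapF_mv a he, hy]

lemma WOrb_ab (h2 : 2 ≤ n) {C : Type} {a : C → ℝ} {x y : V n} (h : WOrb n .D x y)
    (hx : ∀ k, ∃ c, |x k| = a c) : ∀ k, ∃ c, |y k| = a c := by
  refine WIOrb_ind h2 (fun y => ∀ k, ∃ c, |y k| = a c) ?_ h hx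
  intro k _ i j e hij he _ y hy l
  rw [mv_abs he]; exact hy _

lemma WOrb_sg (h2 : 2 ≤ n) {x y : V n} (h : WOrb n .D x y) :
    ((∃ k, x k = 0) ∧ ∃ k, y k = 0) ∨ ((∀ k, y k ≠ 0) ∧ ∑ k, sg (y k) = ∑ k, sg (x k)) := by
  refine WIOrb_ind h2 (fun y => ((∃ k, x k = 0) ∧ ∃ k, y k = 0) ∨ ((∀ k, y k ≠ 0) ∧ ∑ k, sg (y k) = ∑ k, sg (x k))) ?_ h ?_
  · rintro k _ i j e hij he _ y (⟨hx, l, hl⟩ | ⟨h0, hs⟩)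
    · refine Or.inl ⟨hx, Equiv.swap i j l, ?_⟩
      rw [← abs_eq_zero, mv_abs he, Equiv.swap_apply_self, hl, abs_zero]
    · refine Or.inr ⟨fun l hl => ?_, by rw [sg_mv he hij h0, hs]⟩
      rw [← abs_eq_zero, mv_abs he, abs_eq_zero] at hl; exact h0 _ hl
  · by_cases hx : ∃ k, x k = 0
    · exact Or.inl ⟨hx, hx⟩
    · push Not at hx; exact Or.inr ⟨hx, rfl⟩

lemma Integral_iff (x : V n) : IntegralW n .D x ↔
    ∀ i j, i ≠ j → ∀ e : ℝ, (e = 1 ∨ e = -1) → ∃ k : ℤ, x i - e * x j = k := by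
  constructor
  · intro h i j hij e he
    obtain ⟨k, hk⟩ := h _ (rt_root he hij)
    rw [inn_rt_self he hij, inn_rt] at hk
    exact ⟨k, by linarith⟩
  · intro h β hβ
    obtain ⟨i, j, e, hij, he, hv⟩ := root_cases hβ
    obtain ⟨k, hk⟩ := h i j hij e he
    rcases hv with rfl | rfl
    · exact ⟨k, by rw [inn_rt_self he hij, inn_rt, hk]; ring⟩
    · refine ⟨-k, ?_⟩
      have : inn (-rt e i j) (rt e i j) = -2 := by
        rw [← inn_rt_self he hij]; simp [inn]
      rw [inn_neg, inn_neg, this, inn_rt, hk]; push_cast; ring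

lemma WOrb_int (h2 : 2 ≤ n) {x y : V n} (h : WOrb n .D x y) (hx : IntegralW n .D x) : IntegralW n .D y := by
  refine WIOrb_ind h2 (fun y => IntegralW n .D y) ?_ h hx
  intro k _ i j e hij he _ y hy
  rw [Integral_iff] at hy ⊢
  intro p q hpq e' he'
  have hc : ∀ p, ∃ c : ℝ, (c = 1 ∨ c = -1) ∧ mv e i j y p = c * y (Equiv.swap i j p) := fun p => by
    refine ⟨if p = i ∨ p = j then e else 1, ?_, rfl⟩
    split_ifs
    · exact he
    · exact Or.inl rfl
  obtain ⟨c, hc1, hc⟩ := hc p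
  obtain ⟨d, hd1, hd⟩ := ‹∀ p, ∃ c : ℝ, (c = 1 ∨ c = -1) ∧ mv e i j y p = c * y (Equiv.swap i j p)› q
  have hne := (Equiv.swap i j).injective.ne hpq
  obtain ⟨k, hk⟩ := hy _ _ hne (c * d * e') (by
    rcases hc1 with rfl | rfl <;> rcases hd1 with rfl | rfl <;> rcases he' with rfl | rfl <;> norm_num)
  rw [hc, hd]
  rcases hc1 with rfl | rfl
  · exact ⟨k, by linarith⟩
  · exact ⟨-k, by push_cast; linarith⟩

lemma row_dec {I : Finset (Fin n)} {x : V n} (hx : ∀ k ∈ I, 0 < inn x (alphaR n .D k)) :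
    ∀ d : ℕ, ∀ i j : Fin n, j.1 = i.1 + d + 1 → rowN I i = rowN I j → x j < x i := by
  have st : ∀ i : Fin n, ∀ h : i.1 + 1 < n, i ∈ I → x ⟨i.1 + 1, h⟩ < x i := fun i h hi => by
    have := hx i hi; rw [alpha_lt h, inn_rt] at this; linarith
  intro d
  induction d with
  | zero =>
    intro i j hj hr
    have hi : i ∈ I := by
      by_contra hc
      have := rowN_ne hc le_rfl (show i < j by rw [Fin.lt_def]; omega); omega
    have := st i (by omega) hi
    convert this
  | succ d ih =>
    intro i j hj hr
    have hlt : i.1 + d + 1 < n := by omega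
    have a1 := rowN_mono I (show i ≤ ⟨i.1 + d + 1, hlt⟩ by rw [Fin.le_def]; simp; omega)
    have a2 := rowN_mono I (show ⟨i.1 + d + 1, hlt⟩ ≤ j by rw [Fin.le_def]; simp; omega)
    have hk : (⟨i.1 + d + 1, hlt⟩ : Fin n) ∈ I := by
      by_contra hc
      have := rowN_ne hc le_rfl (show ⟨i.1 + d + 1, hlt⟩ < j by rw [Fin.lt_def]; simp; omega)
      omega
    have b1 := ih i ⟨i.1 + d + 1, hlt⟩ rfl (by omega)
    have b2 := st _ (show i.1 + d + 1 + 1 < n by omega) hk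
    have : j = ⟨i.1 + d + 1 + 1, by omega⟩ := Fin.ext (by show j.1 = i.1 + d + 1 + 1; omega)
    rw [this]; exact b2.trans b1

lemma row_dec' {I : Finset (Fin n)} {x : V n} (hx : ∀ k ∈ I, 0 < inn x (alphaR n .D k)) {i j : Fin n}
    (hij : i < j) (hr : rowF I i = rowF I j) : x j < x i := by
  rw [Fin.lt_def] at hij
  exact row_dec hx (j.1 - i.1 - 1) i j (by omega) (rowF_eq.1 hr)

lemma row_last (h2 : 2 ≤ n) {I : Finset (Fin n)} (hI : Std2 I) {x : V n}
    (hx : ∀ k ∈ I, 0 < inn x (alphaR n .D k)) {i j : Fin n} (hij : i < j) (hL : rowF I i = lastF I)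
    (hL' : rowF I j = lastF I) : 0 < x i + x j := by
  have hq := rowL_last h2 hL
  have hp := hI h2 hq
  have hqL : rowF I ⟨n - 1, by omega⟩ = lastF I := rowF_L.2 (rowN_last_mem (by simp; omega) hq)
  have hpL : rowF I ⟨n - 2, by omega⟩ = lastF I := by
    rw [← hqL, rowF_eq]; exact rowN_succ hp (by simp; omega)
  have h0 := hx _ hq
  rw [alpha_last (by simp; omega) h2, inn_rt] at h0
  rw [Fin.lt_def] at hij
  have b1 : x ⟨n - 1, by omega⟩ ≤ x j := by
    by_cases h : j.1 = n - 1
    · exact le_of_eq (by congr 1; exact Fin.ext h.symm)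
    · exact (row_dec' hx (show j < _ by rw [Fin.lt_def]; simp; omega) (hL'.trans hqL.symm)).le
  have b2 : x ⟨n - 2, by omega⟩ ≤ x i := by
    by_cases h : i.1 = n - 2
    · exact le_of_eq (by congr 1; exact Fin.ext h.symm)
    · exact (row_dec' hx (show i < _ by rw [Fin.lt_def]; simp; omega) (hL.trans hpL.symm)).le
  linarith

lemma dom_Rg (h2 : 2 ≤ n) {I : Finset (Fin n)} (hI : Std2 I) {x : V n}
    (hx : ∀ k ∈ I, 0 < inn x (alphaR n .D k)) : Rg (rowF I) (lastF I) x := by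
  have key : ∀ i j : Fin n, i < j → rowF I i = rowF I j → |x i| = |x j| →
      rowF I i ≠ lastF I ∧ x i ≠ 0 ∧ x i = - x j := by
    intro i j hij hr ha
    have h1 := row_dec' hx hij hr
    have h3 : x i = - x j := (abs_eq_abs.1 ha).resolve_left h1.ne'
    refine ⟨fun hL => ?_, fun h0 => by linarith, h3⟩
    have := row_last h2 hI hx hij hL (hr ▸ hL)
    linarith
  intro i j hij hr ha
  rcases lt_or_gt_of_ne hij with h | h
  · exact key i j h hr ha
  · obtain ⟨a1, a2, a3⟩ := key j i h hr.symm ha.symm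
    refine ⟨hr ▸ a1, fun h0 => a2 (by rw [a3, h0, neg_zero]), by rw [a3, neg_neg]⟩

lemma lam_psi (h2 : 2 ≤ n) {I : Finset (Fin n)} {x : V n} (hx : ∀ k ∈ I, 0 < inn x (alphaR n .D k)) :
    ∀ k ∈ TI I, 0 < inn (psi I x) (alphaR n .D k) := by
  unfold TI psi; split_ifs
  · exact hx
  · intro k hk
    rw [mem_phiIdx] at hk
    have := hx _ hk
    rwa [← phiW_alpha h2, ← phiW_inn, phiW_inv] at this

lemma Rg_orb (h2 : 2 ≤ n) {I : Finset (Fin n)} (hI : Std2 I) {x y : V n} (h : WIOrb n .D I x y)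
    (hx : Rg (rowF I) (lastF I) x) : Rg (rowF I) (lastF I) y := by
  induction h with
  | refl => exact hx
  | tail _ hs ih =>
    obtain ⟨k, hk, rfl⟩ := hs
    obtain ⟨i, j, e, hij, he, hr, hL, h⟩ := alpha_row h2 hI hk
    rw [h, sRefl_rt he hij]
    by_cases h1 : e = 1
    · rw [h1]; exact Rg_swap ih hr
    have hL := hL.resolve_left h1
    have hrow : ∀ k, rowF I (Equiv.swap i j k) = rowF I k := by
      intro k; rw [Equiv.swap_apply_def]; split_ifs with h1 h2
      · rw [h1, hr]
      · rw [h2, hr]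
      · rfl
    intro p q hpq hrr hab
    have hab' := hab
    rw [mv_abs he, mv_abs he] at hab'
    have := ih _ _ ((Equiv.swap i j).injective.ne hpq) (by rw [hrow, hrow, hrr]) hab'
    rw [hrow] at this
    have a1 : ∀ p, rowF I p ≠ lastF I → p ≠ i ∧ p ≠ j := fun p hp =>
      ⟨fun h => hp (h ▸ hL), fun h => hp (by rw [h, ← hr, hL])⟩
    obtain ⟨p1, p2⟩ := a1 p this.1
    obtain ⟨q1, q2⟩ := a1 q (hrr ▸ this.1)
    rw [mv_o _ _ p1 p2, mv_o _ _ q1 q2]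
    rwa [Equiv.swap_apply_of_ne_of_ne p1 p2, Equiv.swap_apply_of_ne_of_ne q1 q2] at this

lemma dom_ex (h2 : 2 ≤ n) {I : Finset (Fin n)} (hI : Std2 I) {x : V n} (hx : Rg (rowF I) (lastF I) x) :
    ∃ z, WIOrb n .D I x z ∧ ∀ k ∈ I, 0 < inn z (alphaR n .D k) := by
  let w : V n := fun k => (n : ℝ) - k.1
  have inn_comm : ∀ x y : V n, inn x y = inn y x := fun x y => by simp [inn, mul_comm]
  have hfin : {z | WIOrb n .D I x z}.Finite := by
    refine (Set.Finite.pi' (t := fun _ : Fin n => Set.range (fun l => x l) ∪ Set.range (fun l => - x l))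
      (fun _ => (Set.finite_range _).union (Set.finite_range _))).subset ?_
    intro z hz
    have : ∀ k, ∃ l, |z k| = |x l| := by
      have := WOrb_ab h2 (a := fun l => |x l|) (WIOrb_mono (Finset.subset_univ I) hz) (fun k => ⟨k, rfl⟩)
      exact this
    intro k
    obtain ⟨l, hl⟩ := this k
    rcases abs_eq_abs.1 hl with h | h
    · exact Or.inl ⟨l, h.symm⟩
    · exact Or.inr ⟨l, h.symm⟩
  obtain ⟨z, hz, hmax⟩ := hfin.exists_maximalFor (fun z => inn z w) _ ⟨x, .refl⟩
  refine ⟨z, hz, fun k hk => ?_⟩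
  have hR := Rg_orb h2 hI hz hx
  have hne : inn z (alphaR n .D k) ≠ 0 := by
    refine (RegI_iff h2 hI z).2 hR _ ⟨?_, Submodule.subset_span ⟨k, hk, rfl⟩⟩
    obtain ⟨i, j, e, hij, he, ha⟩ := alpha_rt h2 k
    rw [ha]; exact rt_root he hij
  by_contra hc
  have hlt : inn z (alphaR n .D k) < 0 := lt_of_le_of_ne (not_lt.1 hc) hne
  have hw : 0 < inn w (alphaR n .D k) := by
    by_cases h : k.1 + 1 < n
    · rw [alpha_lt h, inn_rt]; simp [w]
    · have hk' := k.2
      rw [alpha_last (by omega) h2, inn_rt]; simp only [w]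
      have e1 : ((n - 2 : ℕ) : ℝ) = n - 2 := by push_cast [Nat.cast_sub h2]; ring
      have e2 : (k.1 : ℝ) = n - 1 := by
        have : k.1 = n - 1 := by omega
        rw [this, Nat.cast_sub (by omega)]; simp
      rw [e1, e2]; norm_num
  have hself : inn (alphaR n .D k) (alphaR n .D k) = 2 := by
    obtain ⟨i, j, e, hij, he, ha⟩ := alpha_rt h2 k
    rw [ha, inn_rt_self he hij]
  have hz' : WIOrb n .D I x (sRefl (alphaR n .D k) z) := hz.tail ⟨k, hk, rfl⟩
  have hgt : inn z w < inn (sRefl (alphaR n .D k) z) w := by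
    rw [sRefl, inn_comm z w, inn_comm (z - _) w, inn_sub, inn_smul, hself]
    nlinarith
  exact absurd (hmax hz' hgt.le) (not_le.2 hgt)
end Orb

section JF
variable {n : ℕ}

lemma row_ex (J : Finset (Fin n)) {c : ℕ} (hc : c + 1 < mval n J) :
    ∃ k, k ∉ J ∧ rowN J k = c ∧ qval n J (c + 1) = k.1 + 1 := by
  have key : ∀ c, c + 1 < mval n J → ∃ h : c < (Finset.univ \ J).card,
      qval n J (c + 1) = ((Finset.univ \ J).orderEmbOfFin rfl ⟨c, h⟩).1 + 1 := by
    intro c hc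
    have hc' : c < (Finset.univ \ J).card := by rw [mval_eq] at hc; omega
    refine ⟨hc', ?_⟩
    have hlen : c < (Qlist n J).length := by simpa [Qlist] using hc'
    rw [qval, if_neg (by omega), if_pos hc, Nat.add_sub_cancel, List.getD_eq_getElem _ _ hlen]
    simp [Qlist, Finset.orderEmbOfFin_apply]
  obtain ⟨h, hq⟩ := key c hc
  refine ⟨_, (Finset.mem_sdiff.1 (Finset.orderEmbOfFin_mem (Finset.univ \ J) rfl ⟨c, h⟩)).2, ?_, hq⟩
  have a1 := (qval_spec J hc.le ((Finset.univ \ J).orderEmbOfFin rfl ⟨c, h⟩)).1 hq.ge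
  by_contra hne
  have a2 := (qval_spec J (s := c) (by omega) ((Finset.univ \ J).orderEmbOfFin rfl ⟨c, h⟩)).2 (by omega)
  cases c with
  | zero => simp [qval] at a2
  | succ d =>
    obtain ⟨h', hq'⟩ := key d (by omega)
    rw [hq'] at a2
    have : (Finset.univ \ J).orderEmbOfFin rfl ⟨d, h'⟩ < (Finset.univ \ J).orderEmbOfFin rfl ⟨d + 1, h⟩ :=
      ((Finset.univ \ J).orderEmbOfFin rfl).lt_iff_lt.2 (by simp [Fin.lt_def])
    rw [Fin.lt_def] at this; omega

variable {J : Finset (Fin n)} {lbar : V n}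

lemma lb_anti (h2 : 2 ≤ n) (hdom : DominantW n .D lbar) : ∀ {i j : Fin n}, i ≤ j → lbar j ≤ lbar i := by
  have : ∀ d : ℕ, ∀ i j : Fin n, j.1 = i.1 + d → lbar j ≤ lbar i := by
    intro d
    induction d with
    | zero => intro i j h; rw [show j = i from Fin.ext (by omega)]
    | succ d ih =>
      intro i j h
      have hj := j.2
      have a1 := ih i ⟨i.1 + d, by omega⟩ rfl
      have a2 := hdom ⟨i.1 + d, by omega⟩
      rw [alpha_lt (by simp; omega), inn_rt] at a2
      rw [show j = ⟨i.1 + d + 1, by omega⟩ from Fin.ext (by simp; omega)]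
      simp only at a2; linarith
  intro i j h
  rw [Fin.le_def] at h
  exact this (j.1 - i.1) i j (by omega)

lemma lb_strict (h2 : 2 ≤ n) (hdom : DominantW n .D lbar)
    (hJ : ∀ i, i ∈ J ↔ inn lbar (alphaR n .D i) = 0) {k j : Fin n} (hk : k ∉ J) (h : k < j) : lbar j < lbar k := by
  have hj := j.2
  rw [Fin.lt_def] at h
  have a1 := lb_anti h2 hdom (i := ⟨k.1 + 1, by omega⟩) (j := j) (by rw [Fin.le_def]; simp; omega)
  have a2 := lt_of_le_of_ne (hdom k) (fun e => hk ((hJ k).2 e.symm))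
  rw [alpha_lt (by omega), inn_rt] at a2
  linarith

lemma J_std (h2 : 2 ≤ n) (hdom : DominantW n .D lbar)
    (hJ : ∀ i, i ∈ J ↔ inn lbar (alphaR n .D i) = 0) (hA : 0 < aval n .D J lbar (mval n J - 1)) :
    StandardI n .D J := by
  by_contra hs
  obtain ⟨_, h1, h3⟩ := nonstd hs
  rw [aval, if_pos (m_pos J), dif_pos (by rw [qv, if_pos ⟨hs, rfl⟩]; omega)] at hA
  have e1 : (⟨qv n .D J (mval n J - 1) - 1, by rw [qv, if_pos ⟨hs, rfl⟩]; omega⟩ : Fin n) = ⟨n - 1, by omega⟩ :=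
    Fin.ext (by simp only; rw [qv, if_pos ⟨hs, rfl⟩])
  rw [e1] at hA
  have a1 := (hJ _).1 h3
  rw [alpha_last (by simp; omega) h2, inn_rt] at a1
  have a2 := lb_strict h2 hdom hJ h1 (j := ⟨n - 1, by omega⟩) (by rw [Fin.lt_def]; simp; omega)
  linarith

lemma J_Std2 (h : StandardI n .D J) : Std2 J := fun h2 hl => by
  rcases h rfl h2 with h | h
  · exact h
  · exact absurd hl h

lemma J_row (h2 : 2 ≤ n) (hS : StandardI n .D J) (hJ : ∀ i, i ∈ J ↔ inn lbar (alphaR n .D i) = 0)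
    {i j : Fin n} {e : ℝ} (hij : i ≠ j) (hr : rowF J i = rowF J j)
    (he : e = 1 ∨ (e = -1 ∧ rowF J i = lastF J)) : lbar i = e * lbar j := by
  refine closeG h2 (J_Std2 hS) (fun e i j => lbar i = e * lbar j) ?_ ?_ ?_ ?_ hij hr he
  · rintro e i j (rfl | rfl) _ h <;> linarith
  · rintro e i j k (rfl | rfl) _ _ _ h h' <;> linarith
  · intro k hk h
    have := (hJ k).1 hk
    rw [alpha_lt h, inn_rt] at this; linarith
  · intro k hk h
    have := (hJ k).1 hk
    rw [alpha_last h h2, inn_rt] at this; linarith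

lemma J_zero (h2 : 2 ≤ n) (hS : StandardI n .D J) (hJ : ∀ i, i ∈ J ↔ inn lbar (alphaR n .D i) = 0)
    {k : Fin n} (hk : rowF J k = lastF J) : lbar k = 0 := by
  have hl := rowL_last h2 hk
  have hl' := J_Std2 hS h2 hl
  have r1 : rowF J ⟨n - 1, by omega⟩ = lastF J := rowF_L.2 (rowN_last_mem (by simp; omega) hl)
  have r2 : rowF J ⟨n - 2, by omega⟩ = lastF J := by
    rw [← r1, rowF_eq]; exact rowN_succ hl' (by simp; omega)
  have key : ∀ j, rowF J j = lastF J → k ≠ j → lbar k = 0 := fun j hj hkj => by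
    have a1 := J_row h2 hS hJ hkj (hk.trans hj.symm) (Or.inl rfl)
    have a2 := J_row h2 hS hJ hkj (hk.trans hj.symm) (Or.inr ⟨rfl, hk⟩)
    linarith
  by_cases h : k = ⟨n - 1, by omega⟩
  · exact key _ r2 (by rw [h, Ne, Fin.ext_iff]; simp; omega)
  · exact key _ r1 h

noncomputable def aJ (J : Finset (Fin n)) (lbar : V n) (c : Fin (mval n J)) : ℝ := aval n .D J lbar (c.1 + 1)

lemma aJ_row (hS : StandardI n .D J) {c : Fin (mval n J)} (hc : c ≠ lastF J) :
    ∃ k, k ∉ J ∧ rowF J k = c ∧ aJ J lbar c = lbar k := by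
  have hc' : c.1 + 1 < mval n J := by
    have := c.2
    rw [Ne, Fin.ext_iff] at hc; simp [lastF] at hc; omega
  obtain ⟨k, hk, hr, hq⟩ := row_ex J hc'
  refine ⟨k, hk, Fin.ext hr, ?_⟩
  have e : qv n .D J (c.1 + 1) - 1 = k.1 := by rw [qv, if_neg (by simp [hS]), hq]; rfl
  rw [aJ, aval, if_pos hc', dif_pos (by rw [e]; exact k.2)]
  congr 1; exact Fin.ext e

lemma aJ_O : aJ J lbar (lastF J) = 0 := by
  rw [aJ, aval, if_neg]; simp [lastF]; omega

lemma J_m (h2 : 2 ≤ n) (hJ : ∀ i, i ∈ J ↔ inn lbar (alphaR n .D i) = 0)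
    (hS : StandardI n .D J) (hA : 0 < aval n .D J lbar (mval n J - 1)) : 1 < mval n J := by
  by_contra h
  have hm : mval n J = 1 := by rw [mval_eq] at h ⊢; omega
  have h0 : ∀ k, lbar k = 0 := fun k => J_zero h2 hS hJ (Fin.ext (by
    have := (rowF J k).2; simp only [lastF]; omega))
  rw [aval] at hA; split_ifs at hA <;> simp [h0] at hA

lemma J_AH (h2 : 2 ≤ n) (hdom : DominantW n .D lbar) (hJ : ∀ i, i ∈ J ↔ inn lbar (alphaR n .D i) = 0)
    (hS : StandardI n .D J) (hA : 0 < aval n .D J lbar (mval n J - 1)) :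
    AH (aJ J lbar) (lastF J) ∧ ∀ k, |lbar k| = aJ J lbar (rowF J k) := by
  have hm := J_m h2 hJ hS hA
  have hlt : ∀ c c', c < c' → c' ≠ lastF J → aJ J lbar c' < aJ J lbar c := by
    intro c c' h h'
    have hcL : c ≠ lastF J := by
      rintro rfl; have := c'.2; rw [Fin.lt_def] at h; simp [lastF] at h; omega
    obtain ⟨k, hk, hr, e⟩ := aJ_row (lbar := lbar) hS hcL
    obtain ⟨k', hk', hr', e'⟩ := aJ_row (lbar := lbar) hS h'
    rw [e, e']
    refine lb_strict h2 hdom hJ hk ?_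
    by_contra hle
    have := rowN_mono J (not_lt.1 hle)
    rw [← hr, ← hr', Fin.lt_def] at h
    simp [rowF] at h; omega
  have hpos : ∀ c, c ≠ lastF J → 0 < aJ J lbar c := by
    intro c hc
    have e : aJ J lbar ⟨mval n J - 2, by omega⟩ = aval n .D J lbar (mval n J - 1) := by
      rw [aJ]; congr 1; simp; omega
    by_cases h : c = ⟨mval n J - 2, by omega⟩
    · rw [h, e]; exact hA
    · refine lt_trans (e ▸ hA) (hlt _ _ ?_ ?_)
      · have := c.2
        rw [Ne, Fin.ext_iff] at hc; rw [Fin.ext_iff] at h; simp [lastF] at h hc; rw [Fin.lt_def]; simp; omega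
      · rw [Ne, Fin.ext_iff]; simp [lastF]; omega
  refine ⟨⟨?_, aJ_O, ?_⟩, ?_⟩
  · have key : ∀ c c', c < c' → aJ J lbar c ≠ aJ J lbar c' := by
      intro c c' h
      by_cases h' : c' = lastF J
      · rw [h', aJ_O]; exact (hpos c (by rintro rfl; exact absurd h (by rw [h']; exact lt_irrefl _))).ne'
      · exact (hlt c c' h h').ne'
    intro c c' h
    rcases lt_trichotomy c c' with h' | h' | h'
    · exact absurd h (key _ _ h')
    · exact h'
    · exact absurd h.symm (key _ _ h')
  · intro c
    by_cases h' : c = lastF J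
    · rw [h', aJ_O]
    · exact (hpos c h').le
  · intro k
    by_cases h' : rowF J k = lastF J
    · rw [h', aJ_O, J_zero h2 hS hJ h', abs_zero]
    · obtain ⟨k', hk', hr', e'⟩ := aJ_row (lbar := lbar) hS h'
      have : lbar k = lbar k' := by
        by_cases hkk : k = k'
        · rw [hkk]
        · rw [J_row h2 hS hJ hkk hr'.symm (Or.inl rfl), one_mul]
      rw [this, ← e', abs_of_pos (hpos _ h')]

lemma kap_O (h2 : 2 ≤ n) (hdom : DominantW n .D lbar) (hJ : ∀ i, i ∈ J ↔ inn lbar (alphaR n .D i) = 0)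
    (hS : StandardI n .D J) (hA : 0 < aval n .D J lbar (mval n J - 1)) :
    kapF (aJ J lbar) lbar (lastF J) = nsval n .D J (mval n J) := by
  obtain ⟨ha, hk⟩ := J_AH h2 hdom hJ hS hA
  have hT : TI J = J := by rw [TI, if_pos hS]
  rw [nsval_last, hT, kapF]
  simp only [hk, ha.inj.eq_iff, rowF_L]
  simp

lemma rho_L (I : Finset (Fin n)) : rhoF (rowF (TI I)) (lastF (TI I)) = nsval n .D I (mval n I) := by
  rw [nsval_last, rhoF]
  simp only [rowF_L, mval_TI]
  simp
end JF

section SF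
variable {n : ℕ}

lemma sat_tr {R C : Type} [Fintype R] [Fintype C] {cap : R → C → ℤ} {ρ : R → ℤ} {κ : C → ℤ} {N M : R → C → ℤ}
    (hN : Om cap ρ κ N) (hM : Om cap ρ κ M) (S : R → Prop) (T : C → Prop)
    (h1 : ∀ r c, S r → T c → N r c = cap r c) (h2 : ∀ r c, ¬ S r → ¬ T c → N r c = 0) :
    (∀ r c, S r → T c → M r c = cap r c) ∧ (∀ r c, ¬ S r → ¬ T c → M r c = 0) := by
  let g : R → C → ℤ := fun r c => (if S r then 1 else 0) - (if T c then 0 else 1)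
  have hs : ∀ {M}, Om cap ρ κ M → ∑ r, ∑ c, g r c * M r c =
      ∑ r, (if S r then 1 else 0) * ρ r - ∑ c, (if T c then 0 else 1) * κ c := by
    intro M hM
    simp only [g, sub_mul, Finset.sum_sub_distrib]
    congr 1
    · refine Finset.sum_congr rfl fun r _ => ?_
      rw [← Finset.mul_sum, hM.2.1]
    · rw [Finset.sum_comm]
      refine Finset.sum_congr rfl fun c _ => ?_
      rw [← Finset.mul_sum, hM.2.2]
  have hnn : ∀ r c, 0 ≤ g r c * (N r c - M r c) := by
    intro r c
    have b := hM.1 r c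
    simp only [g]
    by_cases hS : S r <;> by_cases hT : T c <;> simp only [hS, hT, if_true, if_false]
    · rw [h1 r c hS hT]; linarith
    · simp
    · simp
    · rw [h2 r c hS hT]; linarith
  have h0 : ∑ r, ∑ c, g r c * (N r c - M r c) = 0 := by
    simp only [mul_sub, Finset.sum_sub_distrib]
    rw [hs hN, hs hM, sub_self]
  have hz : ∀ r c, g r c * (N r c - M r c) = 0 := by
    intro r c
    have a1 := (Finset.sum_eq_zero_iff_of_nonneg fun r _ => Finset.sum_nonneg fun c _ => hnn r c).1 h0 r (Finset.mem_univ _)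
    exact (Finset.sum_eq_zero_iff_of_nonneg fun c _ => hnn r c).1 a1 c (Finset.mem_univ _)
  constructor
  · intro r c hS hT
    have := hz r c
    simp [g, hS, hT] at this
    rw [← h1 r c hS hT]; linarith
  · intro r c hS hT
    have := hz r c
    simp [g, hS, hT] at this
    have a := h2 r c hS hT
    linarith

structure Cx (I J : Finset (Fin n)) (lbar : V n) : Prop where
  h2 : 2 ≤ n
  ha : AH (aJ J lbar) (lastF J)
  ab : ∀ k, ∃ c, |lbar k| = aJ J lbar c
  mJ : 1 < mval n J
  mI : 1 < mval n I

def Om0 (I J : Finset (Fin n)) (lbar : V n) (N : Fin (mval n (TI I)) → Fin (mval n J) → ℤ) : Prop :=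
  Om (capLO (lastF (TI I)) (lastF J)) (rhoF (rowF (TI I))) (kapF (aJ J lbar) lbar) N

variable {I J : Finset (Fin n)} {lbar : V n}

lemma kap_psi (x : V n) : kapF (aJ J lbar) (psi I x) = kapF (aJ J lbar) x := by
  funext c; simp only [kapF, psi_abs]
lemma cnt_psi (x : V n) : cnt (rowF (TI I)) (aJ J lbar) (psi I x) = cnt (rowF (TI I)) (aJ J lbar) x := by
  funext r c; exact Finset.sum_congr rfl fun k _ => by rw [psi_abs]

lemma orb_Om (X : Cx I J lbar) {x : V n} (hx : WOrb n .D lbar x) (hr : RegI n .D I x) :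
    Rg (rowF (TI I)) (lastF (TI I)) (psi I x) ∧ (∀ k, ∃ c, |psi I x k| = aJ J lbar c) ∧
    kapF (aJ J lbar) (psi I x) = kapF (aJ J lbar) lbar ∧
    Om0 I J lbar (cnt (rowF (TI I)) (aJ J lbar) x) := by
  have a1 : Rg (rowF (TI I)) (lastF (TI I)) (psi I x) := by
    rw [← RegI_psi X.h2, psi_inv]; exact hr
  have a2 : ∀ k, ∃ c, |psi I x k| = aJ J lbar c := fun k => by
    rw [psi_abs]; exact WOrb_ab X.h2 hx X.ab k
  have a3 : kapF (aJ J lbar) (psi I x) = kapF (aJ J lbar) lbar := by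
    rw [kap_psi, WOrb_kap X.h2 _ hx]
  refine ⟨a1, a2, a3, ?_⟩
  have := cnt_Om X.ha a1 a2
  rwa [a3, cnt_psi] at this

lemma IWJ_reg (h2 : 2 ≤ n) {x : V n} (hx : x ∈ IWJset n .D I lbar) : RegI n .D I x := by
  have := (RegI_psi h2 I _).2 (dom_Rg h2 (Std2_TI I) (lam_psi h2 hx.2.2))
  rwa [psi_inv] at this

noncomputable def shF {k : ℕ} (S : Fin k → Prop) : Finset ℕ := (Finset.univ.filter S).image fun r => r.1 + 1

lemma shF_mem {k : ℕ} (S : Fin k → Prop) (r : Fin k) : r.1 + 1 ∈ shF S ↔ S r := by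
  simp only [shF, Finset.mem_image, Finset.mem_filter, Finset.mem_univ, true_and]
  constructor
  · rintro ⟨q, hq, h⟩; rwa [← Fin.ext (Nat.succ_injective h)]
  · intro h; exact ⟨r, h, rfl⟩

lemma shF_sub {k : ℕ} (S : Fin k → Prop) : shF S ⊆ Finset.Icc 1 k := by
  intro s hs
  simp only [shF, Finset.mem_image, Finset.mem_filter, Finset.mem_univ, true_and] at hs
  obtain ⟨r, _, rfl⟩ := hs
  have := r.2
  rw [Finset.mem_Icc]; omega

lemma shF_ex {k : ℕ} {s : ℕ} (hs : s ∈ Finset.Icc 1 k) : ∃ r : Fin k, s = r.1 + 1 := by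
  rw [Finset.mem_Icc] at hs
  exact ⟨⟨s - 1, by omega⟩, by simp; omega⟩

lemma DS_mem (X : Cx I J lbar) (S : Fin (mval n (TI I)) → Prop) (T : Fin (mval n J) → Prop)
    (hS : ∃ r, S r) (hT : ∃ c, T c) (hLO : S (lastF (TI I)) ↔ T (lastF J))
    (hsat : ∀ M, Om0 I J lbar M → (∀ r c, S r → T c → M r c = capLO (lastF (TI I)) (lastF J) r c) ∧
      (∀ r c, ¬ S r → ¬ T c → M r c = 0)) : (shF S, shF T) ∈ DSet n .D I J lbar := by
  intro lam hlam
  have hreg := IWJ_reg X.h2 hlam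
  have ho := (orb_Om X hlam.1 hreg).2.2.2
  obtain ⟨s1, s2⟩ := hsat _ ho
  refine ⟨?_, ?_, ?_, shF_sub T, X.mI, X.mJ, ?_, ?_, ?_⟩
  · obtain ⟨r, hr⟩ := hS; exact ⟨_, (shF_mem S r).2 hr⟩
  · obtain ⟨r, hr⟩ := hT; exact ⟨_, (shF_mem T r).2 hr⟩
  · exact (shF_sub S).trans_eq (by rw [mval_TI])
  · intro s hs t ht mu hmu hmr
    obtain ⟨r, rfl⟩ := shF_ex (shF_sub S hs)
    obtain ⟨c, rfl⟩ := shF_ex (shF_sub T ht)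
    have e1 := nsl_cnt I (aJ J lbar) lam r c
    have e2 := nsl_cnt I (aJ J lbar) mu r c
    rw [s1 r c ((shF_mem S r).1 hs) ((shF_mem T c).1 ht)] at e1
    have hb := ((orb_Om X (hlam.1.trans hmu) hmr).2.2.2.1 r c).2
    rw [← e2, ← e1] at hb
    exact_mod_cast hb
  · intro s hs hs' t ht ht'
    rw [← mval_TI] at hs
    obtain ⟨r, rfl⟩ := shF_ex hs
    obtain ⟨c, rfl⟩ := shF_ex ht
    have e1 := nsl_cnt I (aJ J lbar) lam r c
    rw [s2 r c (fun h => hs' ((shF_mem S r).2 h)) (fun h => ht' ((shF_mem T c).2 h))] at e1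
    exact_mod_cast e1
  · have a1 := shF_mem S (lastF (TI I))
    have a2 := shF_mem T (lastF J)
    have e1 : (lastF (TI I)).1 + 1 = mval n I := by
      have := X.mI; simp only [lastF, mval_TI]; omega
    have e2 : (lastF J).1 + 1 = mval n J := by
      have := X.mJ; simp only [lastF]; omega
    rw [e1] at a1; rw [e2] at a2
    exact a1.trans (hLO.trans a2.symm)

lemma shF_all {k : ℕ} {S : Fin k → Prop} (h : shF S = Finset.Icc 1 k) (r : Fin k) : S r := by
  rw [← shF_mem S, h, Finset.mem_Icc]; have := r.2; omega

lemma shF_one {k k' : ℕ} {S : Fin k → Prop} (h : shF S = {k'}) (r : Fin k) : S r ↔ r.1 + 1 = k' := by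
  rw [← shF_mem S, h, Finset.mem_singleton]

lemma hyp_S (X : Cx I J lbar) (hw : ∀ p ∈ DSet n .D I J lbar, IsWeakPair n I J p) (N)
    (hN : Om0 I J lbar N) : HypS (lastF (TI I)) (lastF J) N := by
  intro S T hS hT hLO h1 h2
  have hd := DS_mem X S T hS hT hLO (fun M hM => sat_tr hN hM S T h1 h2)
  have mI := X.mI
  have mJ := X.mJ
  have e1 : ∀ r : Fin (mval n (TI I)), r.1 + 1 = mval n I ↔ r = lastF (TI I) := fun r => by
    rw [Fin.ext_iff]; simp only [lastF, mval_TI]; omega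
  have e2 : ∀ r : Fin (mval n J), r.1 + 1 = mval n J ↔ r = lastF J := fun r => by
    rw [Fin.ext_iff]; simp only [lastF]; omega
  rcases hw _ hd with h | h | h | h <;> obtain ⟨h, h'⟩ := Prod.ext_iff.1 h <;> simp only at h h'
  · exfalso
    have a1 := hLO.2 ((shF_one h' _).2 ((e2 _).2 rfl))
    rw [← shF_mem S, h, (e1 _).2 rfl, Finset.mem_Icc] at a1; omega
  · replace h := h.trans (show _ = Finset.Icc 1 (mval n (TI I)) by rw [mval_TI])
    exact Or.inl ⟨shF_all h, fun c => (shF_one h' c).trans (e2 c)⟩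
  · exfalso
    have a1 := hLO.1 ((shF_one h _).2 ((e1 _).2 rfl))
    rw [← shF_mem T, h', (e2 _).2 rfl, Finset.mem_Icc] at a1; omega
  · exact Or.inr ⟨fun c => (shF_one h c).trans (e1 c), shF_all h'⟩

def Spec (I J : Finset (Fin n)) : Prop :=
  nsval n .D I (mval n I) = mval n J ∧ nsval n .D J (mval n J) = mval n I

lemma sum_one {C : Type} [Fintype C] {f : C → ℤ} (h : ∀ c, f c ≤ 1) (hs : ∑ c, f c = Fintype.card C) (c : C) : f c = 1 := by
  have h0 : ∑ c, (1 - f c) = 0 := by rw [Finset.sum_sub_distrib, hs]; simp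
  have := (Finset.sum_eq_zero_iff_of_nonneg fun c _ => sub_nonneg.2 (h c)).1 h0 c (Finset.mem_univ _)
  linarith

lemma spec_hsp (hk : kapF (aJ J lbar) lbar (lastF J) = nsval n .D J (mval n J)) (hs : Spec I J) (N) (hN : Om0 I J lbar N) :
    ∀ r c, (r = lastF (TI I) ∨ c = lastF J) → N r c = 1 := by
  rintro r c (rfl | rfl)
  · refine sum_one (f := fun c => N (lastF (TI I)) c) (fun c => ?_) ?_ c
    · have := (hN.1 (lastF (TI I)) c).2; simpa [capLO] using this
    · rw [hN.2.1, rho_L, hs.1]; simp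
  · refine sum_one (f := fun r => N r (lastF J)) (fun r => ?_) ?_ r
    · have := (hN.1 r (lastF J)).2; simpa [capLO] using this
    · rw [hN.2.2, hk, hs.2]; simp [mval_TI]

lemma nspec_hns (hk : kapF (aJ J lbar) lbar (lastF J) = nsval n .D J (mval n J)) (hs : ¬ Spec I J) (N) (hN : Om0 I J lbar N) :
    (∃ c, N (lastF (TI I)) c = 0) ∨ ∃ r, N r (lastF J) = 0 := by
  by_contra h
  push Not at h
  have a1 : ∀ c, N (lastF (TI I)) c = 1 := fun c => by
    have b := hN.1 (lastF (TI I)) c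
    have := h.1 c
    simp [capLO] at b; omega
  have a2 : ∀ r, N r (lastF J) = 1 := fun r => by
    have b := hN.1 r (lastF J)
    have := h.2 r
    simp [capLO] at b; omega
  refine hs ⟨?_, ?_⟩
  · have := hN.2.1 (lastF (TI I))
    rw [rho_L] at this; simp [a1] at this; omega
  · have := hN.2.2 (lastF J)
    rw [hk] at this; simp [a2, mval_TI] at this; omega

lemma spec_sep (X : Cx I J lbar) (hk : kapF (aJ J lbar) lbar (lastF J) = nsval n .D J (mval n J)) (hs : Spec I J) :
    SepSys n .D I J lbar := by
  refine ⟨_, DS_mem X (fun _ => True) (fun c => c = lastF J) ⟨lastF _, trivial⟩ ⟨_, rfl⟩ (by simp) ?_⟩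
  intro M hM
  refine ⟨?_, fun r c h => absurd trivial h⟩
  rintro r c _ rfl
  rw [spec_hsp hk hs M hM r _ (Or.inr rfl)]; simp [capLO]

lemma two_N (X : Cx I J lbar) (hw : ∀ p ∈ DSet n .D I J lbar, IsWeakPair n I J p) :
    ∃ lam ∈ IWJset n .D I lbar, ∃ M, Om0 I J lbar M ∧ M ≠ cnt (rowF (TI I)) (aJ J lbar) lam := by
  have mI := X.mI
  have mJ := X.mJ
  by_contra hc
  push Not at hc
  have hmem : (Finset.Icc 1 (mval n I), Finset.Icc 1 (mval n J)) ∈ DSet n .D I J lbar := by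
    intro lam hlam
    refine ⟨⟨1, by simp; omega⟩, ⟨1, by simp; omega⟩, subset_rfl, subset_rfl, mI, mJ, ?_, ?_, ?_⟩
    · intro s hs t ht mu hmu hmr
      simp only at hs ht
      rw [← mval_TI] at hs
      obtain ⟨r, rfl⟩ := shF_ex hs
      obtain ⟨c, rfl⟩ := shF_ex ht
      have e1 := nsl_cnt I (aJ J lbar) lam r c
      have e2 := nsl_cnt I (aJ J lbar) mu r c
      rw [hc lam hlam _ (orb_Om X (hlam.1.trans hmu) hmr).2.2.2, ← e1] at e2
      exact le_of_eq (by exact_mod_cast e2)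
    · intro s hs hs'; exact absurd hs hs'
    · show _ ∈ Finset.Icc 1 _ ↔ _ ∈ Finset.Icc 1 _
      simp only [Finset.mem_Icc]; omega
  have h1 : ∀ a b : ℕ, 1 < a → Finset.Icc 1 a ≠ {b} := fun a b h e => by
    have a1 : 1 ∈ Finset.Icc 1 a := by simp; omega
    have a2 : a ∈ Finset.Icc 1 a := by simp; omega
    rw [e, Finset.mem_singleton] at a1 a2; omega
  rcases hw _ hmem with h | h | h | h <;> obtain ⟨h, h'⟩ := Prod.ext_iff.1 h <;> simp only at h h'
  · exact h1 _ _ mJ h'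
  · exact h1 _ _ mJ h'
  · exact h1 _ _ mI h
  · exact h1 _ _ mI h
end SF

section IN
variable {n : ℕ}

lemma Pst_mv {R : Type} [Fintype R] {row : Fin n → R} {L : R} (e : ℝ) {i j : Fin n} (hij : i ≠ j) (x : V n) :
    Pst row L (mv e i j x) = Pst row L x + ((if row i ≠ L then sg (e * x j) + sg (x i) else 0) +
      (if row j ≠ L then sg (e * x i) + sg (x j) else 0)) := by
  have : ∀ y : V n, Pst row L y = (if row i ≠ L then sg (y i) else 0) + ((if row j ≠ L then sg (y j) else 0) +
      ∑ k ∈ (Finset.univ.erase i).erase j, if row k ≠ L then sg (y k) else 0) := fun y => by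
    rw [Finset.add_sum_erase _ (fun k => if row k ≠ L then sg (y k) else 0) (by simp [hij.symm]),
      Finset.add_sum_erase _ (fun k => if row k ≠ L then sg (y k) else 0) (by simp)]
    rfl
  rw [this, this x, mv_l, mv_r]
  have hs : ∑ k ∈ (Finset.univ.erase i).erase j, (if row k ≠ L then sg (mv e i j x k) else 0) =
      ∑ k ∈ (Finset.univ.erase i).erase j, (if row k ≠ L then sg (x k) else 0) := by
    refine Finset.sum_congr rfl fun k hk => ?_
    simp at hk
    rw [mv_o e x hk.2 hk.1]
  rw [hs]
  have z1 := z2 (sg (x i))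
  have z3 := z2 (sg (x j))
  split_ifs
  · linear_combination - z1 - z3
  · linear_combination - z1
  · linear_combination - z3
  · ring

section Ex
variable {C : Type} [Fintype C] (I : Finset (Fin n)) {a : C → ℝ} {O : C}

lemma cnt_one {R : Type} [Fintype R] {row : Fin n → R} {x : V n} {p : Fin n} {c : C} (hc : |x p| = a c)
    (h : ∀ q, q ≠ p → row q = row p → |x q| ≠ |x p|) : cnt row a x (row p) c = 1 := by
  rw [cnt_set]
  have : (Finset.univ.filter fun k => row k = row p ∧ |x k| = a c) = {p} := by
    ext k; simp only [Finset.mem_filter, Finset.mem_univ, true_and, Finset.mem_singleton]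
    constructor
    · rintro ⟨h1, h2⟩; by_contra hk; exact h k hk h1 (h2.trans hc.symm)
    · rintro rfl; exact ⟨rfl, hc⟩
  rw [this]; rfl

lemma mkExc (ha : AH a O) {x : V n}
    (hsp : ∀ r c, (r = lastF (TI I) ∨ c = O) → cnt (rowF (TI I)) a x r c = 1)
    (hxa : ∀ k, ∃ c, |x k| = a c) {p : Fin n} (hp : rowF (TI I) p ≠ lastF (TI I)) (hp0 : x p ≠ 0)
    (hu : ∀ q, q ≠ p → rowF (TI I) q = rowF (TI I) p → |x q| ≠ |x p|) {β : V n}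
    (hβ : (∃ q, rowF (TI I) q = rowF (TI I) p ∧ x q = 0 ∧ β = ee p + ee q) ∨
      ∃ k, rowF (TI I) k = lastF (TI I) ∧ ((x k = x p ∧ β = ee p + ee k) ∨ (x k = - x p ∧ β = ee p - ee k))) :
    ExcD n (TI I) x β := by
  obtain ⟨c, hc⟩ := hxa p
  have hmm : mval n (TI I) = (lastF (TI I)).1 + 1 := by simp [lastF]; have := mval_eq (TI I); omega
  have Lm := (lastF (TI I)).2
  have rm := (rowF (TI I) p).2
  have cv : ∀ (r : Fin (mval n (TI I))) c, (nsl n .D (TI I) x (r.1 + 1) (a c) : ℤ) = cnt (rowF (TI I)) a x r c := by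
    intro r c
    rw [cnt_set, nsl]; congr 2; ext k; simp only [Finset.mem_filter, Finset.mem_univ, true_and]
    rw [InSeg_iff (TI I) r.2, TI_TI]
    simp [rowF, Fin.ext_iff]
  have sgm : ∀ (r : Fin (mval n (TI I))) k, InSeg n .D (TI I) (r.1 + 1) k ↔ rowF (TI I) k = r := fun r k => by
    rw [InSeg_iff (TI I) r.2, TI_TI]; simp [rowF, Fin.ext_iff]
  have ex : ∀ r c, cnt (rowF (TI I)) a x r c = 1 → ∃ k, rowF (TI I) k = r ∧ |x k| = a c := fun r c h =>
    cnt_pos (by rw [h]; norm_num)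
  have ex0 : ∀ r, ∃ k, rowF (TI I) k = r ∧ x k = 0 := fun r => by
    obtain ⟨k, h1, h2⟩ := ex r O (hsp _ _ (Or.inr rfl))
    rw [ha.z, abs_eq_zero] at h2; exact ⟨k, h1, h2⟩
  obtain ⟨l, l1, l2⟩ := ex0 (lastF (TI I))
  refine ⟨(rowF (TI I) p).1 + 1, by omega, ?_, |x p|, abs_pos.2 hp0, ?_, ?_, ?_, ?_, ?_⟩
  · have : (rowF (TI I) p).1 ≠ (lastF (TI I)).1 := fun h => hp (Fin.ext h)
    omega
  · have := cv (rowF (TI I) p) c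
    rw [cnt_one hc hu, ← hc] at this; exact_mod_cast this
  · have := cv (lastF (TI I)) c
    rw [hsp _ _ (Or.inl rfl), ← hc, ← hmm] at this; exact_mod_cast this
  · have := cv (rowF (TI I) p) O
    rw [hsp _ _ (Or.inr rfl), ha.z] at this; exact_mod_cast this
  · have := cv (lastF (TI I)) O
    rw [hsp _ _ (Or.inl rfl), ha.z, ← hmm] at this; exact_mod_cast this
  have fin : ∀ q k, rowF (TI I) q = rowF (TI I) p → x q = 0 → rowF (TI I) k = lastF (TI I) →
      ((x k = x p ∧ (β = ee p + ee q ∨ β = ee p + ee k)) ∨ (x k = - x p ∧ (β = ee p + ee q ∨ β = ee p - ee k))) →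
      ∃ i j k l : Fin n, InSeg n CType.D (TI I) ((rowF (TI I) p).1 + 1) i ∧ InSeg n CType.D (TI I) ((rowF (TI I) p).1 + 1) j ∧
      InSeg n CType.D (TI I) (mval n (TI I)) k ∧ InSeg n CType.D (TI I) (mval n (TI I)) l ∧
      x j = 0 ∧ x l = 0 ∧
      ((((x i = |x p| ∧ x k = |x p|) ∨ (x i = -|x p| ∧ x k = -|x p|)) ∧
          (β = ee i + ee j ∨ β = ee i + ee k)) ∨
       (((x i = |x p| ∧ x k = -|x p|) ∨ (x i = -|x p| ∧ x k = |x p|)) ∧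
          (β = ee i + ee j ∨ β = ee i - ee k))) := by
    intro q k hq hq0 hk h
    refine ⟨p, q, k, l, (sgm _ _).2 rfl, (sgm _ _).2 hq, by rw [hmm]; exact (sgm _ _).2 hk,
      by rw [hmm]; exact (sgm _ _).2 l1, hq0, l2, ?_⟩
    rcases lt_or_gt_of_ne hp0 with h0 | h0
    · rw [abs_of_neg h0]
      rcases h with ⟨h, hb⟩ | ⟨h, hb⟩
      · exact Or.inl ⟨Or.inr ⟨by ring, by rw [h]; ring⟩, hb⟩
      · exact Or.inr ⟨Or.inr ⟨by ring, by rw [h]⟩, hb⟩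
    · rw [abs_of_pos h0]
      rcases h with ⟨h, hb⟩ | ⟨h, hb⟩
      · exact Or.inl ⟨Or.inl ⟨rfl, h⟩, hb⟩
      · exact Or.inr ⟨Or.inl ⟨rfl, h⟩, hb⟩
  rcases hβ with ⟨q, hq, hq0, hb⟩ | ⟨k, hk, h⟩
  · obtain ⟨k, k1, k2⟩ := ex (lastF (TI I)) c (hsp _ _ (Or.inl rfl))
    refine fin q k hq hq0 k1 ?_
    rw [← hc] at k2
    rcases abs_eq_abs.1 k2 with h | h
    · exact Or.inl ⟨h, Or.inl hb⟩
    · exact Or.inr ⟨h, Or.inl hb⟩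
  · obtain ⟨q, q1, q2⟩ := ex0 (rowF (TI I) p)
    refine fin q k q1 q2 hk ?_
    rcases h with ⟨h, hb⟩ | ⟨h, hb⟩
    · exact Or.inl ⟨h, Or.inr hb⟩
    · exact Or.inr ⟨h, Or.inr hb⟩

lemma inv_B (ha : AH a O) {x : V n}
    (hsp : ∀ r c, (r = lastF (TI I) ∨ c = O) → cnt (rowF (TI I)) a x r c = 1)
    (hxa : ∀ k, ∃ c, |x k| = a c) {i j : Fin n} (hij : i ≠ j)
    (hx : Rg (rowF (TI I)) (lastF (TI I)) x)
    (hy : Rg (rowF (TI I)) (lastF (TI I)) (mv (-1) i j x)) (hj : rowF (TI I) j ≠ lastF (TI I))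
    (i0 : x i = 0) (j0 : x j ≠ 0) : ExcD n (TI I) x (ee j + ee i) := by
  by_cases hr : rowF (TI I) i = rowF (TI I) j
  · refine mkExc I ha hsp hxa hj j0 ?_ (Or.inl ⟨i, hr, i0, rfl⟩)
    intro q hq hqr he
    have hqi : q ≠ i := by rintro rfl; rw [i0, abs_zero] at he; exact j0 (abs_eq_zero.1 he.symm)
    have a1 := (hx q j hq hqr he).2.2
    have a2 := (hy q i hqi (hqr.trans hr.symm) (by rw [mv_o _ _ hqi hq, mv_l, he]; simp)).2
    rw [mv_o _ _ hqi hq, mv_l] at a2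
    exact a2.1 (by linarith [a2.2])
  · exfalso
    obtain ⟨p, p1, p2⟩ := cnt_pos (by rw [hsp (rowF (TI I) j) O (Or.inr rfl)]; norm_num : 0 < cnt (rowF (TI I)) a x (rowF (TI I) j) O)
    rw [ha.z, abs_eq_zero] at p2
    have hpj : p ≠ j := by rintro rfl; exact j0 p2
    have hpi : p ≠ i := by rintro rfl; exact hr p1
    refine (hy p j hpj p1 ?_).2.1 ?_
    · rw [mv_o _ _ hpi hpj, mv_r, i0, p2]; simp
    · rw [mv_o _ _ hpi hpj, p2]

lemma inv_step (ha : AH a O) {x : V n}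
    (hsp : ∀ r c, (r = lastF (TI I) ∨ c = O) → cnt (rowF (TI I)) a x r c = 1)
    (hxa : ∀ k, ∃ c, |x k| = a c) {e : ℝ} (he : e = 1 ∨ e = -1) {i j : Fin n} (hij : i < j)
    (hx : Rg (rowF (TI I)) (lastF (TI I)) x)
    (hy : Rg (rowF (TI I)) (lastF (TI I)) (mv e i j x)) (hne : ¬ ExcD n (TI I) x (rt e i j)) :
    Pst (rowF (TI I)) (lastF (TI I)) (mv e i j x) = Pst (rowF (TI I)) (lastF (TI I)) x := by
  rw [Pst_mv e hij.ne x]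
  by_cases hi : rowF (TI I) i = lastF (TI I)
  · have hj : rowF (TI I) j = lastF (TI I) := by
      have a1 := rowN_mono (TI I) hij.le
      have a2 := rowN_lt (TI I) j
      rw [rowF_L] at hi ⊢; omega
    simp [hi, hj]
  have zi := z2 (sg (x i))
  have zj := z2 (sg (x j))
  by_cases hj : rowF (TI I) j = lastF (TI I)
  · simp only [hi, hj, ne_eq, not_true, not_false_iff, if_true, if_false, add_zero]
    have hab : |x i| = |x j| := by
      by_contra hc
      obtain ⟨c, hxc⟩ := hxa i
      obtain ⟨p, p1, p2⟩ := cnt_pos (by rw [hsp (lastF (TI I)) c (Or.inl rfl)]; norm_num : 0 < cnt (rowF (TI I)) a x (lastF (TI I)) c)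
      have hpj : p ≠ j := by rintro rfl; exact hc (hxc.trans p2.symm)
      have hpi : p ≠ i := by rintro rfl; exact hi p1
      refine (hy p j hpj (p1.trans hj.symm) ?_).1 p1
      rw [mv_o _ _ hpi hpj, mv_r, p2, ← hxc]
      rcases he with rfl | rfl <;> simp
    by_cases h0 : e * x j = x i
    · rw [h0, zi, add_zero]
    · exfalso
      have h1 : e * x j = - x i := by
        rcases he with rfl | rfl <;> rcases abs_eq_abs.1 hab with h | h
        · exact absurd (by rw [h, one_mul]) h0
        · rw [h]; ring
        · rw [h]; ring
        · exact absurd (by rw [h]; ring) h0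
      have i0 : x i ≠ 0 := by intro h; exact h0 (by rw [h1, h, neg_zero])
      refine hne (mkExc I ha hsp hxa hi i0 ?_ (Or.inr ⟨j, hj, ?_⟩))
      · intro q hq hqr hqe
        have hqj : q ≠ j := by rintro rfl; exact hi (hqr.symm.trans hj)
        have a1 := (hx q i hq hqr hqe).2.2
        have a2 := (hy q i hq hqr (by rw [mv_o _ _ hq hqj, mv_l, h1, hqe]; simp)).2
        rw [mv_o _ _ hq hqj, mv_l, h1] at a2
        exact i0 (by linarith [a2.2])
      · rcases he with rfl | rfl
        · exact Or.inr ⟨by linarith, by simp [rt]⟩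
        · exact Or.inl ⟨by linarith, by simp [rt]⟩
  simp only [hi, hj, ne_eq, not_false_iff, if_true]
  rcases he with rfl | rfl
  · rw [one_mul, one_mul]; linear_combination zi + zj
  · have hee : rt (-1) i j = ee j + ee i := by simp [rt, add_comm]
    by_cases i0 : x i = 0
    · by_cases j0 : x j = 0
      · rw [i0, j0]; simp [sg]
      · exact absurd (hee ▸ inv_B I ha hsp hxa hij.ne hx hy hj i0 j0) hne
    · by_cases j0 : x j = 0
      · rw [mv_comm] at hy
        exact absurd (by rw [hee, add_comm]; exact inv_B I ha hsp hxa hij.ne' hx hy hi j0 i0) hne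
      · rw [neg_one_mul, neg_one_mul, sg_neg i0, sg_neg j0]
        linear_combination zi + zj + z2 1

end Ex
end IN

section FinalS
variable {n : ℕ} {I J : Finset (Fin n)} {lbar : V n}

lemma sg_psi (I : Finset (Fin n)) : ∃ c : ZMod 2, ∀ x : V n, (∀ k, x k ≠ 0) →
    ∑ k, sg (psi I x k) = ∑ k, sg (x k) + c := by
  by_cases hs : StandardI n .D I
  · exact ⟨0, fun x _ => by simp [psi, hs]⟩
  · refine ⟨∑ k : Fin n, if k.1 = n - 1 then 1 else 0, fun x hx => ?_⟩
    rw [← Finset.sum_add_distrib]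
    refine Finset.sum_congr rfl fun k _ => ?_
    simp only [psi, hs, if_false, phiW]
    split_ifs
    · exact sg_neg (hx k)
    · simp

lemma conn_NS (X : Cx I J lbar) (hw : ∀ p ∈ DSet n .D I J lbar, IsWeakPair n I J p)
    (hk : kapF (aJ J lbar) lbar (lastF J) = nsval n .D J (mval n J)) (hs : ¬ Spec I J) {x y : V n}
    (hx : x ∈ IWJset n .D I lbar) (hy : y ∈ IWJset n .D I lbar) : Conn n .D I x y := by
  obtain ⟨a1, a2, a3, a4⟩ := orb_Om X hx.1 (IWJ_reg X.h2 hx)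
  obtain ⟨b1, b2, b3, b4⟩ := orb_Om X hy.1 (IWJ_reg X.h2 hy)
  have hxy : WOrb n .D x y := (WIOrb_symm X.h2 hx.1).trans hy.1
  have := RL_NS X.ha (KR_Conn X.h2 I X.ha) a1 b1 a2 b2 (by rw [a3, b3]) ?_
    (fun N hN => hyp_S X hw N (by rw [a3] at hN; exact hN))
    (fun N hN => nspec_hns hk hs N (by rw [a3] at hN; exact hN))
  · have := (this a2).1
    rwa [psi_inv, psi_inv] at this
  · rcases WOrb_sg X.h2 hxy with ⟨⟨k, h⟩, _⟩ | ⟨h, h'⟩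
    · left; refine ⟨k, ?_⟩; rw [← abs_eq_zero, psi_abs, h, abs_zero]
    · right
      rcases WOrb_sg X.h2 (WIOrb_symm X.h2 hxy) with ⟨⟨k, hk⟩, _⟩ | ⟨g, _⟩
      · exact absurd hk (h k)
      · obtain ⟨c, hc⟩ := sg_psi I
        rw [hc x g, hc y h, h']

lemma spec_std (X : Cx I J lbar) (hs : Spec I J) : StandardI n .D I := by
  by_contra h
  obtain ⟨h2, h3, h4⟩ := nonstd h
  have h0 : 0 < nsval n .D I (mval n I) := by rw [hs.1]; have := X.mJ; omega
  rw [nsval_last, Finset.card_pos] at h0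
  obtain ⟨i, hi⟩ := h0
  simp only [Finset.mem_filter, Finset.mem_univ, true_and] at hi
  have := rowL_last h2 (I := TI I) (i := i) (by rw [rowF_L, mval_TI]; exact hi)
  rw [TI, if_neg h, mem_phiIdx, sl1 h2] at this
  exact h3 this

lemma Pst_WI (h2 : 2 ≤ n) (hI : Std2 I) {x y : V n} (h : WIOrb n .D I x y) :
    Pst (rowF I) (lastF I) y = Pst (rowF I) (lastF I) x := by
  induction h with
  | refl => rfl
  | tail _ hb ih =>
    obtain ⟨k, hk, rfl⟩ := hb
    obtain ⟨i, j, e, hij, he, hr, hL, hα⟩ := alpha_row h2 hI hk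
    rw [hα, sRefl_rt he hij, Pst_mv e hij, ih, ← hr]
    rcases hL with rfl | hL
    · split_ifs
      · rw [one_mul, one_mul]
        have z1 := z2 (sg (‹V n› i)); have z3 := z2 (sg (‹V n› j))
        linear_combination z1 + z3
      · simp
    · simp [hL]

lemma Pst_conn (X : Cx I J lbar) (hT : TI I = I) (hst : StandardI n .D I)
    (hk : kapF (aJ J lbar) lbar (lastF J) = nsval n .D J (mval n J)) (hs : Spec I J) {x y : V n}
    (hx : WOrb n .D lbar x) (h : Conn n .D I x y) :
    Pst (rowF (TI I)) (lastF (TI I)) y = Pst (rowF (TI I)) (lastF (TI I)) x := by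
  have hpsi : ∀ z, psi I z = z := fun z => by simp [psi, hst]
  have key : WOrb n .D lbar y ∧ Pst (rowF (TI I)) (lastF (TI I)) y = Pst (rowF (TI I)) (lastF (TI I)) x := by
    replace h := h.2.2
    induction h with
    | refl => exact ⟨hx, rfl⟩
    | @tail u v _ hb ih =>
      obtain ⟨ih1, ih2⟩ := ih
      obtain ⟨hu, hv, h | ⟨β, hβ, h⟩⟩ := hb
      · refine ⟨ih1.trans (WIOrb_mono (Finset.subset_univ _) h), ?_⟩
        rw [← ih2]; exact Pst_WI X.h2 (Std2_TI I) (by rw [hT]; exact h)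
      · rw [LinkedRoot, if_pos hst] at hβ
        obtain ⟨_, hp, _, hr, _, hE⟩ := hβ
        obtain ⟨i, j, e, hij, he, rfl⟩ := pos_cases hp
        rw [sRefl_rt he hij.ne] at hr h
        have ho := WOrb_mv X.h2 he hij.ne u
        obtain ⟨a1, a2, a3, a4⟩ := orb_Om X ih1 hu
        obtain ⟨b1, _⟩ := orb_Om X (ih1.trans ho) hr
        rw [hpsi] at a1 b1
        simp only [hpsi] at a2
        refine ⟨(ih1.trans ho).trans (WIOrb_mono (Finset.subset_univ _) h), ?_⟩
        rw [← ih2, Pst_WI X.h2 (Std2_TI I) (show WIOrb n .D (TI I) _ _ by rw [hT]; exact h)]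
        refine inv_step I X.ha (spec_hsp hk hs _ a4) a2 he hij a1 b1 ?_
        rw [hT]; exact hE
  exact key.2

lemma conn_Sp (X : Cx I J lbar) (hw : ∀ p ∈ DSet n .D I J lbar, IsWeakPair n I J p)
    (hst : StandardI n .D I)
    (hk : kapF (aJ J lbar) lbar (lastF J) = nsval n .D J (mval n J)) (hs : Spec I J) {x y : V n}
    (hx : x ∈ IWJset n .D I lbar) (hy : y ∈ IWJset n .D I lbar)
    (hP : Pst (rowF (TI I)) (lastF (TI I)) x = Pst (rowF (TI I)) (lastF (TI I)) y) : Conn n .D I x y := by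
  have hpsi : ∀ z, psi I z = z := fun z => by simp [psi, hst]
  obtain ⟨a1, a2, a3, a4⟩ := orb_Om X hx.1 (IWJ_reg X.h2 hx)
  obtain ⟨b1, b2, b3, b4⟩ := orb_Om X hy.1 (IWJ_reg X.h2 hy)
  have := RL_Sp X.ha (KR_Conn X.h2 I X.ha) a1 b1 a2 b2 (by rw [a3, b3])
    (by rw [hpsi, hpsi]; exact hP)
    (fun N hN => hyp_S X hw N (by rw [a3] at hN; exact hN))
    (fun N hN => spec_hsp hk hs N (by rw [a3] at hN; exact hN))
  have := (this a2).1
  rwa [psi_inv, psi_inv] at this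

lemma Pst_Pfun (X : Cx I J lbar) (hT : TI I = I)
    (hk : kapF (aJ J lbar) lbar (lastF J) = nsval n .D J (mval n J)) (hs : Spec I J) {x : V n}
    (hx : x ∈ IWJset n .D I lbar) :
    Pst (rowF (TI I)) (lastF (TI I)) x = ((Finset.univ.filter (fun i : Fin n => x i < 0)).card : ZMod 2) := by
  obtain ⟨a1, a2, a3, a4⟩ := orb_Om X hx.1 (IWJ_reg X.h2 hx)
  have h1 := spec_hsp hk hs _ a4 (lastF (TI I)) (lastF J) (Or.inl rfl)
  obtain ⟨p, hp, hp0⟩ := cnt_pos (by rw [h1]; norm_num)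
  rw [aJ_O, abs_eq_zero] at hp0
  have hx' : ∀ k ∈ TI I, 0 < inn x (alphaR n .D k) := by rw [hT]; exact hx.2.2
  have hpos : ∀ k, rowF (TI I) k = lastF (TI I) → 0 ≤ x k := by
    intro k hkL
    rcases lt_trichotomy k p with h | rfl | h
    · have := row_last X.h2 (Std2_TI I) hx' h hkL hp; linarith
    · exact hp0.ge
    · have := row_last X.h2 (Std2_TI I) hx' h hp hkL; linarith
  rw [Pst, Finset.card_filter, Nat.cast_sum]
  refine Finset.sum_congr rfl fun k _ => ?_
  by_cases h : rowF (TI I) k = lastF (TI I)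
  · simp [h, not_lt.2 (hpos k h)]
  · simp [h, sg]

lemma Pst_iff (X : Cx I J lbar) (hT : TI I = I)
    (hk : kapF (aJ J lbar) lbar (lastF J) = nsval n .D J (mval n J)) (hs : Spec I J) {x y : V n}
    (hx : x ∈ IWJset n .D I lbar) (hy : y ∈ IWJset n .D I lbar) :
    Pst (rowF (TI I)) (lastF (TI I)) x = Pst (rowF (TI I)) (lastF (TI I)) y ↔ Pfun n x = Pfun n y := by
  rw [Pst_Pfun X hT hk hs hx, Pst_Pfun X hT hk hs hy, ZMod.natCast_eq_natCast_iff]; rfl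

lemma conn_iff (X : Cx I J lbar) (hw : ∀ p ∈ DSet n .D I J lbar, IsWeakPair n I J p)
    (hk : kapF (aJ J lbar) lbar (lastF J) = nsval n .D J (mval n J)) (hs : Spec I J) {x y : V n}
    (hx : x ∈ IWJset n .D I lbar) (hy : y ∈ IWJset n .D I lbar) :
    Conn n .D I x y ↔ Pfun n x = Pfun n y := by
  have hst := spec_std X hs
  have hT : TI I = I := by simp [TI, hst]
  rw [← Pst_iff X hT hk hs hx hy]
  exact ⟨fun h => (Pst_conn X hT hst hk hs hx.1 h).symm, conn_Sp X hw hst hk hs hx hy⟩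

lemma two_el (X : Cx I J lbar) (hw : ∀ p ∈ DSet n .D I J lbar, IsWeakPair n I J p)
    (hk : kapF (aJ J lbar) lbar (lastF J) = nsval n .D J (mval n J)) (hs : Spec I J) :
    ∃ x ∈ IWJset n .D I lbar, ∃ y ∈ IWJset n .D I lbar, Pfun n x ≠ Pfun n y := by
  have hst := spec_std X hs
  have hT : TI I = I := by simp [TI, hst]
  have hpsi : ∀ z, psi I z = z := fun z => by simp [psi, hst]
  obtain ⟨x, hx, M, hM, hne⟩ := two_N X hw
  obtain ⟨a1, a2, a3, a4⟩ := orb_Om X hx.1 (IWJ_reg X.h2 hx)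
  rw [hpsi] at a1 a3
  simp only [hpsi] at a2
  obtain ⟨y, y1, y2, y3⟩ := spBoth X.ha (KR_WOrb X.h2 (rowF (TI I)) (lastF (TI I)) _ _)
    (fun x i j e he hij => WOrb_mv X.h2 he hij x) a1 a2
    (fun N hN => spec_hsp hk hs N (by rw [a3] at hN; exact hN)) (M := M) (by rw [a3]; exact hM) hne
  obtain ⟨z, z1, z2⟩ := dom_ex X.h2 (Std2_TI I) y1
  have hoz : WOrb n .D x z := y2.trans (WIOrb_mono (Finset.subset_univ _) z1)
  have hz : z ∈ IWJset n .D I lbar := ⟨hx.1.trans hoz, WOrb_int X.h2 hoz hx.2.1, by rw [hT] at z2; exact z2⟩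
  refine ⟨x, hx, z, hz, fun h => y3 ?_⟩
  rw [← Pst_WI X.h2 (Std2_TI I) z1]
  exact ((Pst_iff X hT hk hs hx hz).2 h).symm

lemma one_bl (hne : (IWJset n .D I lbar).Nonempty)
    (h : ∀ x ∈ IWJset n .D I lbar, ∀ y ∈ IWJset n .D I lbar, Conn n .D I x y) :
    (BlockSet n .D I lbar).ncard = 1 := by
  rw [Set.ncard_eq_one]
  refine ⟨IWJset n .D I lbar, ?_⟩
  have : ∀ x ∈ IWJset n .D I lbar, {mu | mu ∈ IWJset n .D I lbar ∧ Conn n .D I x mu} = IWJset n .D I lbar :=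
    fun x hx => Set.ext fun y => ⟨fun hy => hy.1, fun hy => ⟨hy, h x hx y hy⟩⟩
  ext Cl
  simp only [BlockSet, Set.mem_setOf_eq, Set.mem_singleton_iff]
  constructor
  · rintro ⟨x, hx, rfl⟩; exact this x hx
  · rintro rfl; obtain ⟨x, hx⟩ := hne; exact ⟨x, hx, (this x hx).symm⟩

lemma two_bl (h : ∀ x ∈ IWJset n .D I lbar, ∀ y ∈ IWJset n .D I lbar, (Conn n .D I x y ↔ Pfun n x = Pfun n y))
    {x y : V n} (hx : x ∈ IWJset n .D I lbar) (hy : y ∈ IWJset n .D I lbar) (hxy : Pfun n x ≠ Pfun n y) :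
    (BlockSet n .D I lbar).ncard = 2 := by
  rw [Set.ncard_eq_two]
  have hc : ∀ u ∈ IWJset n .D I lbar, {mu | mu ∈ IWJset n .D I lbar ∧ Conn n .D I u mu} =
      {mu | mu ∈ IWJset n .D I lbar ∧ Pfun n u = Pfun n mu} := fun u hu =>
    Set.ext fun v => ⟨fun hv => ⟨hv.1, (h u hu v hv.1).1 hv.2⟩, fun hv => ⟨hv.1, (h u hu v hv.1).2 hv.2⟩⟩
  refine ⟨{mu | mu ∈ IWJset n .D I lbar ∧ Pfun n x = Pfun n mu},
    {mu | mu ∈ IWJset n .D I lbar ∧ Pfun n y = Pfun n mu}, ?_, ?_⟩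
  · intro he
    have : x ∈ {mu | mu ∈ IWJset n .D I lbar ∧ Pfun n y = Pfun n mu} := by rw [← he]; exact ⟨hx, rfl⟩
    exact hxy this.2.symm
  · have hlt : ∀ u, Pfun n u < 2 := fun u => Nat.mod_lt _ (by norm_num)
    ext Cl
    simp only [BlockSet, Set.mem_setOf_eq, Set.mem_insert_iff, Set.mem_singleton_iff]
    constructor
    · rintro ⟨u, hu, rfl⟩
      rw [hc u hu]
      have h1 := hlt u; have h2 := hlt x; have h3 := hlt y
      rcases (show Pfun n u = Pfun n x ∨ Pfun n u = Pfun n y by omega) with h | h <;> rw [h] <;> simp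
    · rintro (rfl | rfl)
      · exact ⟨x, hx, (hc x hx).symm⟩
      · exact ⟨y, hy, (hc y hy).symm⟩

lemma gen_case (X : Cx I J lbar) (hk : kapF (aJ J lbar) lbar (lastF J) = nsval n .D J (mval n J))
    (hne : (IWJset n .D I lbar).Nonempty) :
    (¬ SepSys n .D I J lbar → (BlockSet n .D I lbar).ncard = 1) ∧
    (WeaklySepSys n .D I J lbar →
      (Spec I J → (BlockSet n .D I lbar).ncard = 2) ∧ (¬ Spec I J → (BlockSet n .D I lbar).ncard = 1)) ∧
    (WeaklySepSys n .D I J lbar → (BlockSet n .D I lbar).ncard = 2 →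
      ∀ lam ∈ IWJset n .D I lbar, ∀ mu ∈ IWJset n .D I lbar,
        (Conn n .D I lam mu ↔ Pfun n lam = Pfun n mu)) := by
  refine ⟨fun h => ?_, fun h => ⟨fun hs => ?_, fun hs => ?_⟩, fun h h2 lam hl mu hm => ?_⟩
  · exact one_bl hne fun x hx y hy => conn_NS X (fun p hp => absurd ⟨p, hp⟩ h) hk (fun hs => h (spec_sep X hk hs)) hx hy
  · obtain ⟨x, hx, y, hy, hxy⟩ := two_el X h.2 hk hs
    exact two_bl (fun x hx y hy => conn_iff X h.2 hk hs hx hy) hx hy hxy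
  · exact one_bl hne fun x hx y hy => conn_NS X h.2 hk hs hx hy
  · by_cases hs : Spec I J
    · exact conn_iff X h.2 hk hs hl hm
    · rw [one_bl hne fun x hx y hy => conn_NS X h.2 hk hs hx hy] at h2
      omega

lemma D1_reg (x : V 1) (K : Finset (Fin 1)) : RegI 1 .D K x := by
  rintro β ⟨⟨i, j, hij, _⟩, _⟩
  exact absurd (Subsingleton.elim i j) hij

lemma D1_al (i : Fin 1) : alphaR 1 .D i = fun _ => 2 := by
  funext k
  rw [Subsingleton.elim i 0, Subsingleton.elim k 0]
  simp [alphaR, ee]; norm_num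

lemma D1_orb {K : Finset (Fin 1)} {x y : V 1} (h : WIOrb 1 .D K x y) : |y 0| = |x 0| := by
  induction h with
  | refl => rfl
  | tail _ hb ih =>
    obtain ⟨k, _, rfl⟩ := hb
    rw [← ih, D1_al, sRefl]
    simp [inn]
    rw [← abs_neg]; congr 1; ring

lemma m1_case (hm : ¬ 1 < mval n I) (h : ∀ x ∈ IWJset n .D I lbar, ∀ y ∈ IWJset n .D I lbar, Conn n .D I x y)
    (hne : (IWJset n .D I lbar).Nonempty) :
    (¬ SepSys n .D I J lbar → (BlockSet n .D I lbar).ncard = 1) ∧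
    (WeaklySepSys n .D I J lbar →
      (Spec I J → (BlockSet n .D I lbar).ncard = 2) ∧ (¬ Spec I J → (BlockSet n .D I lbar).ncard = 1)) ∧
    (WeaklySepSys n .D I J lbar → (BlockSet n .D I lbar).ncard = 2 →
      ∀ lam ∈ IWJset n .D I lbar, ∀ mu ∈ IWJset n .D I lbar,
        (Conn n .D I lam mu ↔ Pfun n lam = Pfun n mu)) := by
  have hw : ¬ WeaklySepSys n .D I J lbar := by
    rintro ⟨⟨p, hp⟩, _⟩
    obtain ⟨x, hx⟩ := hne
    exact hm (hp x hx).2.2.2.2.1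
  exact ⟨fun _ => one_bl hne h, fun h => absurd h hw, fun h => absurd h hw⟩

lemma D1_case (I J : Finset (Fin 1)) (lbar : V 1)
    (hJ : ∀ i : Fin 1, i ∈ J ↔ inn lbar (alphaR 1 CType.D i) = 0)
    (hA : 0 < aval 1 CType.D J lbar (mval 1 J - 1))
    (hne : (IWJset 1 CType.D I lbar).Nonempty) :
    (¬ SepSys 1 .D I J lbar → (BlockSet 1 .D I lbar).ncard = 1) ∧
    (WeaklySepSys 1 .D I J lbar →
      (Spec I J → (BlockSet 1 .D I lbar).ncard = 2) ∧ (¬ Spec I J → (BlockSet 1 .D I lbar).ncard = 1)) ∧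
    (WeaklySepSys 1 .D I J lbar → (BlockSet 1 .D I lbar).ncard = 2 →
      ∀ lam ∈ IWJset 1 .D I lbar, ∀ mu ∈ IWJset 1 .D I lbar,
        (Conn 1 .D I lam mu ↔ Pfun 1 lam = Pfun 1 mu)) := by
  have hst : ∀ K : Finset (Fin 1), StandardI 1 .D K := fun K _ h => absurd h (by norm_num)
  have hfs : ∀ K : Finset (Fin 1), (0 : Fin 1) ∉ K → K = ∅ := fun K h => by
    ext i; rw [Subsingleton.elim i 0]; simpa using h
  have hq1 : Qlist 1 (∅ : Finset (Fin 1)) = [1] := by simp [Qlist]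
  have hm1 : mval 1 (∅ : Finset (Fin 1)) = 2 := by simp [mval, hq1]
  by_cases h0 : (0 : Fin 1) ∈ I
  · refine m1_case ?_ ?_ hne
    · have : Finset.univ \ I = ∅ := by ext i; rw [Subsingleton.elim i 0]; simpa using h0
      rw [mval_eq, this]; simp
    · intro x hx y hy
      have px := hx.2.2 0 h0
      have py := hy.2.2 0 h0
      have ex := D1_orb hx.1
      have ey := D1_orb hy.1
      simp [D1_al, inn] at px py
      rw [abs_of_pos px] at ex
      rw [abs_of_pos py] at ey
      have : x = y := funext fun i => by rw [Subsingleton.elim i 0, ex, ey]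
      subst this
      exact ⟨D1_reg _ _, D1_reg _ _, .refl⟩
  · have hI := hfs I h0
    subst hI
    have hJ0 : J = ∅ := by
      apply hfs
      intro h
      have h1 := (hJ 0).1 h
      have hJu : Finset.univ \ J = ∅ := by ext i; rw [Subsingleton.elim i 0]; simpa using h
      have hmJ : mval 1 J = 1 := by rw [mval_eq, hJu]; simp
      have hl : lbar = 0 := by
        funext i; rw [Subsingleton.elim i 0]
        simpa [D1_al, inn] using h1
      subst hl
      simp [aval] at hA
    subst hJ0
    have hd : (({1} : Finset ℕ), ({1} : Finset ℕ)) ∈ DSet 1 .D (∅ : Finset (Fin 1)) ∅ lbar := by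
      intro x hx
      refine ⟨⟨1, by simp⟩, ⟨1, by simp⟩, by simp [hm1], by simp [hm1], by rw [hm1]; norm_num, by rw [hm1]; norm_num, ?_, ?_, ?_⟩
      · intro s hs t ht mu hmu _
        refine le_of_eq ?_
        unfold nsl
        congr 1; ext i; rw [Subsingleton.elim i 0, Finset.mem_filter, Finset.mem_filter, D1_orb hmu]
      · intro s hs hs' t ht ht'
        simp [hm1] at hs hs'
        have : s = 2 := by omega
        subst this
        rw [nsl, Finset.card_eq_zero, Finset.filter_eq_empty_iff]
        rintro i _ ⟨⟨h1, _⟩, _⟩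
        simp [qv, hst, qval, hm1, hq1] at h1
      · show _ ∈ ({1} : Finset ℕ) ↔ _ ∈ ({1} : Finset ℕ)
        simp [hm1]
    have hnw : ¬ WeaklySepSys 1 .D (∅ : Finset (Fin 1)) ∅ lbar := by
      intro h
      have := h.2 _ hd
      rcases this with h | h | h | h <;> obtain ⟨h, h'⟩ := Prod.ext_iff.1 h <;> simp [hm1] at h h'
    exact ⟨fun h => absurd ⟨_, hd⟩ h, fun h => absurd h hnw, fun h => absurd h hnw⟩
end FinalS

theorem final (n : ℕ) (I J : Finset (Fin n)) (lbar : V n)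
    (hdom : DominantW n CType.D lbar)
    (hJ : ∀ i : Fin n, i ∈ J ↔ inn lbar (alphaR n CType.D i) = 0)
    (hA : 0 < aval n CType.D J lbar (mval n J - 1))
    (hne : (IWJset n CType.D I lbar).Nonempty) :
    (¬ SepSys n .D I J lbar → (BlockSet n .D I lbar).ncard = 1) ∧
    (WeaklySepSys n .D I J lbar →
      (Spec I J → (BlockSet n .D I lbar).ncard = 2) ∧ (¬ Spec I J → (BlockSet n .D I lbar).ncard = 1)) ∧
    (WeaklySepSys n .D I J lbar → (BlockSet n .D I lbar).ncard = 2 →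
      ∀ lam ∈ IWJset n .D I lbar, ∀ mu ∈ IWJset n .D I lbar,
        (Conn n .D I lam mu ↔ Pfun n lam = Pfun n mu)) := by
  rcases (show n = 0 ∨ n = 1 ∨ 2 ≤ n by omega) with rfl | rfl | h2
  · exfalso
    unfold aval at hA
    split_ifs at hA with h1 h2
    · omega
    · exact lt_irrefl _ hA
    · exact lt_irrefl _ hA
  · exact D1_case I J lbar hJ hA hne
  · have hS := J_std h2 hdom hJ hA
    have hAH := J_AH h2 hdom hJ hS hA
    by_cases hm : 1 < mval n I
    · exact gen_case ⟨h2, hAH.1, fun k => ⟨_, hAH.2 k⟩, J_m h2 hJ hS hA, hm⟩ (kap_O h2 hdom hJ hS hA) hne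
    · refine m1_case hm ?_ hne
      intro x hx y hy
      have hI : I = Finset.univ := by
        rw [mval_eq] at hm
        have : Finset.univ \ I = ∅ := Finset.card_eq_zero.1 (by omega)
        exact Finset.eq_univ_of_forall fun i => by
          by_contra h
          have h' : i ∈ Finset.univ \ I := by simp [h]
          rw [this] at h'; simp at h'
      refine ConnStep_Conn ⟨IWJ_reg h2 hx, IWJ_reg h2 hy, Or.inl ?_⟩
      subst hI
      exact (WIOrb_symm h2 hx.1).trans hy.1

/-- Theorem 6.16 / `bkswthm3`. -/
theorem statement17 (n : ℕ) (I J : Finset (Fin n)) (lbar : V n)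
    (hdom : DominantW n CType.D lbar) (hint : IntegralW n CType.D lbar)
    (hJ : ∀ i : Fin n, i ∈ J ↔ inn lbar (alphaR n CType.D i) = 0)
    (hA : 0 < aval n CType.D J lbar (mval n J - 1))
    (hne : (IWJset n CType.D I lbar).Nonempty) :
    (¬ SepSys n CType.D I J lbar → (BlockSet n CType.D I lbar).ncard = 1) ∧
    (WeaklySepSys n CType.D I J lbar →
      ((nsval n CType.D I (mval n I) = mval n J ∧
        nsval n CType.D J (mval n J) = mval n I) →
         (BlockSet n CType.D I lbar).ncard = 2) ∧
      (¬ (nsval n CType.D I (mval n I) = mval n J ∧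
          nsval n CType.D J (mval n J) = mval n I) →
         (BlockSet n CType.D I lbar).ncard = 1)) ∧
    (WeaklySepSys n CType.D I J lbar → (BlockSet n CType.D I lbar).ncard = 2 →
      ∀ lam ∈ IWJset n CType.D I lbar, ∀ mu ∈ IWJset n CType.D I lbar,
        (Conn n CType.D I lam mu ↔ Pfun n lam = Pfun n mu)) := by
  exact final n I J lbar hdom hJ hA hne

end JantzenBlocks
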